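/- arXiv:2605.27623 — 2 statements merged into one kernel-verified Lean document; each statement's English description precedes it below -/
import Mathlib

section
/- Let d ≥ 1 be an integer. For a general pencil of plane curves of degree d over ℂ spanned by forms F and G, the number of points [λ:μ] ∈ ℙ¹ such that the curve {λF + μG = 0} is singular (i.e., there is a point of ℙ² at which all three first partial derivatives of λF + μG vanish) is exactly 3(d−1)². -/
noncomputable section

/-- The restriction of the form `F` to the line through `[v]` and `[w]`,
parametrized by `t ↦ v + t • w`, as a polynomial in `t`. -/
def linePoly (F : MvPolynomial (Fin 3) ℂ) (v w : Fin 3 → ℂ) : Polynomial ℂ :=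
  MvPolynomial.aeval (fun i => Polynomial.C (v i) + Polynomial.X * Polynomial.C (w i)) F

/-- The line through the two (projectively distinct) points `[v]`, `[w]` has contact
order at least `m` with the curve `{F = 0}` at the point `[v]`. -/
def ContactLE (F : MvPolynomial (Fin 3) ℂ) (v w : Fin 3 → ℂ) (m : ℕ) : Prop :=
  (Polynomial.X : Polynomial ℂ) ^ m ∣ linePoly F v w

/-- The member of the pencil spanned by `F` and `G` corresponding to `c ∈ ℙ¹`. -/
def pencilMember (F G : MvPolynomial (Fin 3) ℂ) (c : Projectivization ℂ (Fin 2 → ℂ)) :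
    MvPolynomial (Fin 3) ℂ :=
  c.rep 0 • F + c.rep 1 • G

/-- The coefficient vector of a pair of forms. -/
def coeffs2 (F G : MvPolynomial (Fin 3) ℂ) : (Fin 3 →₀ ℕ) ⊕ (Fin 3 →₀ ℕ) → ℂ :=
  Sum.elim (fun m => MvPolynomial.coeff m F) (fun m => MvPolynomial.coeff m G)

/-- The set of singular members of the pencil spanned by `F` and `G`: those members whose
defining form has a point of `ℙ²` at which all three first partial derivatives vanish. -/
def singularMembers (F G : MvPolynomial (Fin 3) ℂ) :
    Set (Projectivization ℂ (Fin 2 → ℂ)) :=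
  {c | ∃ v : Fin 3 → ℂ, v ≠ 0 ∧
    ∀ i : Fin 3, MvPolynomial.eval v (MvPolynomial.pderiv i (pencilMember F G c)) = 0}


set_option linter.unusedVariables false


namespace SMC
open MvPolynomial Matrix

abbrev S := MvPolynomial (Fin 3) ℂ
abbrev H (n : ℕ) : Submodule ℂ S := homogeneousSubmodule (Fin 3) ℂ n
abbrev Dg (n : ℕ) := {m : Fin 3 →₀ ℕ // m ∈ (Finset.univ : Finset (Fin 3)).finsuppAntidiag n}

lemma mem_dg {n : ℕ} {m : Fin 3 →₀ ℕ} :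
    m ∈ (Finset.univ : Finset (Fin 3)).finsuppAntidiag n ↔ m.degree = n := by
  simp [Finset.mem_finsuppAntidiag, Finsupp.degree_eq_sum]

lemma card_dg (n : ℕ) : 2 * Fintype.card (Dg n) = (n + 1) * (n + 2) := by
  have h := Finset.card_finsuppAntidiag_nat_eq_choose (s := (Finset.univ : Finset (Fin 3))) n
  have h2 : Fintype.card (Dg n) = (n + 2).choose 2 := by
    rw [Fintype.card_coe, h]
    simp only [Finset.card_univ, Fintype.card_fin]
    rw [show 3 + n - 1 = n + 2 by omega, Nat.choose_symm_add]
  rw [h2, Nat.choose_two_right]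
  have := Nat.even_mul_pred_self (n + 2)
  rw [Nat.mul_div_cancel' this.two_dvd]
  simp; ring

/-- coordinates on forms of degree n -/
def coord (n : ℕ) : H n ≃ₗ[ℂ] (Dg n → ℂ) where
  toFun h m := coeff m.1 h.1
  map_add' a b := by ext; simp
  map_smul' a b := by ext; simp
  invFun a := ⟨∑ m : Dg n, monomial m.1 (a m), by
    apply Submodule.sum_mem
    intro m _
    exact isHomogeneous_monomial _ (mem_dg.1 m.2)⟩
  left_inv h := by
    ext m
    simp only [coeff_sum, coeff_monomial]
    by_cases hm : m.degree = n
    · rw [Finset.sum_eq_single ⟨m, mem_dg.2 hm⟩]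
      · simp
      · intro b _ hb
        rw [if_neg]
        rintro rfl
        exact hb rfl
      · simp
    · have h2 : coeff m h.1 = 0 := IsHomogeneous.coeff_eq_zero h.2 hm
      rw [h2]
      apply Finset.sum_eq_zero
      intro b _
      rw [if_neg]
      rintro rfl
      exact hm (mem_dg.1 b.2)
  right_inv a := by
    ext m
    simp only [coeff_sum, coeff_monomial]
    rw [Finset.sum_eq_single m]
    · simp
    · intro b _ hb
      rw [if_neg]
      intro h
      exact hb (Subtype.ext h)
    · simp

instance (n : ℕ) : FiniteDimensional ℂ (H n) := (coord n).symm.finiteDimensional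

lemma finrank_H (n : ℕ) : Module.finrank ℂ (H n) = Fintype.card (Dg n) := by
  rw [(coord n).finrank_eq, Module.finrank_fintype_fun_eq_card]

lemma two_finrank_H (n : ℕ) : 2 * Module.finrank ℂ (H n) = (n + 1) * (n + 2) := by
  rw [finrank_H, card_dg]

section generic
variable {R : Type*} [CommRing R]

def grad (F : MvPolynomial (Fin 3) R) : Fin 3 → MvPolynomial (Fin 3) R := fun i => pderiv i F
def Mn (F G : MvPolynomial (Fin 3) R) : Fin 3 → MvPolynomial (Fin 3) R :=
  crossProduct (grad F) (grad G)
def dir (F : MvPolynomial (Fin 3) R) : MvPolynomial (Fin 3) R :=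
  pderiv 0 F + pderiv 1 F - pderiv 2 F

end generic

lemma hom_grad {F : S} {e : ℕ} (hF : F.IsHomogeneous (e + 1)) (i : Fin 3) :
    (grad F i).IsHomogeneous e := by
  exact hF.pderiv (i := i)

lemma hom_dir {F : S} {e : ℕ} (hF : F.IsHomogeneous (e + 1)) : (dir F).IsHomogeneous e :=
  ((hom_grad hF 0).add (hom_grad hF 1)).sub (hom_grad hF 2)

lemma hom_Mn {F G : S} {e : ℕ} (hF : F.IsHomogeneous (e + 1)) (hG : G.IsHomogeneous (e + 1))
    (i : Fin 3) : (Mn F G i).IsHomogeneous (2 * e) := by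
  have key : ∀ i j k l, (grad F i * grad G j - grad F k * grad G l).IsHomogeneous (2 * e) := by
    intro i j k l
    rw [two_mul]
    exact ((hom_grad hF i).mul (hom_grad hG j)).sub ((hom_grad hF k).mul (hom_grad hG l))
  fin_cases i <;> simp [Mn, cross_apply] <;> apply key

/-- α ↦ α · M -/
def dotM (F G : S) : (Fin 3 → S) →ₗ[ℂ] S where
  toFun α := α ⬝ᵥ Mn F G
  map_add' a b := by simp
  map_smul' a b := by simp

lemma dotM_apply (F G : S) (α : Fin 3 → S) : dotM F G α = α ⬝ᵥ Mn F G := rfl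

def Hv (n : ℕ) : Submodule ℂ (Fin 3 → S) := Submodule.pi Set.univ (fun _ => H n)

lemma mem_Hv {n : ℕ} {α : Fin 3 → S} : α ∈ Hv n ↔ ∀ i, (α i).IsHomogeneous n := by
  simp [Hv, Submodule.mem_pi]

def HvEquiv (n : ℕ) : Hv n ≃ₗ[ℂ] (Fin 3 → H n) where
  toFun α i := ⟨α.1 i, mem_Hv.1 α.2 i⟩
  map_add' a b := rfl
  map_smul' a b := rfl
  invFun α := ⟨fun i => (α i).1, mem_Hv.2 fun i => (α i).2⟩
  left_inv a := rfl
  right_inv a := rfl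

instance (n : ℕ) : FiniteDimensional ℂ (Hv n) := (HvEquiv n).symm.finiteDimensional

lemma finrank_Hv (n : ℕ) : Module.finrank ℂ (Hv n) = 3 * Module.finrank ℂ (H n) := by
  rw [(HvEquiv n).finrank_eq, Module.finrank_pi_fintype]
  simp

/-- The degree m+2e part of the ideal of minors -/
def J (F G : S) (m : ℕ) : Submodule ℂ S := (Hv m).map (dotM F G)

instance (F G : S) (m : ℕ) : FiniteDimensional ℂ (J F G m) := by
  unfold J; infer_instance

lemma mem_J {F G : S} {m : ℕ} {h : S} :
    h ∈ J F G m ↔ ∃ α : Fin 3 → S, (∀ i, (α i).IsHomogeneous m) ∧ α ⬝ᵥ Mn F G = h := by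
  simp [J, mem_Hv, dotM_apply]

lemma J_le {F G : S} {e : ℕ} (hF : F.IsHomogeneous (e + 1)) (hG : G.IsHomogeneous (e + 1))
    (m : ℕ) : J F G m ≤ H (m + 2 * e) := by
  intro h hh
  obtain ⟨α, hα, rfl⟩ := mem_J.1 hh
  exact IsHomogeneous.sum _ _ _ fun i _ => (hα i).mul (hom_Mn hF hG i)

lemma J_mul {F G : S} {m n : ℕ} {h p : S} (hh : h ∈ J F G m) (hp : p.IsHomogeneous n) :
    p * h ∈ J F G (n + m) := by
  obtain ⟨α, hα, rfl⟩ := mem_J.1 hh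
  refine mem_J.2 ⟨fun i => p * α i, fun i => hp.mul (hα i), ?_⟩
  simp [dotProduct, Finset.mul_sum, mul_assoc]

/-- the two syzygies -/
def syz (F G : S) : (S × S) →ₗ[ℂ] (Fin 3 → S) where
  toFun p i := p.1 * grad F i + p.2 * grad G i
  map_add' a b := by ext1 i; simp; ring
  map_smul' a b := by ext1 i; simp

lemma syz_dot (F G : S) (p : S × S) : syz F G p ⬝ᵥ Mn F G = 0 := by
  have h1 : grad F ⬝ᵥ Mn F G = 0 := dot_self_cross _ _
  have h2 : grad G ⬝ᵥ Mn F G = 0 := dot_cross_self _ _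
  have : syz F G p = p.1 • grad F + p.2 • grad G := by ext1 i; simp [syz]
  rw [this, add_dotProduct, smul_dotProduct, smul_dotProduct, h1, h2]; simp

lemma syz_inj {F G : S} (hM : Mn F G ≠ 0) : Function.Injective (syz F G) := by
  rw [injective_iff_map_eq_zero]
  rintro ⟨p, q⟩ h
  have this : p • grad F + q • grad G = 0 := by
    rw [← h]; ext1 i; simp [syz]
  have h1 : p • Mn F G = 0 := by
    have := congrArg (fun v => crossProduct v (grad G)) this
    simpa [cross_self, Mn] using this
  have h2 : q • Mn F G = 0 := by
    have := congrArg (fun v => crossProduct (grad F) v) this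
    simpa [cross_self, Mn] using this
  obtain ⟨i, hi⟩ := Function.ne_iff.1 hM
  have e1 := congrFun h1 i
  have e2 := congrFun h2 i
  simp only [Pi.smul_apply, smul_eq_mul, Pi.zero_apply, mul_eq_zero] at e1 e2 hi
  simp [e1.resolve_right hi, e2.resolve_right hi]

def syzR (F G : S) {e : ℕ} (hF : F.IsHomogeneous (e + 1)) (hG : G.IsHomogeneous (e + 1)) (l : ℕ) :
    (H l × H l) →ₗ[ℂ] LinearMap.ker ((dotM F G).domRestrict (Hv (l + e))) where
  toFun p := ⟨⟨syz F G (p.1.1, p.2.1), mem_Hv.2 fun i =>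
      (p.1.2.mul (hom_grad hF i)).add (p.2.2.mul (hom_grad hG i))⟩, by
      simp [dotM_apply, syz_dot]⟩
  map_add' a b := by
    apply Subtype.ext; apply Subtype.ext
    exact (syz F G).map_add (a.1.1, a.2.1) (b.1.1, b.2.1)
  map_smul' a b := by
    apply Subtype.ext; apply Subtype.ext
    exact (syz F G).map_smul a (b.1.1, b.2.1)

lemma rank_null (F G : S) (n : ℕ) :
    Module.finrank ℂ (J F G n) + Module.finrank ℂ (LinearMap.ker ((dotM F G).domRestrict (Hv n)))
      = 3 * Module.finrank ℂ (H n) := by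
  rw [← finrank_Hv, ← LinearMap.finrank_range_add_finrank_ker ((dotM F G).domRestrict (Hv n)),
    LinearMap.range_domRestrict]
  rfl

lemma count (l e : ℕ) : Module.finrank ℂ (H (l + e + 2 * e)) + 2 * Module.finrank ℂ (H l) =
    3 * Module.finrank ℂ (H (l + e)) + 3 * e ^ 2 := by
  have h1 := two_finrank_H (l + e + 2 * e)
  have h2 := two_finrank_H l
  have h3 := two_finrank_H (l + e)
  nlinarith

/-- codimension of J is at least 3e² -/
lemma finrank_J_le {F G : S} {e : ℕ} (hF : F.IsHomogeneous (e + 1)) (hG : G.IsHomogeneous (e + 1))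
    (hM : Mn F G ≠ 0) (l : ℕ) :
    Module.finrank ℂ (J F G (l + e)) + 3 * e ^ 2 ≤ Module.finrank ℂ (H (l + e + 2 * e)) := by
  have h := rank_null F G (l + e)
  have hi : Function.Injective (syzR F G hF hG l) := by
    intro a b hab
    have h1 : syz F G (a.1.1, a.2.1) = syz F G (b.1.1, b.2.1) :=
      congrArg (fun x => x.1.1) hab
    have h2 := syz_inj hM h1
    simp only [Prod.mk.injEq] at h2
    exact Prod.ext (Subtype.ext h2.1) (Subtype.ext h2.2)
  have h2 := LinearMap.finrank_le_finrank_of_injective hi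
  rw [Module.finrank_prod] at h2
  have := count l e
  omega

/-- equality if all syzygies are the obvious ones -/
lemma finrank_J_ge {F G : S} {e : ℕ} (hF : F.IsHomogeneous (e + 1)) (hG : G.IsHomogeneous (e + 1))
    (l : ℕ) (hs : ∀ α : Fin 3 → S, (∀ i, (α i).IsHomogeneous (l + e)) → α ⬝ᵥ Mn F G = 0 →
      ∃ p q : S, p.IsHomogeneous l ∧ q.IsHomogeneous l ∧ α = syz F G (p, q)) :
    Module.finrank ℂ (H (l + e + 2 * e)) ≤ Module.finrank ℂ (J F G (l + e)) + 3 * e ^ 2 := by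
  have h := rank_null F G (l + e)
  have hi : Function.Surjective (syzR F G hF hG l) := by
    rintro ⟨⟨α, hα⟩, h⟩
    obtain ⟨p, q, hp, hq, rfl⟩ := hs α (mem_Hv.1 hα) (by simpa [dotM_apply] using h)
    exact ⟨(⟨p, hp⟩, ⟨q, hq⟩), rfl⟩
  have h2 := LinearMap.finrank_le_finrank_of_surjective hi
  rw [Module.finrank_prod] at h2
  have := count l e
  omega

end SMC


namespace SMC
open MvPolynomial Matrix

section lin
variable {A A' B B' : Submodule ℂ S} [FiniteDimensional ℂ B] [FiniteDimensional ℂ B']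
  {T : S →ₗ[ℂ] S}

def qmap (hB : ∀ h ∈ B, T h ∈ B') (hA : ∀ h ∈ A, T h ∈ A') :
    (B ⧸ A.submoduleOf B) →ₗ[ℂ] (B' ⧸ A'.submoduleOf B') :=
  Submodule.mapQ _ _ (T.restrict hB) (by
    intro h hh
    exact hA _ hh)

lemma finrank_q (h : A ≤ B) :
    Module.finrank ℂ (B ⧸ A.submoduleOf B) + Module.finrank ℂ A = Module.finrank ℂ B := by
  rw [← Submodule.finrank_quotient_add_finrank (A.submoduleOf B),
    (Submodule.submoduleOfEquivOfLe h).finrank_eq]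

lemma qmap_surj (hB : ∀ h ∈ B, T h ∈ B') (hA : ∀ h ∈ A, T h ∈ A') (hA' : A' ≤ B') :
    Function.Surjective (qmap hB hA) ↔ B' ≤ A' ⊔ B.map T := by
  constructor
  · intro h b hb
    obtain ⟨x, hx⟩ := h (Submodule.Quotient.mk ⟨b, hb⟩)
    obtain ⟨x, rfl⟩ := Submodule.Quotient.mk_surjective _ x
    have h2 : Submodule.Quotient.mk (p := A'.submoduleOf B') (T.restrict hB x) = Submodule.Quotient.mk ⟨b, hb⟩ := hx
    rw [Submodule.Quotient.eq] at h2
    have h3 : T x.1 - b ∈ A' := h2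
    rw [show b = -(T x.1 - b) + T x.1 by abel]
    exact Submodule.add_mem _ (Submodule.mem_sup_left (Submodule.neg_mem _ h3))
      (Submodule.mem_sup_right ⟨x.1, x.2, rfl⟩)
  · intro h y
    obtain ⟨⟨b, hb⟩, rfl⟩ := Submodule.Quotient.mk_surjective _ y
    obtain ⟨a, ha, c, ⟨x, hx, rfl⟩, habc⟩ := Submodule.mem_sup.1 (h hb)
    refine ⟨Submodule.Quotient.mk ⟨x, hx⟩, ?_⟩
    change Submodule.Quotient.mk (p := A'.submoduleOf B') (T.restrict hB ⟨x, hx⟩) = _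
    rw [Submodule.Quotient.eq]
    change T x - b ∈ A'
    rw [← habc]
    simpa using ha

lemma qmap_inj (hB : ∀ h ∈ B, T h ∈ B') (hA : ∀ h ∈ A, T h ∈ A') :
    Function.Injective (qmap hB hA) ↔ ∀ h ∈ B, T h ∈ A' → h ∈ A := by
  rw [injective_iff_map_eq_zero]
  constructor
  · intro h b hb hT
    have := h (Submodule.Quotient.mk ⟨b, hb⟩) (by
      change Submodule.Quotient.mk (p := A'.submoduleOf B') (T.restrict hB ⟨b, hb⟩) = 0
      rw [Submodule.Quotient.mk_eq_zero]
      exact hT)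
    rw [Submodule.Quotient.mk_eq_zero] at this
    exact this
  · intro h y hy
    obtain ⟨⟨b, hb⟩, rfl⟩ := Submodule.Quotient.mk_surjective _ y
    replace hy : Submodule.Quotient.mk (p := A'.submoduleOf B') (T.restrict hB ⟨b, hb⟩) = 0 := hy
    rw [Submodule.Quotient.mk_eq_zero] at hy ⊢
    exact h b hb hy

lemma lin_iff (hB : ∀ h ∈ B, T h ∈ B') (hA : ∀ h ∈ A, T h ∈ A') (hAB : A ≤ B) (hA' : A' ≤ B')
    (hd : Module.finrank ℂ B + Module.finrank ℂ A' = Module.finrank ℂ B' + Module.finrank ℂ A) :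
    B' ≤ A' ⊔ B.map T ↔ ∀ h ∈ B, T h ∈ A' → h ∈ A := by
  rw [← qmap_surj hB hA hA', ← qmap_inj hB hA]
  refine (LinearMap.injective_iff_surjective_of_finrank_eq_finrank ?_).symm
  have := finrank_q hAB
  have := finrank_q hA'
  omega

lemma lin_le (hB : ∀ h ∈ B, T h ∈ B') (hA : ∀ h ∈ A, T h ∈ A') (hAB : A ≤ B) (hA' : A' ≤ B')
    (h : B' ≤ A' ⊔ B.map T) :
    Module.finrank ℂ B' + Module.finrank ℂ A ≤ Module.finrank ℂ B + Module.finrank ℂ A' := by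
  have := LinearMap.finrank_le_finrank_of_surjective ((qmap_surj hB hA hA').2 h)
  have := finrank_q hAB
  have := finrank_q hA'
  omega
end lin

lemma hc_mul {a b : S} {i n : ℕ} (hb : b.IsHomogeneous i) (hin : i ≤ n) :
    homogeneousComponent n (a * b) = homogeneousComponent (n - i) a * b := by
  conv_lhs => rw [← sum_homogeneousComponent a, Finset.sum_mul, map_sum]
  have : ∀ j, homogeneousComponent n (homogeneousComponent j a * b) =
      if j = n - i then homogeneousComponent j a * b else 0 := by
    intro j
    have h1 : homogeneousComponent j a * b ∈ homogeneousSubmodule (Fin 3) ℂ (j + i) :=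
      (homogeneousComponent_isHomogeneous j a).mul hb
    rw [homogeneousComponent_of_mem h1]
    apply if_congr _ rfl rfl
    omega
  simp_rw [this]
  rw [Finset.sum_ite_eq']
  split_ifs with h
  · rfl
  · rw [homogeneousComponent_eq_zero, zero_mul]
    simp at h
    omega

/-- graded projective Nullstellensatz -/
lemma null {ι : Type} [Fintype ι] (g : ι → S) (δ : ι → ℕ) (hg : ∀ i, (g i).IsHomogeneous (δ i))
    (hz : ∀ v : Fin 3 → ℂ, (∀ i, eval v (g i) = 0) → v = 0) :
    ∃ n0, ∀ n, n0 ≤ n → (∀ i, δ i ≤ n) ∧ ∀ h : S, h.IsHomogeneous n → ∃ α : ι → S,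
      (∀ i, (α i).IsHomogeneous (n - δ i)) ∧ ∑ i, α i * g i = h := by
  have h1 : idealOfVars (Fin 3) ℂ ≤ (Ideal.span (Set.range g)).radical := by
    rw [← vanishingIdeal_zeroLocus_eq_radical (K := ℂ), Ideal.span_le]
    rintro _ ⟨j, rfl⟩ v hv
    have : v = 0 := hz v fun i => by
      have := hv (g i) (Ideal.subset_span ⟨i, rfl⟩)
      simpa [MvPolynomial.aeval_eq_eval] using this
    simp [this]
  obtain ⟨N, hN⟩ := Ideal.exists_pow_le_of_le_radical_of_fg h1 (idealOfVars_fg _ _)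
  refine ⟨N + ∑ i, δ i, fun n hn => ?_⟩
  have hδ : ∀ i, δ i ≤ n := fun i =>
    (Finset.single_le_sum (f := δ) (fun _ _ => Nat.zero_le _) (Finset.mem_univ i)).trans (by omega)
  refine ⟨hδ, fun h hh => ?_⟩
  have h2 : h ∈ Ideal.span (Set.range g) := by
    apply hN
    rw [mem_pow_idealOfVars_iff]
    intro x hx
    have h3 : x.degree = n := by
      by_contra hne
      exact (mem_support_iff.1 hx) (hh.coeff_eq_zero hne)
    omega
  obtain ⟨c, hc⟩ := Ideal.mem_span_range_iff_exists_fun.1 h2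
  refine ⟨fun i => homogeneousComponent (n - δ i) (c i),
    fun i => homogeneousComponent_isHomogeneous _ _, ?_⟩
  rw [← homogeneousComponent_eq_self hh, ← hc, map_sum]
  exact Finset.sum_congr rfl fun i _ => (hc_mul (hg i) (hδ i)).symm

lemma null_J {F G L : S} {e : ℕ} (hF : F.IsHomogeneous (e + 1)) (hG : G.IsHomogeneous (e + 1))
    (hL : L.IsHomogeneous e)
    (hz : ∀ v : Fin 3 → ℂ, (∀ i, eval v (Mn F G i) = 0) → eval v L = 0 → v = 0) :
    ∃ m1, ∀ m, m1 ≤ m → H (m + e + 2 * e) ≤ J F G (m + e) ⊔ (H (m + 2 * e)).map (LinearMap.mulLeft ℂ L) := by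
  obtain ⟨n0, hn0⟩ := null (ι := Option (Fin 3)) (fun o => o.elim L (Mn F G))
    (fun o => o.elim e (fun _ => 2 * e)) (by
      rintro (_ | i)
      · exact hL
      · exact hom_Mn hF hG i) (by
      intro v hv
      exact hz v (fun i => hv (some i)) (hv none))
  refine ⟨n0, fun m hm h hh => ?_⟩
  obtain ⟨-, hn⟩ := hn0 (m + e + 2 * e) (by omega)
  obtain ⟨α, hα, hs⟩ := hn h hh
  rw [Fintype.sum_option] at hs
  rw [← hs]
  refine Submodule.add_mem _ (Submodule.mem_sup_right ?_) (Submodule.mem_sup_left ?_)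
  rotate_left
  · refine mem_J.2 ⟨fun i => α (some i), fun i => ?_, rfl⟩
    have := hα (some i)
    simpa using this
  · refine ⟨α none, ?_, by simp [mul_comm]⟩
    have := hα none
    simp only [Option.elim] at this
    rwa [show m + e + 2 * e - e = m + 2 * e by omega] at this

lemma H_succ {n : ℕ} {K : Submodule ℂ S} (h : ∀ i : Fin 3, ∀ b ∈ H n, X i * b ∈ K) :
    H (n + 1) ≤ K := by
  have h1 : H (n + 1) = H 1 * H n := by
    simp only [H]
    rw [← homogeneousSubmodule_one_pow _ (n + 1), pow_succ', homogeneousSubmodule_one_pow _ n]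
  rw [h1, H, homogeneousSubmodule_one_eq_span_X, Submodule.mul_le]
  intro a ha b hb
  induction ha using Submodule.span_induction with
  | mem x hx => obtain ⟨i, rfl⟩ := hx; exact h i b hb
  | zero => simp
  | add x y _ _ h1 h2 => rw [add_mul]; exact K.add_mem h1 h2
  | smul c x _ h1 => rw [smul_mul_assoc]; exact K.smul_mem c h1

section core

lemma persist {F G : S} {e : ℕ} {L : S} {m0 : ℕ} (h0 : H (m0 + e + 2 * e) ≤
      J F G (m0 + e) ⊔ (H (m0 + 2 * e)).map (LinearMap.mulLeft ℂ L)) :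
    ∀ m, m0 ≤ m → H (m + e + 2 * e) ≤ J F G (m + e) ⊔ (H (m + 2 * e)).map (LinearMap.mulLeft ℂ L) := by
  intro m hm
  induction m, hm using Nat.le_induction with
  | base => exact h0
  | succ m hm ih =>
    rw [show m + 1 + e + 2 * e = (m + e + 2 * e) + 1 by ring]
    apply H_succ
    intro i b hb
    obtain ⟨a, ha, _, ⟨x, hx, rfl⟩, rfl⟩ := Submodule.mem_sup.1 (ih hb)
    rw [mul_add]
    refine Submodule.add_mem _ (Submodule.mem_sup_left ?_) (Submodule.mem_sup_right ?_)
    · have := J_mul ha (isHomogeneous_X ℂ i)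
      rwa [show 1 + (m + e) = m + 1 + e by ring] at this
    · refine ⟨X i * x, ?_, by simp; ring⟩
      have := (isHomogeneous_X ℂ i).mul hx
      rwa [show 1 + (m + 2 * e) = m + 1 + 2 * e by ring] at this

lemma mul_H {e : ℕ} {L : S} (hL : L.IsHomogeneous e) (m : ℕ) :
    ∀ h ∈ H (m + 2 * e), LinearMap.mulLeft ℂ L h ∈ H (m + e + 2 * e) := by
  intro h hh
  have := hL.mul hh
  rwa [show e + (m + 2 * e) = m + e + 2 * e by ring] at this

lemma mul_J {F G : S} {e : ℕ} {L : S} (hL : L.IsHomogeneous e) (m : ℕ) :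
    ∀ h ∈ J F G m, LinearMap.mulLeft ℂ L h ∈ J F G (m + e) := by
  intro h hh
  have := J_mul hh hL
  rwa [add_comm] at this

lemma core {F G : S} {e : ℕ} (hF : F.IsHomogeneous (e + 1)) (hG : G.IsHomogeneous (e + 1))
    (he : 1 ≤ e) (hM : Mn F G ≠ 0) {L : S} (hL : L.IsHomogeneous e) {m0 : ℕ} (hm0 : e ≤ m0)
    (hd : Module.finrank ℂ (H (m0 + 2 * e)) ≤ Module.finrank ℂ (J F G m0) + 3 * e ^ 2)
    (hs : H (m0 + e + 2 * e) ≤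
      J F G (m0 + e) ⊔ (H (m0 + 2 * e)).map (LinearMap.mulLeft ℂ L))
    {L' : S} (hL' : L'.IsHomogeneous e)
    (hz : ∀ v : Fin 3 → ℂ, (∀ i, eval v (Mn F G i) = 0) → eval v L' = 0 → v = 0) :
    H (m0 + e + 2 * e) ≤ J F G (m0 + e) ⊔ (H (m0 + 2 * e)).map (LinearMap.mulLeft ℂ L') := by
  have hs' := persist hs
  have hge : ∀ m, e ≤ m →
      Module.finrank ℂ (J F G m) + 3 * e ^ 2 ≤ Module.finrank ℂ (H (m + 2 * e)) := by
    intro m hm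
    obtain ⟨l, rfl⟩ := Nat.exists_eq_add_of_le' hm
    exact finrank_J_le hF hG hM l
  have hdim : ∀ j, Module.finrank ℂ (H (m0 + j * e + 2 * e)) =
      Module.finrank ℂ (J F G (m0 + j * e)) + 3 * e ^ 2 := by
    intro j
    apply le_antisymm _ (hge _ (by omega))
    induction j with
    | zero => rw [Nat.zero_mul, Nat.add_zero]; exact hd
    | succ j ih =>
      have := lin_le (mul_H hL (m0 + j * e)) (mul_J hL (m0 + j * e)) (J_le hF hG _)
        (J_le hF hG _) (hs' (m0 + j * e) (by omega))
      rw [show m0 + (j + 1) * e = m0 + j * e + e by ring]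
      omega
  have hiff : ∀ (j : ℕ) (L'' : S), L''.IsHomogeneous e → (H (m0 + j * e + e + 2 * e) ≤
      J F G (m0 + j * e + e) ⊔ (H (m0 + j * e + 2 * e)).map (LinearMap.mulLeft ℂ L'') ↔
      ∀ h ∈ H (m0 + j * e + 2 * e), L'' * h ∈ J F G (m0 + j * e + e) → h ∈ J F G (m0 + j * e)) := by
    intro j L'' hL''
    have h1 := hdim j
    have h2 := hdim (j + 1)
    rw [show m0 + (j + 1) * e = m0 + j * e + e by ring] at h2
    exact lin_iff (mul_H hL'' (m0 + j * e)) (mul_J hL'' (m0 + j * e)) (J_le hF hG _)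
        (J_le hF hG _) (by omega)
  obtain ⟨m1, hm1⟩ := null_J hF hG hL' hz
  have hinj : ∀ j, ∀ h ∈ H (m0 + j * e + 2 * e), L * h ∈ J F G (m0 + j * e + e) →
      h ∈ J F G (m0 + j * e) := fun j => (hiff j L hL).1 (hs' _ (by omega))
  have hdown : ∀ j, (∀ h ∈ H (m0 + j * e + 2 * e), L' * h ∈ J F G (m0 + j * e + e) →
      h ∈ J F G (m0 + j * e)) := by
    have key : ∀ i j, m1 ≤ j + i → (∀ h ∈ H (m0 + j * e + 2 * e),
        L' * h ∈ J F G (m0 + j * e + e) → h ∈ J F G (m0 + j * e)) := by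
      intro i
      induction i with
      | zero =>
        intro j hj
        exact (hiff j L' hL').1 (hm1 _ (by nlinarith))
      | succ i ih =>
        intro j hj h hh hJ
        apply hinj j h hh
        rw [show m0 + j * e + e = m0 + (j + 1) * e by ring]
        apply ih (j + 1) (by omega)
        · have := mul_H hL (m0 + j * e) h hh
          rwa [show m0 + j * e + e + 2 * e = m0 + (j + 1) * e + 2 * e by ring] at this
        · have := mul_J hL _ _ hJ
          rw [LinearMap.mulLeft_apply, mul_left_comm] at this
          rwa [show m0 + j * e + e + e = m0 + (j + 1) * e + e by ring] at this
    exact fun j => key m1 j (by omega)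
  have := (hiff 0 L' hL').2 (hdown 0)
  rw [Nat.zero_mul, Nat.add_zero] at this
  exact this

end core
end SMC


namespace SMC
open MvPolynomial Matrix

section ex
/-- partial derivatives and forms of the explicit example -/
def exf (n : ℕ) : S := X 0 ^ (n + 2) - ((n + 2 : ℕ) : S) * (X 0 * X 2 ^ (n + 1))
def exg (n : ℕ) : S := X 1 ^ (n + 2) - ((n + 2 : ℕ) : S) * (X 1 * X 2 ^ (n + 1)) +
  ((2 * (n + 1) : ℕ) : S) * X 2 ^ (n + 2)
def exF (n : ℕ) : S := exf n + (exg n + exg n)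
def exG (n : ℕ) : S := exf n + exg n
def ux (n : ℕ) : S := X 0 ^ (n + 1) - X 2 ^ (n + 1)
def uy (n : ℕ) : S := X 1 ^ (n + 1) - X 2 ^ (n + 1)
def k1 (n : ℕ) : S := ((n + 2 : ℕ) : S)
def k2 (n : ℕ) : S := ((n + 2 : ℕ) : S) * ((n + 1 : ℕ) : S)

lemma pd2 (i : Fin 3) : pderiv i (2 : S) = 0 := by
  have : (2 : S) = C 2 := rfl
  rw [this, pderiv_C]

lemma pf (n : ℕ) : grad (exf n) = ![k1 n * ux n, 0, - (k2 n * (X 0 * X 2 ^ n))] := by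
  ext1 i
  fin_cases i
  · simp [grad, exf, pderiv_X, pd2, k1, ux]; ring
  · simp [grad, exf, pderiv_X, pd2]
  · simp [grad, exf, pderiv_X, pd2, k2]; ring

lemma pg (n : ℕ) : grad (exg n) = ![0, k1 n * uy n, k2 n * (X 2 ^ n * (2 * X 2 - X 1))] := by
  ext1 i
  fin_cases i
  · simp [grad, exg, pderiv_X, pd2]
  · simp [grad, exg, pderiv_X, pd2, k1, uy]; ring
  · simp [grad, exg, pderiv_X, pd2, k2]; ring

lemma grad_add {R : Type*} [CommRing R] (F G : MvPolynomial (Fin 3) R) :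
    grad (F + G) = grad F + grad G := by
  ext1 i; simp [grad]

lemma exF_grad (n : ℕ) : grad (exF n) = grad (exf n) + (grad (exg n) + grad (exg n)) := by
  simp [exF, grad_add]
lemma exG_grad (n : ℕ) : grad (exG n) = grad (exf n) + grad (exg n) := by
  simp [exG, grad_add]

lemma exM (n : ℕ) : Mn (exF n) (exG n) = ![-(k1 n * k2 n) * ((X 0 * X 2 ^ n) * uy n),
    (k1 n * k2 n) * (ux n * (X 2 ^ n * (2 * X 2 - X 1))), -(k1 n * k1 n) * (ux n * uy n)] := by
  rw [Mn, exF_grad, exG_grad, pf, pg, cross_apply]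
  ext1 i
  fin_cases i
  · simp; ring
  · simp; ring
  · simp; ring

lemma homf (n : ℕ) : (exf n).IsHomogeneous (n + 1 + 1) := by
  have h1 : (X 0 ^ (n + 2) : S).IsHomogeneous (n + 2) := isHomogeneous_X_pow _ _
  have h2 : (((n + 2 : ℕ) : S) * (X 0 * X 2 ^ (n + 1))).IsHomogeneous (0 + (1 + (n + 1))) :=
    (isHomogeneous_C _ ((n + 2 : ℕ) : ℂ)).mul ((isHomogeneous_X _ _).mul (isHomogeneous_X_pow _ _))
  rw [show 0 + (1 + (n + 1)) = n + 2 by ring] at h2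
  exact h1.sub h2
lemma homg (n : ℕ) : (exg n).IsHomogeneous (n + 1 + 1) := by
  have h1 : (X 1 ^ (n + 2) : S).IsHomogeneous (n + 2) := isHomogeneous_X_pow _ _
  have h2 : (((n + 2 : ℕ) : S) * (X 1 * X 2 ^ (n + 1))).IsHomogeneous (0 + (1 + (n + 1))) :=
    (isHomogeneous_C _ ((n + 2 : ℕ) : ℂ)).mul ((isHomogeneous_X _ _).mul (isHomogeneous_X_pow _ _))
  rw [show 0 + (1 + (n + 1)) = n + 2 by ring] at h2
  have h3 : (((2 * (n + 1) : ℕ) : S) * X 2 ^ (n + 2)).IsHomogeneous (0 + (n + 2)) :=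
    (isHomogeneous_C _ ((2 * (n + 1) : ℕ) : ℂ)).mul (isHomogeneous_X_pow _ _)
  rw [zero_add] at h3
  exact (h1.sub h2).add h3
lemma homF (n : ℕ) : (exF n).IsHomogeneous (n + 1 + 1) := (homf n).add ((homg n).add (homg n))
lemma homG (n : ℕ) : (exG n).IsHomogeneous (n + 1 + 1) := (homf n).add (homg n)

lemma two_pow_ne (n : ℕ) : (2 : ℂ) ^ (n + 1) - 1 ≠ 0 := by
  have : (1 : ℕ) < 2 ^ (n + 1) := Nat.one_lt_two_pow (by omega)
  have h : ((2 ^ (n + 1) : ℕ) : ℂ) ≠ ((1 : ℕ) : ℂ) := by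
    rw [Ne, Nat.cast_inj]; omega
  rw [sub_ne_zero]
  simpa using h

lemma cne (n : ℕ) : ((n : ℂ) + 2) ≠ 0 ∧ ((n : ℂ) + 1) ≠ 0 := by
  constructor
  · exact_mod_cast (by omega : n + 2 ≠ 0)
  · exact_mod_cast (by omega : n + 1 ≠ 0)

lemma dirF_eq (n : ℕ) : dir (exF n) = k1 n * (ux n + 2 * uy n) +
    k2 n * (X 2 ^ n * (X 0 + 2 * X 1 - 4 * X 2)) := by
  have h : dir (exF n) = grad (exF n) 0 + grad (exF n) 1 - grad (exF n) 2 := rfl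
  rw [h, exF_grad, pf, pg]; simp; ring
lemma dirG_eq (n : ℕ) : dir (exG n) = k1 n * (ux n + uy n) +
    k2 n * (X 2 ^ n * (X 0 + X 1 - 2 * X 2)) := by
  have h : dir (exG n) = grad (exG n) 0 + grad (exG n) 1 - grad (exG n) 2 := rfl
  rw [h, exG_grad, pf, pg]; simp; ring

/-- zeros of the minors -/
lemma ex_zero (n : ℕ) (v : Fin 3 → ℂ) (h : ∀ i, eval v (Mn (exF n) (exG n) i) = 0) :
    (v 2 ≠ 0 ∧ v 0 ^ (n + 1) = v 2 ^ (n + 1) ∧ v 1 ^ (n + 1) = v 2 ^ (n + 1)) ∨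
    (v 2 = 0 ∧ v 0 = 0) ∨ (v 2 = 0 ∧ v 1 = 0) := by
  obtain ⟨c1, c2⟩ := cne n
  have h0 := h 0
  have h1 := h 1
  have h2 := h 2
  rw [exM] at h0 h1 h2
  simp [k1, k2, ux, uy, c1, c2] at h0 h1 h2
  by_cases hz : v 2 = 0
  · simp [hz] at h2 ⊢
    exact h2
  · left
    simp only [hz] at h0 h1
    refine ⟨hz, ?_⟩
    by_cases hx : v 0 ^ (n + 1) - v 2 ^ (n + 1) = 0
    · refine ⟨sub_eq_zero.1 hx, ?_⟩
      have : v 0 ≠ 0 := by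
        intro h; rw [h] at hx; simp [hz] at hx
      simp only [this] at h0
      simpa [sub_eq_zero] using h0
    · exfalso
      simp only [hx] at h1 h2
      simp at h1 h2
      have : v 1 = 2 * v 2 := by rw [sub_eq_zero] at h1; exact h1.symm
      rw [this, mul_pow] at h2
      have h3 : ((2:ℂ) ^ (n+1) - 1) * v 2 ^ (n + 1) = 0 := by linear_combination h2
      simp [two_pow_ne, hz] at h3

lemma dirF_z0 (n : ℕ) (v : Fin 3 → ℂ) (h : v 2 = 0) : eval v (dir (exF n)) =
   (n + 2) * (v 0 ^ (n + 1) + 2 * v 1 ^ (n + 1) + (n + 1) * (0 ^ n * (v 0 + 2 * v 1))) := by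
  rw [dirF_eq]; simp [k1, k2, ux, uy, h]; ring
lemma dirG_z0 (n : ℕ) (v : Fin 3 → ℂ) (h : v 2 = 0) : eval v (dir (exG n)) =
   (n + 2) * (v 0 ^ (n + 1) + v 1 ^ (n + 1) + (n + 1) * (0 ^ n * (v 0 + v 1))) := by
  rw [dirG_eq]; simp [k1, k2, ux, uy, h]; ring

lemma norm_eq_of_pow {n : ℕ} {a b : ℂ} (h : a ^ (n + 1) = b ^ (n + 1)) : ‖a‖ = ‖b‖ := by
  have := congrArg norm h
  rw [norm_pow, norm_pow] at this
  exact (pow_left_inj₀ (norm_nonneg _) (norm_nonneg _) (by omega)).1 this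

lemma z0_aux (n : ℕ) (v : Fin 3 → ℂ) (c : ℂ) (hc : c ≠ 0) (h2 : v 2 = 0) (h : v 0 = 0 ∨ v 1 = 0)
    (hv : ((n:ℂ) + 2) * (v 0 ^ (n + 1) + c * v 1 ^ (n + 1) +
      (n + 1) * (0 ^ n * (v 0 + c * v 1))) = 0) :
    v = 0 := by
  obtain ⟨c1, c2⟩ := cne n
  simp only [mul_eq_zero, c1, false_or] at hv
  have key : v 0 = 0 ∧ v 1 = 0 := by
    rcases Nat.eq_zero_or_pos n with rfl | hn
    · rcases h with h | h
      · simp [h] at hv ⊢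
        exact hv.resolve_left hc
      · simp [h] at hv ⊢
        exact hv
    · have : n ≠ 0 := by omega
      rcases h with h | h
      · simpa [h, this, hc] using hv
      · simpa [h, this] using hv
  ext1 i
  fin_cases i
  · exact key.1
  · exact key.2
  · exact h2

lemma ex_F (n : ℕ) (v : Fin 3 → ℂ) (h : ∀ i, eval v (Mn (exF n) (exG n) i) = 0)
    (hF : eval v (dir (exF n)) = 0) : v = 0 := by
  obtain ⟨c1, c2⟩ := cne n
  rcases ex_zero n v h with ⟨hz, hx, hy⟩ | ⟨hz, hx⟩ | ⟨hz, hx⟩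
  · exfalso
    rw [dirF_eq] at hF
    simp [k1, k2, ux, uy, hx, hy, c1, c2, hz] at hF
    have h4 : v 0 + 2 * v 1 = 4 * v 2 := by linear_combination hF
    have n1 := norm_eq_of_pow hx
    have n2 := norm_eq_of_pow hy
    have n3 := congrArg norm h4
    have n4 := norm_add_le (v 0) (2 * v 1)
    rw [n3, norm_mul, norm_mul, n1, n2] at n4
    have : 0 < ‖v 2‖ := norm_pos_iff.2 hz
    norm_num at n4
    linarith
  · rw [dirF_z0 n v hz] at hF
    exact z0_aux n v 2 (by norm_num) hz (Or.inl hx) hF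
  · rw [dirF_z0 n v hz] at hF
    exact z0_aux n v 2 (by norm_num) hz (Or.inr hx) hF

lemma ex_G (n : ℕ) (v : Fin 3 → ℂ) (h : ∀ i, eval v (Mn (exF n) (exG n) i) = 0)
    (hG : eval v (dir (exG n)) = 0) : v = 0 ∨ (v 2 ≠ 0 ∧ v 0 = v 2 ∧ v 1 = v 2) := by
  obtain ⟨c1, c2⟩ := cne n
  rcases ex_zero n v h with ⟨hz, hx, hy⟩ | ⟨hz, hx⟩ | ⟨hz, hx⟩
  · right
    rw [dirG_eq] at hG
    simp [k1, k2, ux, uy, hx, hy, c1, c2, hz] at hG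
    have n1 := norm_eq_of_pow hx
    have n2 := norm_eq_of_pow hy
    have n3 := parallelogram_law_with_norm ℂ (v 2) (v 0 - v 2)
    rw [show v 2 + (v 0 - v 2) = v 0 by ring, show v 2 - (v 0 - v 2) = v 1 by
      linear_combination -hG, n1, n2] at n3
    have : ‖v 0 - v 2‖ = 0 := by nlinarith
    have h0 : v 0 = v 2 := by rwa [norm_eq_zero, sub_eq_zero] at this
    refine ⟨hz, h0, ?_⟩
    linear_combination hG - h0
  · rw [dirG_z0 n v hz] at hG
    exact Or.inl (z0_aux n v 1 (by norm_num) hz (Or.inl hx) (by simpa using hG))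
  · rw [dirG_z0 n v hz] at hG
    exact Or.inl (z0_aux n v 1 (by norm_num) hz (Or.inr hx) (by simpa using hG))

end ex
end SMC


namespace SMC
open MvPolynomial Matrix

lemma C2 : (C 2 : S) = 2 := rfl

lemma dvd_irred {i : Fin 3} {p : S} (v : Fin 3 → ℂ) (hv : v i = 0) (hp : eval v p ≠ 0) :
    IsRelPrime p (X i) := by
  rw [isRelPrime_comm]
  refine ((X_prime (R := ℂ) (i := i)).irreducible.isRelPrime_iff_not_dvd).2 ?_
  rintro ⟨q, rfl⟩
  simp [hv] at hp

lemma ux_ne (n : ℕ) : ux n ≠ 0 := by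
  intro h
  have := congrArg (eval ![1, 0, 0]) h
  simp [ux] at this
lemma uy_ne (n : ℕ) : uy n ≠ 0 := by
  intro h
  have := congrArg (eval ![0, 1, 0]) h
  simp [uy] at this

lemma deg_dvd {i : Fin 3} {p q : S} (hp : p ≠ 0) (h : q ∣ p) (hd : degreeOf i p = 0) :
    degreeOf i q = 0 := by
  obtain ⟨r, rfl⟩ := h
  have h1 : q ≠ 0 := left_ne_zero_of_mul hp
  have h2 : r ≠ 0 := right_ne_zero_of_mul hp
  rw [degreeOf_mul_eq h1 h2] at hd
  omega

lemma deg_sub {i j k : Fin 3} (n : ℕ) (hij : j ≠ i) (hik : k ≠ i) :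
    degreeOf i (X j ^ n - X k ^ n : S) = 0 := by
  have := degreeOf_sub_le i (X j ^ n : S) (X k ^ n)
  have h1 := degreeOf_pow_le i (X j : S) n
  have h2 := degreeOf_pow_le i (X k : S) n
  rw [degreeOf_X_of_ne hij.symm] at h1
  rw [degreeOf_X_of_ne hik.symm] at h2
  simp at h1 h2
  simp [h1, h2] at this
  exact this

lemma rp_uxuy (n : ℕ) : IsRelPrime (ux n) (uy n) := by
  intro q h1 h2
  have h3 : q ∣ X 0 ^ (n + 1) - X 1 ^ (n + 1) := by
    have := dvd_sub h1 h2
    simpa [ux, uy] using this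
  have hne : (X 0 ^ (n + 1) - X 1 ^ (n + 1) : S) ≠ 0 := by
    intro h
    have := congrArg (eval ![1, 0, 0]) h
    simp at this
  have d0 := deg_dvd (i := 0) (uy_ne n) h2 (deg_sub _ (by decide) (by decide))
  have d1 := deg_dvd (i := 1) (ux_ne n) h1 (deg_sub _ (by decide) (by decide))
  have d2 := deg_dvd (i := 2) hne h3 (deg_sub _ (by decide) (by decide))
  have hq : q ≠ 0 := fun h => ux_ne n (by rw [h] at h1; exact zero_dvd_iff.1 h1)
  have ht : q = C (q.coeff 0) := by
    rw [← totalDegree_eq_zero_iff_eq_C, totalDegree_eq_zero_iff]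
    intro m hm i
    have : m i ≤ degreeOf i q := le_degreeOf_of_mem_support _ hm
    fin_cases i
    · exact Nat.le_zero.1 (this.trans d0.le)
    · exact Nat.le_zero.1 (this.trans d1.le)
    · exact Nat.le_zero.1 (this.trans d2.le)
  rw [ht]
  refine (isUnit_iff_ne_zero.2 fun h => hq ?_).map C
  rw [ht, h, C_0]

lemma rp_ux (n : ℕ) : IsRelPrime (ux n) ((X 0 * X 2 ^ n) * uy n) := by
  refine IsRelPrime.mul_right (IsRelPrime.mul_right ?_ (IsRelPrime.pow_right ?_)) (rp_uxuy n)
  · exact dvd_irred ![0, 0, 1] (by simp) (by simp [ux])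
  · exact dvd_irred ![1, 0, 0] (by simp) (by simp [ux])

lemma rp_uy (n : ℕ) : IsRelPrime (uy n) (X 2 ^ n * (2 * X 2 - X 1)) := by
  have h2 : IsRelPrime (uy n) (X 2) := dvd_irred ![0, 1, 0] (by simp) (by simp [uy])
  refine IsRelPrime.mul_right (IsRelPrime.pow_right h2) ?_
  intro q h1 h3
  have h4 : q ∣ (2 * X 2) ^ (n + 1) - X 1 ^ (n + 1) := h3.trans (sub_dvd_pow_sub_pow _ _ _)
  have h5 : q ∣ C ((2:ℂ) ^ (n + 1) - 1) * X 2 ^ (n + 1) := by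
    have := dvd_add h1 h4
    convert this using 1
    rw [C_sub, C_pow, C2]
    simp [uy]; ring
  have hu : IsUnit (C ((2:ℂ) ^ (n + 1) - 1) : S) := (isUnit_iff_ne_zero.2 (two_pow_ne n)).map C
  exact h2.pow_right h1 ((hu.dvd_mul_left).1 h5)

lemma ex_syz0 (n : ℕ) (α : Fin 3 → S) (h : α ⬝ᵥ Mn (exF n) (exG n) = 0) :
    ∃ p q : S, α = syz (exF n) (exG n) (p, q) := by
  obtain ⟨c1, c2⟩ := cne n
  have hk1 : k1 n = C ((n:ℂ) + 2) := by simp [k1, C2]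
  have hk2 : k2 n = C (((n:ℂ) + 2) * (n + 1)) := by simp [k2, C2]
  have hu1 : IsUnit (k1 n) := by rw [hk1]; exact (isUnit_iff_ne_zero.2 c1).map C
  have hu2 : IsUnit (k2 n) := by rw [hk2]; exact (isUnit_iff_ne_zero.2 (mul_ne_zero c1 c2)).map C
  rw [exM, dotProduct, Fin.sum_univ_three] at h
  simp at h
  have h' : k1 n * (-(k2 n * (α 0 * (X 0 * X 2 ^ n * uy n))) +
    ux n * (k2 n * (α 1 * (X 2 ^ n * (2 * X 2 - X 1))) - k1 n * (α 2 * uy n))) = 0 := by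
    linear_combination h
  replace h' := (mul_eq_zero.1 h').resolve_left hu1.ne_zero
  have hd : ux n ∣ k2 n * (α 0 * (X 0 * X 2 ^ n * uy n)) := 
    ⟨k2 n * (α 1 * (X 2 ^ n * (2 * X 2 - X 1))) - k1 n * (α 2 * uy n), by linear_combination -h'⟩
  obtain ⟨p, hp⟩ := (rp_ux n).dvd_of_dvd_mul_right ((hu2.dvd_mul_left).1 hd)
  rw [hp] at h'
  have h2 : ux n * (-(k2 n * (p * (X 0 * X 2 ^ n * uy n))) +
     (k2 n * (α 1 * (X 2 ^ n * (2 * X 2 - X 1))) - k1 n * (α 2 * uy n))) = 0 := by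
    linear_combination h'
  replace h2 := (mul_eq_zero.1 h2).resolve_left (ux_ne n)
  have hd2 : uy n ∣ k2 n * (α 1 * (X 2 ^ n * (2 * X 2 - X 1))) :=
    ⟨k2 n * (p * (X 0 * X 2 ^ n)) + k1 n * α 2, by linear_combination h2⟩
  obtain ⟨q, hq⟩ := (rp_uy n).dvd_of_dvd_mul_right ((hu2.dvd_mul_left).1 hd2)
  rw [hq] at h2
  have h3 : uy n * (-(k2 n * (p * (X 0 * X 2 ^ n))) +
     (k2 n * (q * (X 2 ^ n * (2 * X 2 - X 1))) - k1 n * α 2)) = 0 := by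
    linear_combination h2
  replace h3 := (mul_eq_zero.1 h3).resolve_left (uy_ne n)
  obtain ⟨i, hi⟩ := hu1.exists_left_inv
  refine ⟨i * (q - p), i * (2 * p - q), ?_⟩
  ext1 j
  change α j = i * (q - p) * grad (exF n) j + i * (2 * p - q) * grad (exG n) j
  rw [exF_grad, exG_grad, pf, pg]
  fin_cases j
  · simp
    linear_combination hp - p * ux n * hi
  · simp
    linear_combination hq - q * uy n * hi
  · simp
    linear_combination -i * h3 - α 2 * hi

lemma ex_syz (n l : ℕ) (α : Fin 3 → S) (hα : ∀ i, (α i).IsHomogeneous (l + (n + 1)))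
    (h : α ⬝ᵥ Mn (exF n) (exG n) = 0) :
    ∃ p q : S, p.IsHomogeneous l ∧ q.IsHomogeneous l ∧ α = syz (exF n) (exG n) (p, q) := by
  obtain ⟨p, q, hpq⟩ := ex_syz0 n α h
  refine ⟨homogeneousComponent l p, homogeneousComponent l q,
    homogeneousComponent_isHomogeneous _ _, homogeneousComponent_isHomogeneous _ _, ?_⟩
  ext1 i
  have h1 : α i = p * grad (exF n) i + q * grad (exG n) i := congrFun hpq i
  rw [← homogeneousComponent_eq_self (hα i), h1, map_add, hc_mul (hom_grad (homF n) i) (by omega),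
    hc_mul (hom_grad (homG n) i) (by omega), Nat.add_sub_cancel]
  rfl

lemma ex_dim (n l : ℕ) : Module.finrank ℂ (H (l + (n + 1) + 2 * (n + 1))) ≤
    Module.finrank ℂ (J (exF n) (exG n) (l + (n + 1))) + 3 * (n + 1) ^ 2 :=
  finrank_J_ge (homF n) (homG n) l (fun α hα h => ex_syz n l α hα h)

lemma exM_ne (n : ℕ) : Mn (exF n) (exG n) ≠ 0 := by
  obtain ⟨c1, c2⟩ := cne n
  intro h
  have h2 := congrFun h 2
  rw [exM] at h2
  have := congrArg (eval ![1, 1, 0]) h2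
  simp [k1, ux, uy, c1] at this

end SMC


namespace SMC
open MvPolynomial Matrix

def IM (F G : S) : Ideal S := Ideal.span (Set.range (Mn F G))

lemma mem_J_of_IM {F G : S} {e m : ℕ} (hF : F.IsHomogeneous (e + 1)) (hG : G.IsHomogeneous (e + 1))
    {h : S} (hh : h.IsHomogeneous (m + 2 * e)) (hI : h ∈ IM F G) : h ∈ J F G m := by
  obtain ⟨c, hc⟩ := Ideal.mem_span_range_iff_exists_fun.1 hI
  refine mem_J.2 ⟨fun i => homogeneousComponent m (c i),
    fun i => homogeneousComponent_isHomogeneous _ _, ?_⟩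
  rw [← homogeneousComponent_eq_self hh, ← hc, map_sum]
  refine Finset.sum_congr rfl fun i _ => ?_
  rw [hc_mul (hom_Mn hF hG i) (by omega), Nat.add_sub_cancel]

lemma eval_IM {F G : S} {v : Fin 3 → ℂ} (hv : ∀ i, eval v (Mn F G i) = 0) {h : S}
    (hI : h ∈ IM F G) : eval v h = 0 := by
  obtain ⟨c, hc⟩ := Ideal.mem_span_range_iff_exists_fun.1 hI
  rw [← hc, map_sum]
  exact Finset.sum_eq_zero fun i _ => by rw [map_mul, hv i, mul_zero]

lemma J_IM {F G : S} {m : ℕ} {h : S} (hh : h ∈ J F G m) : h ∈ IM F G := by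
  obtain ⟨α, hα, rfl⟩ := mem_J.1 hh
  exact Ideal.mem_span_range_iff_exists_fun.2 ⟨α, rfl⟩

lemma ex_mem (n : ℕ) : (X 0 * X 2 ^ n) * uy n ∈ IM (exF n) (exG n) ∧
    ux n * (X 2 ^ n * (2 * X 2 - X 1)) ∈ IM (exF n) (exG n) ∧
    ux n * uy n ∈ IM (exF n) (exG n) := by
  obtain ⟨c1, c2⟩ := cne n
  have hk1 : k1 n = C ((n:ℂ) + 2) := by simp [k1, C2]
  have hk2 : k2 n = C (((n:ℂ) + 2) * (n + 1)) := by simp [k2, C2]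
  have hu1 : IsUnit (k1 n) := by rw [hk1]; exact (isUnit_iff_ne_zero.2 c1).map C
  have hu2 : IsUnit (k2 n) := by rw [hk2]; exact (isUnit_iff_ne_zero.2 (mul_ne_zero c1 c2)).map C
  have h : ∀ i, Mn (exF n) (exG n) i ∈ IM (exF n) (exG n) := fun i => Ideal.subset_span ⟨i, rfl⟩
  have h0 := h 0
  have h1 := h 1
  have h2 := h 2
  generalize IM (exF n) (exG n) = I at *
  rw [exM] at h0 h1 h2
  refine ⟨?_, ?_, ?_⟩
  · exact (Ideal.unit_mul_mem_iff_mem _ (hu1.mul hu2).neg).1 h0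
  · exact (Ideal.unit_mul_mem_iff_mem _ (hu1.mul hu2)).1 h1
  · exact (Ideal.unit_mul_mem_iff_mem _ (hu1.mul hu1).neg).1 h2

lemma ex_mem2 (n : ℕ) : X 2 ^ (2 * n + 1) * ux n ∈ IM (exF n) (exG n) ∧
    X 2 ^ (2 * n + 1) * uy n ∈ IM (exF n) (exG n) := by
  obtain ⟨h0, h1, h2⟩ := ex_mem n
  generalize IM (exF n) (exG n) = I at *
  constructor
  · have hu : IsUnit (C ((2:ℂ) ^ (n + 1) - 1) : S) := (isUnit_iff_ne_zero.2 (two_pow_ne n)).map C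
    obtain ⟨r, hr⟩ := sub_dvd_pow_sub_pow (2 * X 2 : S) (X 1) (n + 1)
    refine (Ideal.unit_mul_mem_iff_mem _ hu).1 ?_
    have := I.add_mem (I.mul_mem_left r h1) (I.mul_mem_left (X 2 ^ n) h2)
    convert this using 1
    rw [C_sub, C_pow, C2, C_1]
    rw [mul_pow] at hr
    have hr' : (2 ^ (n + 1) - 1) * (X 2 : S) ^ (n + 1) = (2 * X 2 - X 1) * r + uy n := by
      rw [← hr, uy]; ring
    linear_combination (X 2 ^ n * ux n) * hr'
  · have := I.sub_mem (I.mul_mem_left (X 0 ^ n) h0) (I.mul_mem_left (X 2 ^ n) h2)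
    convert this using 1
    simp only [ux]; ring

def gs (i : Fin 3) (n : ℕ) : S := ∑ j ∈ Finset.range (n + 1), X i ^ j * X 2 ^ (n - j)
lemma gs_mul (i : Fin 3) (n : ℕ) : gs i n * (X i - X 2) = X i ^ (n + 1) - X 2 ^ (n + 1) := by
  have := (Commute.all (X i : S) (X 2)).geom_sum₂_mul (n + 1)
  simpa [gs] using this
lemma gs_hom (i : Fin 3) (n : ℕ) : (gs i n).IsHomogeneous n := by
  refine IsHomogeneous.sum _ _ _ fun j hj => ?_
  have := (isHomogeneous_X_pow (R := ℂ) i j).mul (isHomogeneous_X_pow (R := ℂ) (2 : Fin 3) (n - j))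
  rwa [show j + (n - j) = n by simp at hj; omega] at this
lemma gs_eval (i : Fin 3) (n : ℕ) (v : Fin 3 → ℂ) (h : v i = v 2) :
    eval v (gs i n) = (n + 1) * v 2 ^ n := by
  simp only [gs, map_sum, map_mul, map_pow, eval_X, h]
  rw [Finset.sum_congr rfl (g := fun _ => v 2 ^ n) (fun j hj => by
    rw [← pow_add]; congr 1; simp at hj; omega)]
  simp

def exs (n : ℕ) : S := gs 0 n * gs 1 n * X 2 ^ (2 * n + 1)
lemma exs_hom (n : ℕ) : (exs n).IsHomogeneous (4 * n + 1) := by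
  have := ((gs_hom 0 n).mul (gs_hom 1 n)).mul (isHomogeneous_X_pow (R := ℂ) (2 : Fin 3) (2 * n + 1))
  rwa [show n + n + (2 * n + 1) = 4 * n + 1 by ring] at this
lemma exs_X (n : ℕ) (i : Fin 3) : exs n * (X i - X 2) ∈ IM (exF n) (exG n) := by
  obtain ⟨h0, h1⟩ := ex_mem2 n
  generalize IM (exF n) (exG n) = I at *
  fin_cases i
  · have := I.mul_mem_left (gs 1 n) h0
    convert this using 1
    simp only [ux, exs, Fin.zero_eta, ← gs_mul]; ring
  · have := I.mul_mem_left (gs 0 n) h1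
    convert this using 1
    simp only [uy, exs, Fin.mk_one, ← gs_mul]; ring
  · simp

lemma exs_mul0 (n : ℕ) (h : S) :
    exs n * (h - aeval (fun _ => (X 2 : S)) h) ∈ IM (exF n) (exG n) := by
  have hX := exs_X n
  generalize IM (exF n) (exG n) = I at *
  induction h using MvPolynomial.induction_on with
  | C a => simp [algebraMap_eq]
  | add p q hp hq =>
    have := I.add_mem hp hq
    convert this using 1
    rw [map_add]; ring
  | mul_X p i hp =>
    have := I.add_mem (I.mul_mem_left (X i) hp)
      (I.mul_mem_left (aeval (fun _ => (X 2 : S)) p) (hX i))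
    convert this using 1
    rw [map_mul, aeval_X]; ring

lemma aeval_z {h : S} {k : ℕ} (hh : h.IsHomogeneous k) :
    aeval (fun _ => (X 2 : S)) h = C (eval (fun _ => 1) h) * X 2 ^ k := by
  rw [aeval_def, eval₂_eq', eval_eq', map_sum, Finset.sum_mul]
  refine Finset.sum_congr rfl fun m hm => ?_
  have h3 : m.degree = k := by
    by_contra hne
    exact (mem_support_iff.1 hm) (hh.coeff_eq_zero hne)
  rw [Finset.prod_pow_eq_pow_sum, ← Finsupp.degree_eq_sum, h3]
  simp [algebraMap_eq]

lemma exs_mul (n : ℕ) {h : S} {k : ℕ} (hh : h.IsHomogeneous k) :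
    exs n * h - C (eval (fun _ => 1) h) * (exs n * X 2 ^ k) ∈ IM (exF n) (exG n) := by
  have := exs_mul0 n h
  rw [aeval_z hh] at this
  convert this using 1
  ring

lemma ex_one (n : ℕ) : (∀ i, eval (fun _ => (1:ℂ)) (Mn (exF n) (exG n) i) = 0) ∧
    eval (fun _ => (1:ℂ)) (dir (exG n)) = 0 ∧ eval (fun _ => (1:ℂ)) (exs n) ≠ 0 := by
  refine ⟨fun i => ?_, ?_, ?_⟩
  · rw [exM]
    fin_cases i <;> simp [ux, uy]
  · rw [dirG_eq]; simp [ux, uy]; norm_num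
  · simp [exs, gs_eval, (cne n).2]

lemma ex_s (n : ℕ) : ∃ m1, ∀ m, m1 ≤ m → ∃ sk : S, sk.IsHomogeneous (m + 2 * (n + 1)) ∧
    sk ∉ J (exF n) (exG n) m ∧ dir (exG n) * sk ∈ J (exF n) (exG n) (m + (n + 1)) ∧
    H (m + (n + 1) + 2 * (n + 1)) ≤ (J (exF n) (exG n) (m + (n + 1)) ⊔
      Submodule.span ℂ {dir (exF n) * sk}) ⊔
        (H (m + 2 * (n + 1))).map (LinearMap.mulLeft ℂ (dir (exG n))) := by
  obtain ⟨v1, v2, v3⟩ := ex_one n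
  have v4 : eval (fun _ => (1:ℂ)) (dir (exF n)) ≠ 0 := by
    intro h
    have := congrFun (ex_F n _ v1 h) 0
    simp at this
  obtain ⟨n0, hn0⟩ := null (ι := Option (Option (Fin 3)))
    (fun o => o.elim (dir (exG n)) (fun o => o.elim (exs n) (Mn (exF n) (exG n))))
    (fun o => o.elim (n + 1) (fun o => o.elim (4 * n + 1) (fun _ => 2 * (n + 1)))) (by
      rintro (_ | _ | i)
      · exact hom_dir (homG n)
      · exact exs_hom n
      · exact hom_Mn (homF n) (homG n) i) (by
      intro v hv
      rcases ex_G n v (fun i => hv (some (some i))) (hv none) with h | ⟨h2, h0, h1⟩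
      · exact h
      · exfalso
        have := hv (some none)
        simp [exs, gs_eval _ n v h0, gs_eval _ n v h1, (cne n).2, h2] at this)
  refine ⟨n0 + 4 * n + 1, fun m hm => ?_⟩
  obtain ⟨p, hp⟩ : ∃ p, m + 2 * (n + 1) = 4 * n + 1 + p := ⟨m + 2 * (n + 1) - (4 * n + 1), by omega⟩
  have hsk : (exs n * X 2 ^ p).IsHomogeneous (m + 2 * (n + 1)) := by
    rw [hp]; exact (exs_hom n).mul (isHomogeneous_X_pow _ _)
  have hpF := (hom_dir (homF n)).mul (isHomogeneous_X_pow (R := ℂ) (2 : Fin 3) p)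
  have hpG := (hom_dir (homG n)).mul (isHomogeneous_X_pow (R := ℂ) (2 : Fin 3) p)
  refine ⟨exs n * X 2 ^ p, hsk, ?_, ?_, ?_⟩
  · intro h
    have := eval_IM v1 (J_IM h)
    simp [v3] at this
  · apply mem_J_of_IM (homF n) (homG n)
    · have := (hom_dir (homG n)).mul hsk
      rwa [show (n + 1) + (m + 2 * (n + 1)) = m + (n + 1) + 2 * (n + 1) by ring] at this
    · have := exs_mul n hpG
      rw [map_mul, v2, zero_mul, C_0, zero_mul, sub_zero] at this
      convert this using 1
      ring
  · intro h hh
    obtain ⟨-, hn⟩ := hn0 (m + (n + 1) + 2 * (n + 1)) (by omega)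
    obtain ⟨α, hα, hs⟩ := hn h hh
    rw [Fintype.sum_option, Fintype.sum_option] at hs
    rw [← hs]
    refine Submodule.add_mem _ (Submodule.mem_sup_right ?_) (Submodule.add_mem _ ?_
      (Submodule.mem_sup_left (Submodule.mem_sup_left ?_)))
    · refine ⟨α none, ?_, by simp [mul_comm]⟩
      have := hα none
      simp only [Option.elim] at this
      rwa [show m + (n + 1) + 2 * (n + 1) - (n + 1) = m + 2 * (n + 1) by omega] at this
    · apply Submodule.mem_sup_left
      have h1 := hα (some none)
      simp only [Option.elim] at h1 ⊢
      rw [show m + (n + 1) + 2 * (n + 1) - (4 * n + 1) = (n + 1) + p by omega] at h1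
      have h2 := exs_mul n h1
      have h3 := exs_mul n hpF
      set c := eval (fun _ => (1:ℂ)) (α (some none)) with hc
      set c' := eval (fun _ => (1:ℂ)) (dir (exF n) * X 2 ^ p) with hc'
      have hc'0 : c' ≠ 0 := by rw [hc']; simpa using v4
      have h4 := (IM (exF n) (exG n)).sub_mem h2 ((IM (exF n) (exG n)).mul_mem_left (C (c / c')) h3)
      have h5 : α (some none) * exs n = (α (some none) * exs n - (c / c') • (dir (exF n) * (exs n * X 2 ^ p)))
        + (c / c') • (dir (exF n) * (exs n * X 2 ^ p)) := by ring
      rw [h5]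
      refine Submodule.add_mem _ (Submodule.mem_sup_left ?_) (Submodule.mem_sup_right
        (Submodule.smul_mem _ _ (Submodule.mem_span_singleton_self _)))
      apply mem_J_of_IM (homF n) (homG n)
      · apply IsHomogeneous.sub
        · have := h1.mul (exs_hom n)
          rwa [show n + 1 + p + (4 * n + 1) = m + (n + 1) + 2 * (n + 1) by omega] at this
        · apply Submodule.smul_mem (H _)
          have := (hom_dir (homF n)).mul hsk
          rwa [show (n + 1) + (m + 2 * (n + 1)) = m + (n + 1) + 2 * (n + 1) by ring] at this
      · convert h4 using 1
        rw [smul_eq_C_mul]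
        have : C c = C (c / c') * (C c' : S) := by
          rw [← C_mul, div_mul_cancel₀ _ hc'0]
        rw [this]
        ring
    · refine mem_J.2 ⟨fun i => α (some (some i)), fun i => ?_, rfl⟩
      have := hα (some (some i))
      simpa using this

end SMC


namespace SMC
open MvPolynomial Matrix

section det
variable {A B : Type*} [CommRing A] [CommRing B]

lemma map_grad (φ : A →+* B) (F : MvPolynomial (Fin 3) A) (i : Fin 3) :
    map φ (grad F i) = grad (map φ F) i := by
  simp [grad, pderiv_map]

lemma map_dir (φ : A →+* B) (F : MvPolynomial (Fin 3) A) : map φ (dir F) = dir (map φ F) := by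
  simp [dir, pderiv_map]

lemma map_Mn (φ : A →+* B) (F G : MvPolynomial (Fin 3) A) (i : Fin 3) :
    map φ (Mn F G i) = Mn (map φ F) (map φ G) i := by
  rw [Mn, Mn, cross_apply, cross_apply]
  fin_cases i <;> simp [map_grad]

variable {r N : ℕ}

/-- columns of the multiplication matrix -/
def cols (W : Fin r → Fin 3 → MvPolynomial (Fin 3) A) (b : Fin N → MvPolynomial (Fin 3) A)
    (F G L : MvPolynomial (Fin 3) A) : Fin r ⊕ Fin N → MvPolynomial (Fin 3) A :=
  Sum.elim (fun j => W j ⬝ᵥ Mn F G) (fun j => L * b j)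

lemma map_cols (φ : A →+* B) (W : Fin r → Fin 3 → MvPolynomial (Fin 3) A)
    (b : Fin N → MvPolynomial (Fin 3) A)
    (F G L : MvPolynomial (Fin 3) A) (j : Fin r ⊕ Fin N) :
    map φ (cols W b F G L j) =
      cols (fun j i => map φ (W j i)) (fun j => map φ (b j)) (map φ F) (map φ G) (map φ L) j := by
  rcases j with j | j
  · simp [cols, dotProduct, map_Mn]
  · simp [cols]

variable {n : ℕ} {ι : Type*}
def Mt (ε : Dg n ≃ ι) (c : ι → MvPolynomial (Fin 3) A) : Matrix (Dg n) (Dg n) A :=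
  of fun i j => coeff i.1 (c (ε j))

def Dt (ε : Dg n ≃ ι) (c : ι → MvPolynomial (Fin 3) A) : A := (Mt ε c).det

lemma map_Dt (φ : A →+* B) (ε : Dg n ≃ ι) (c : ι → MvPolynomial (Fin 3) A) :
    φ (Dt ε c) = Dt ε (fun j => map φ (c j)) := by
  rw [Dt, Dt, RingHom.map_det]
  congr 1

/-- pencil determinant -/
def PA (ε : Dg n ≃ Fin r ⊕ Fin N) (W : Fin r → Fin 3 → MvPolynomial (Fin 3) A)
    (b : Fin N → MvPolynomial (Fin 3) A) (F G : MvPolynomial (Fin 3) A) : Polynomial A :=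
  Dt ε (cols (fun j i => map Polynomial.C (W j i)) (fun j => map Polynomial.C (b j))
    (map Polynomial.C F) (map Polynomial.C G)
    (C Polynomial.X * dir (map Polynomial.C F) + dir (map Polynomial.C G)))

lemma map_PA (φ : A →+* B) (ε : Dg n ≃ Fin r ⊕ Fin N)
    (W : Fin r → Fin 3 → MvPolynomial (Fin 3) A)
    (b : Fin N → MvPolynomial (Fin 3) A) (F G : MvPolynomial (Fin 3) A) :
    (PA ε W b F G).map φ =
      PA ε (fun j i => map φ (W j i)) (fun j => map φ (b j)) (map φ F) (map φ G) := by
  rw [← Polynomial.coe_mapRingHom, PA, map_Dt]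
  simp_rw [map_cols]
  simp only [MvPolynomial.map_map]
  have : (Polynomial.mapRingHom φ).comp Polynomial.C = Polynomial.C.comp φ := by ext; simp
  simp only [PA, map_add, map_mul, map_C, map_dir, MvPolynomial.map_map, this, Polynomial.coe_mapRingHom,
    Polynomial.map_X]

lemma eval_PA (t : A) (ε : Dg n ≃ Fin r ⊕ Fin N)
    (W : Fin r → Fin 3 → MvPolynomial (Fin 3) A)
    (b : Fin N → MvPolynomial (Fin 3) A) (F G : MvPolynomial (Fin 3) A) :
    (PA ε W b F G).eval t = Dt ε (cols W b F G (C t * dir F + dir G)) := by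
  rw [← Polynomial.coe_evalRingHom, PA, map_Dt]
  simp_rw [map_cols]
  simp only [MvPolynomial.map_map]
  have : (Polynomial.evalRingHom t).comp Polynomial.C = RingHom.id A := by ext; simp
  simp only [map_add, map_mul, map_C, map_dir, MvPolynomial.map_map, this, Polynomial.coe_evalRingHom,
    Polynomial.eval_X, MvPolynomial.map_id, RingHom.id_apply]

lemma PA_X (ε : Dg n ≃ Fin r ⊕ Fin N)
    (W : Fin r → Fin 3 → MvPolynomial (Fin 3) A)
    (b : Fin N → MvPolynomial (Fin 3) A) (F G : MvPolynomial (Fin 3) A) :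
    Polynomial.X ^ r * PA ε W b F G = det ((Polynomial.X : Polynomial A) •
      (Mt ε (cols W b F G (dir F))).map Polynomial.C +
      (Mt ε (cols (fun _ _ => 0) b F G (dir G))).map Polynomial.C) := by
  have h := det_mul_row (fun j : Dg n => Sum.elim (fun _ => (Polynomial.X : Polynomial A))
    (fun _ => 1) (ε j)) (Mt ε (cols (fun j i => map Polynomial.C (W j i))
      (fun j => map Polynomial.C (b j))
    (map Polynomial.C F) (map Polynomial.C G)
    (C Polynomial.X * dir (map Polynomial.C F) + dir (map Polynomial.C G))))
  rw [Equiv.prod_comp ε (fun j => Sum.elim (fun _ => (Polynomial.X : Polynomial A))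
    (fun _ => 1) j), Fintype.prod_sum_type] at h
  simp only [Sum.elim_inl, Sum.elim_inr, Finset.prod_const, Finset.card_univ, Fintype.card_fin,
    one_pow, mul_one] at h
  rw [PA, Dt, ← h]
  congr 1
  ext1 i j
  simp only [of_apply, Matrix.add_apply, Matrix.smul_apply, Matrix.map_apply, Mt]
  rw [← coeff_map Polynomial.C, ← coeff_map Polynomial.C, map_cols, map_cols]
  rcases ε j with j | j
  · simp [cols]
  · simp only [cols, Sum.elim_inr, one_mul, map_dir, add_mul, coeff_add, mul_assoc, coeff_C_mul,
      smul_eq_mul]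

lemma PA_deg (ε : Dg n ≃ Fin r ⊕ Fin N)
    (W : Fin r → Fin 3 → MvPolynomial (Fin 3) A)
    (b : Fin N → MvPolynomial (Fin 3) A) (F G : MvPolynomial (Fin 3) A) :
    (PA ε W b F G).natDegree ≤ N ∧ (PA ε W b F G).coeff N = Dt ε (cols W b F G (dir F)) := by
  have hc : Fintype.card (Dg n) = r + N := by
    rw [Fintype.card_congr ε]; simp
  have h1 := Polynomial.natDegree_det_X_add_C_le (Mt ε (cols W b F G (dir F)))
    (Mt ε (cols (fun _ _ => 0) b F G (dir G)))
  have h2 := Polynomial.coeff_det_X_add_C_card (Mt ε (cols W b F G (dir F)))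
    (Mt ε (cols (fun _ _ => 0) b F G (dir G)))
  rw [← PA_X, hc] at h1 h2
  constructor
  · rw [Polynomial.natDegree_le_iff_coeff_eq_zero]
    intro k hk
    rw [Polynomial.natDegree_le_iff_coeff_eq_zero] at h1
    have := h1 (k + r) (by omega)
    rwa [Polynomial.coeff_X_pow_mul] at this
  · rw [add_comm, Polynomial.coeff_X_pow_mul] at h2
    exact h2
end det

lemma Dt_iff {n : ℕ} {ι : Type} [Fintype ι] (ε : Dg n ≃ ι) (c : ι → S)
    (hc : ∀ j, (c j).IsHomogeneous n) :
    (Dt ε c ≠ 0 ↔ H n ≤ Submodule.span ℂ (Set.range c)) ∧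
    (Dt ε c ≠ 0 → LinearIndependent ℂ c) := by
  let c' : ι → H n := fun j => ⟨c j, hc j⟩
  have h1 : Dt ε c ≠ 0 ↔ LinearIndependent ℂ c' := by
    rw [Dt, ← isUnit_iff_ne_zero, ← isUnit_iff_isUnit_det, ← linearIndependent_cols_iff_isUnit]
    have : (Mt ε c).col = (coord n).toLinearMap ∘ (c' ∘ ε) := by
      ext j i
      rfl
    rw [this, LinearMap.linearIndependent_iff _ (LinearEquiv.ker _), linearIndependent_equiv]
  have hcard : Fintype.card ι = Module.finrank ℂ (H n) := by
    rw [finrank_H, Fintype.card_congr ε]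
  have h2 : LinearIndependent ℂ c' ↔ ⊤ ≤ Submodule.span ℂ (Set.range c') :=
    ⟨fun h => (h.span_eq_top_of_card_eq_finrank' hcard).ge,
      fun h => linearIndependent_of_top_le_span_of_card_eq_finrank h hcard⟩
  have h3 : (⊤ ≤ Submodule.span ℂ (Set.range c')) ↔ H n ≤ Submodule.span ℂ (Set.range c) := by
    have hm : (Submodule.span ℂ (Set.range c')).map (H n).subtype = Submodule.span ℂ (Set.range c) := by
      rw [Submodule.map_span, ← Set.range_comp]; rfl
    rw [← hm]
    constructor
    · intro h
      rw [top_le_iff.1 h]; simp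
    · rintro h ⟨x, hx⟩ -
      obtain ⟨y, hy, hxy⟩ := h hx
      have : y = ⟨x, hx⟩ := Subtype.ext hxy
      rwa [← this]
  refine ⟨by rw [h1, h2, h3], fun h => ?_⟩
  have := (h1.1 h).map' (H n).subtype (Submodule.ker_subtype _)
  exact this

end SMC


namespace SMC
open MvPolynomial Matrix

lemma Dt_vanish {n : ℕ} {ι : Type} [Fintype ι] (ε : Dg n ≃ ι) (c : ι → S)
    (hc : ∀ j, (c j).IsHomogeneous n) (v : Fin 3 → ℂ) (hv : v ≠ 0)
    (h : ∀ j, eval v (c j) = 0) : Dt ε c = 0 := by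
  by_contra hD
  have hs := ((Dt_iff ε c hc).1).1 hD
  obtain ⟨i, hi⟩ := Function.ne_iff.1 hv
  have hX : (X i ^ n : S) ∈ H n := by
    have := (isHomogeneous_X ℂ i).pow n
    simpa using this
  have hle : Submodule.span ℂ (Set.range c) ≤ LinearMap.ker (aeval v : S →ₐ[ℂ] ℂ).toLinearMap := by
    rw [Submodule.span_le]
    rintro _ ⟨j, rfl⟩
    simpa [aeval_eq_eval] using h j
  have := hle (hs hX)
  simp at this
  exact hi this.1

variable {r r' N m e : ℕ}

lemma span_cols (W : Fin r → Fin 3 → S) (b : Fin N → S) (F G L : S) :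
    Submodule.span ℂ (Set.range (cols W b F G L)) =
      Submodule.span ℂ (Set.range fun j => W j ⬝ᵥ Mn F G) ⊔
      Submodule.span ℂ (Set.range fun j => L * b j) := by
  rw [cols, Set.Sum.elim_range, Submodule.span_union]

lemma cols_hom {F G L : S} (hF : F.IsHomogeneous (e + 1)) (hG : G.IsHomogeneous (e + 1))
    {k q : ℕ} {W : Fin r → Fin 3 → S} (hW : ∀ j i, (W j i).IsHomogeneous k)
    {b : Fin N → S} (hb : ∀ j, (b j).IsHomogeneous q) {q' : ℕ} (hL : L.IsHomogeneous q')
    (hq : q' + q = k + 2 * e) (j : Fin r ⊕ Fin N) :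
    (cols W b F G L j).IsHomogeneous (k + 2 * e) := by
  rcases j with j | j
  · have := IsHomogeneous.sum Finset.univ _ _ fun i _ => (hW j i).mul (hom_Mn hF hG i)
    exact this
  · have := hL.mul (hb j)
    rwa [hq] at this

lemma cols_vanish {F G L : S} {W : Fin r → Fin 3 → S} {b : Fin N → S} {v : Fin 3 → ℂ}
    (hM : ∀ i, eval v (Mn F G i) = 0) (hL : eval v L = 0) (j : Fin r ⊕ Fin N) :
    eval v (cols W b F G L j) = 0 := by
  rcases j with j | j
  · simp [cols, dotProduct, hM]
  · simp [cols, hL]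

lemma spanW_le {F G : S} {k : ℕ} {W : Fin r → Fin 3 → S} (hW : ∀ j i, (W j i).IsHomogeneous k) :
    Submodule.span ℂ (Set.range fun j => W j ⬝ᵥ Mn F G) ≤ J F G k := by
  rw [Submodule.span_le]
  rintro _ ⟨j, rfl⟩
  exact mem_J.2 ⟨W j, hW j, rfl⟩

lemma eval_Mn (F G : S) (v : Fin 3 → ℂ) : (fun i => eval v (Mn F G i)) =
    crossProduct (fun i => eval v (grad F i)) (fun i => eval v (grad G i)) := by
  rw [Mn, cross_apply, cross_apply]
  ext i; fin_cases i <;> simp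

lemma Mn_of_sing {F G : S} {t : ℂ} {v : Fin 3 → ℂ}
    (h : ∀ i, t * eval v (grad F i) + eval v (grad G i) = 0) :
    (∀ i, eval v (Mn F G i) = 0) ∧ eval v (C t * dir F + dir G) = 0 := by
  constructor
  · intro i
    have := congrFun (eval_Mn F G v) i
    rw [this, cross_apply]
    have h0 := h 0
    have h1 := h 1
    have h2 := h 2
    fin_cases i <;> simp
    · linear_combination eval v (grad F 1) * h2 - eval v (grad F 2) * h1
    · linear_combination eval v (grad F 2) * h0 - eval v (grad F 0) * h2
    · linear_combination eval v (grad F 0) * h1 - eval v (grad F 1) * h0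
  · have : ∀ F : S, dir F = grad F 0 + grad F 1 - grad F 2 := fun _ => rfl
    rw [this, this]
    simp only [map_add, map_sub, map_mul, eval_C]
    linear_combination h 0 + h 1 - h 2

lemma sing_of_Mn {F G : S} {t : ℂ} {v : Fin 3 → ℂ}
    (hM : ∀ i, eval v (Mn F G i) = 0) (hL : eval v (C t * dir F + dir G) = 0)
    (hF : eval v (dir F) ≠ 0) (i : Fin 3) : t * eval v (grad F i) + eval v (grad G i) = 0 := by
  have h0 := hM 0
  have h1 := hM 1
  have h2 := hM 2
  simp only [Mn, cross_apply] at h0 h1 h2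
  have hd : ∀ F : S, dir F = grad F 0 + grad F 1 - grad F 2 := fun _ => rfl
  rw [hd, hd] at hL
  rw [hd] at hF
  simp at h0 h1 h2 hL hF
  apply mul_left_cancel₀ hF
  rw [mul_zero]
  fin_cases i <;> simp only [Fin.zero_eta, Fin.mk_one, Fin.reduceFinMk]
  · linear_combination eval v (grad F 0) * hL - h2 - h1
  · linear_combination eval v (grad F 1) * hL + h2 + h0
  · linear_combination eval v (grad F 2) * hL + h0 - h1

lemma dir_zero {F : S} {v : Fin 3 → ℂ} (h : ∀ i, eval v (grad F i) = 0) : eval v (dir F) = 0 := by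
  have hd : ∀ F : S, dir F = grad F 0 + grad F 1 - grad F 2 := fun _ => rfl
  rw [hd]; simp [h]

lemma pencil_hom {F G : S} (hF : F.IsHomogeneous (e + 1)) (hG : G.IsHomogeneous (e + 1)) (t : ℂ) :
    (C t * dir F + dir G).IsHomogeneous e := by
  have := (isHomogeneous_C (Fin 3) t).mul (hom_dir hF)
  rw [zero_add] at this
  exact this.add (hom_dir hG)

/-- a singular member always kills the determinant -/
lemma sing_zero {F G : S} (hF : F.IsHomogeneous (e + 1)) (hG : G.IsHomogeneous (e + 1))
    {W : Fin r → Fin 3 → S} (hW : ∀ j i, (W j i).IsHomogeneous (m + e))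
    {b : Fin N → S} (hb : ∀ j, (b j).IsHomogeneous (m + 2 * e))
    (ε : Dg (m + e + 2 * e) ≃ Fin r ⊕ Fin N) {t : ℂ} {v : Fin 3 → ℂ} (hv : v ≠ 0)
    (h : ∀ i, t * eval v (grad F i) + eval v (grad G i) = 0) :
    Dt ε (cols W b F G (C t * dir F + dir G)) = 0 :=
  Dt_vanish ε _ (cols_hom hF hG hW hb (pencil_hom hF hG t) (by ring)) v hv
    (cols_vanish (Mn_of_sing h).1 (Mn_of_sing h).2)

lemma good_Mn {F G : S} (hF : F.IsHomogeneous (e + 1)) (hG : G.IsHomogeneous (e + 1))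
    (he : 1 ≤ e) (hm : e ≤ m)
    {W' : Fin r' → Fin 3 → S} (hW' : ∀ j i, (W' j i).IsHomogeneous m)
    {b : Fin N → S} (hb : ∀ j, (b j).IsHomogeneous (m + 2 * e)) (hN : N = 3 * e ^ 2)
    (ε' : Dg (m + 2 * e) ≃ Fin r' ⊕ Fin N)
    (h1 : Dt ε' (cols W' b F G 1) ≠ 0) :
    H (m + 2 * e) ≤ J F G m ⊔ Submodule.span ℂ (Set.range b) ∧ Mn F G ≠ 0 ∧
    Module.finrank ℂ (H (m + 2 * e)) ≤ Module.finrank ℂ (J F G m) + 3 * e ^ 2 := by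
  have h2 := ((Dt_iff ε' _ (cols_hom hF hG hW' hb (isHomogeneous_one _ _) (by ring))).1).1 h1
  rw [span_cols] at h2
  simp only [one_mul] at h2
  have h3 : H (m + 2 * e) ≤ J F G m ⊔ Submodule.span ℂ (Set.range b) :=
    h2.trans (sup_le_sup_right (spanW_le hW') _)
  have h4 : Module.finrank ℂ (H (m + 2 * e)) ≤ Module.finrank ℂ (J F G m) + 3 * e ^ 2 := by
    haveI : FiniteDimensional ℂ (Submodule.span ℂ (Set.range b)) :=
      FiniteDimensional.span_of_finite ℂ (Set.finite_range b)
    have a1 := Submodule.finrank_mono h3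
    have a2 := Submodule.finrank_add_le_finrank_add_finrank (J F G m) (Submodule.span ℂ (Set.range b))
    have a3 : Module.finrank ℂ (Submodule.span ℂ (Set.range b)) ≤ N := by
      have := finrank_range_le_card (R := ℂ) b
      simpa [Set.finrank] using this
    rw [← hN]
    omega
  refine ⟨h3, ?_, h4⟩
  intro hM
  have h5 : J F G m = ⊥ := by
    rw [eq_bot_iff]
    intro h hh
    obtain ⟨α, -, rfl⟩ := mem_J.1 hh
    simp [hM]
  rw [h5, finrank_bot] at h4
  have := two_finrank_H (m + 2 * e)
  nlinarith

lemma good_iff {F G : S} (hF : F.IsHomogeneous (e + 1)) (hG : G.IsHomogeneous (e + 1))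
    (he : 1 ≤ e) (hm : e ≤ m)
    {W' : Fin r' → Fin 3 → S} (hW' : ∀ j i, (W' j i).IsHomogeneous m)
    {W : Fin r → Fin 3 → S} (hW : ∀ j i, (W j i).IsHomogeneous (m + e))
    {b : Fin N → S} (hb : ∀ j, (b j).IsHomogeneous (m + 2 * e)) (hN : N = 3 * e ^ 2)
    (ε' : Dg (m + 2 * e) ≃ Fin r' ⊕ Fin N) (ε : Dg (m + e + 2 * e) ≃ Fin r ⊕ Fin N)
    (h1 : Dt ε' (cols W' b F G 1) ≠ 0) (h2 : Dt ε (cols W b F G (dir F)) ≠ 0) (t : ℂ) :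
    (∃ v : Fin 3 → ℂ, v ≠ 0 ∧ ∀ i, t * eval v (grad F i) + eval v (grad G i) = 0) ↔
      Dt ε (cols W b F G (C t * dir F + dir G)) = 0 := by
  constructor
  · rintro ⟨v, hv, h⟩
    exact sing_zero hF hG hW hb ε hv h
  intro hD
  obtain ⟨g1, hM, g3⟩ := good_Mn hF hG he hm hW' hb hN ε' h1
  have hcF := cols_hom hF hG hW hb (hom_dir hF) (by ring)
  have hs := ((Dt_iff ε _ hcF).1).1 h2
  have hli := (Dt_iff ε _ hcF).2 h2
  have hJ : Submodule.span ℂ (Set.range fun j => W j ⬝ᵥ Mn F G) = J F G (m + e) := by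
    apply Submodule.eq_of_le_of_finrank_le (spanW_le hW)
    have l1 : LinearIndependent ℂ (fun j => W j ⬝ᵥ Mn F G) :=
      hli.comp Sum.inl Sum.inl_injective
    rw [finrank_span_eq_card l1, Fintype.card_fin]
    have := finrank_J_le hF hG hM m
    rw [finrank_H, Fintype.card_congr ε, Fintype.card_sum, Fintype.card_fin, Fintype.card_fin] at this
    omega
  have key : ∀ L : S, L.IsHomogeneous e →
      (H (m + e + 2 * e) ≤ J F G (m + e) ⊔ (H (m + 2 * e)).map (LinearMap.mulLeft ℂ L)) →
      H (m + e + 2 * e) ≤ Submodule.span ℂ (Set.range (cols W b F G L)) := by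
    intro L hL h
    rw [span_cols, hJ]
    refine h.trans (sup_le le_sup_left ?_)
    refine (Submodule.map_mono g1).trans ?_
    rw [Submodule.map_sup]
    refine sup_le_sup ?_ ?_
    · rw [Submodule.map_le_iff_le_comap]
      exact mul_J hL m
    · rw [Submodule.map_span, ← Set.range_comp]; rfl
  have hsF : H (m + e + 2 * e) ≤
      J F G (m + e) ⊔ (H (m + 2 * e)).map (LinearMap.mulLeft ℂ (dir F)) := by
    rw [span_cols, hJ] at hs
    refine hs.trans (sup_le_sup_left ?_ _)
    rw [Submodule.span_le]
    rintro _ ⟨j, rfl⟩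
    exact ⟨b j, hb j, rfl⟩
  by_contra hcon
  push Not at hcon
  have hL' := pencil_hom hF hG t
  refine ((Dt_iff ε _ (cols_hom hF hG hW hb hL' (by ring))).1).2 (key _ hL'
    (core hF hG he hM (hom_dir hF) hm g3 hsF hL' ?_)) hD
  intro v hMv hLv
  by_contra hv
  obtain ⟨i, hi⟩ := hcon v hv
  refine hi (sing_of_Mn hMv hLv ?_ i)
  intro hdF
  exact h2 (Dt_vanish ε _ hcF v hv (cols_vanish hMv hdF))

lemma good_inf {F G : S} (hF : F.IsHomogeneous (e + 1)) (hG : G.IsHomogeneous (e + 1))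
    {W : Fin r → Fin 3 → S} (hW : ∀ j i, (W j i).IsHomogeneous (m + e))
    {b : Fin N → S} (hb : ∀ j, (b j).IsHomogeneous (m + 2 * e))
    (ε : Dg (m + e + 2 * e) ≃ Fin r ⊕ Fin N)
    (h2 : Dt ε (cols W b F G (dir F)) ≠ 0) (v : Fin 3 → ℂ) (hv : v ≠ 0) :
    ¬ ∀ i, eval v (grad F i) = 0 := by
  intro h
  refine h2 (Dt_vanish ε _ (cols_hom hF hG hW hb (hom_dir hF) (by ring)) v hv
    (cols_vanish (fun i => ?_) (dir_zero h)))
  have := congrFun (eval_Mn F G v) i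
  rw [this, show (fun i => eval v (grad F i)) = 0 from funext h]
  simp

end SMC


namespace SMC
open MvPolynomial Matrix

lemma exists_compl_fam {E : Type*} [AddCommGroup E] [Module ℂ E] (U : Submodule ℂ E)
    [FiniteDimensional ℂ U] (K : ℕ) :
    ∀ V : Submodule ℂ E, V ≤ U → Module.finrank ℂ U ≤ Module.finrank ℂ V + K →
    ∃ b : Fin K → E, (∀ j, b j ∈ U) ∧ U ≤ V ⊔ Submodule.span ℂ (Set.range b) := by
  induction K with
  | zero =>
    intro V hV h
    haveI : FiniteDimensional ℂ V := Submodule.finiteDimensional_of_le hV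
    have := Submodule.eq_of_le_of_finrank_le hV h
    exact ⟨fun j => j.elim0, fun j => j.elim0, by rw [this]; exact le_sup_left⟩
  | succ K ih =>
    intro V hV h
    by_cases hUV : U ≤ V
    · exact ⟨fun _ => 0, fun _ => U.zero_mem, hUV.trans le_sup_left⟩
    obtain ⟨s, hs, hsV⟩ := Set.not_subset.1 hUV
    have hle : V ⊔ Submodule.span ℂ {s} ≤ U :=
      sup_le hV ((Submodule.span_singleton_le_iff_mem _ _).2 hs)
    have hlt : V < V ⊔ Submodule.span ℂ {s} := by
      refine lt_of_le_of_ne le_sup_left fun h => hsV ?_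
      have h2 : s ∈ V ⊔ Submodule.span ℂ {s} :=
        Submodule.mem_sup_right (Submodule.mem_span_singleton_self s)
      rwa [← h] at h2
    haveI : FiniteDimensional ℂ ↥(V ⊔ Submodule.span ℂ {s}) := Submodule.finiteDimensional_of_le hle
    have := Submodule.finrank_lt_finrank_of_lt hlt
    obtain ⟨b, hb, hU⟩ := ih _ hle (by omega)
    refine ⟨Fin.cons s b, fun j => ?_, hU.trans ?_⟩
    · refine Fin.cases hs hb j
    · rw [Fin.range_cons, Submodule.span_insert, sup_assoc]

lemma exists_W (F G : S) (k : ℕ) : ∃ W : Fin (Module.finrank ℂ (J F G k)) → Fin 3 → S,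
    (∀ j i, (W j i).IsHomogeneous k) ∧
    Submodule.span ℂ (Set.range fun j => W j ⬝ᵥ Mn F G) = J F G k := by
  let B := Module.finBasis ℂ (J F G k)
  choose W hW hB using fun j => mem_J.1 (B j).2
  refine ⟨W, hW, ?_⟩
  have : (fun j => W j ⬝ᵥ Mn F G) = (J F G k).subtype ∘ B := by
    ext1 j; exact hB j
  rw [this, Set.range_comp, ← Submodule.map_span, B.span_eq, Submodule.map_subtype_top]

lemma Mt_update {A : Type*} [CommRing A] {n : ℕ} {ι : Type} [DecidableEq ι] (ε : Dg n ≃ ι)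
    (c : ι → MvPolynomial (Fin 3) A) (j : ι) (x : MvPolynomial (Fin 3) A) :
    Mt ε (Function.update c j x) = (Mt ε c).updateCol (ε.symm j) (fun i => coeff i.1 x) := by
  ext i k
  rw [updateCol_apply]
  split_ifs with h
  · subst h
    simp [Mt]
  · have : ε k ≠ j := fun h2 => h (by simp [← h2])
    simp [Mt, Function.update_of_ne this]

lemma Dt_update {A : Type*} [CommRing A] {n : ℕ} {ι : Type} [DecidableEq ι] (ε : Dg n ≃ ι)
    (c : ι → MvPolynomial (Fin 3) A) (j : ι) (t : A) (x y : MvPolynomial (Fin 3) A) :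
    Dt ε (Function.update c j (C t * x + y)) =
      t * Dt ε (Function.update c j x) + Dt ε (Function.update c j y) := by
  rw [Dt, Dt, Dt, Mt_update, Mt_update, Mt_update]
  have : (fun i : Dg n => coeff i.1 (C t * x + y)) =
    t • (fun i : Dg n => coeff i.1 x) + fun i : Dg n => coeff i.1 y := by
    ext i; simp
  rw [this, det_updateCol_add, det_updateCol_smul]

lemma ex_choice (n : ℕ) : ∃ (m r' r : ℕ) (W' : Fin r' → Fin 3 → S) (W : Fin r → Fin 3 → S)
    (b : Fin (3 * (n + 1) ^ 2) → S) (ε' : Dg (m + 2 * (n + 1)) ≃ Fin r' ⊕ Fin (3 * (n + 1) ^ 2))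
    (ε : Dg (m + (n + 1) + 2 * (n + 1)) ≃ Fin r ⊕ Fin (3 * (n + 1) ^ 2)),
    n + 1 ≤ m ∧ (∀ j i, (W' j i).IsHomogeneous m) ∧ (∀ j i, (W j i).IsHomogeneous (m + (n + 1))) ∧
    (∀ j, (b j).IsHomogeneous (m + 2 * (n + 1))) ∧
    Dt ε' (cols W' b (exF n) (exG n) 1) ≠ 0 ∧
    Dt ε (cols W b (exF n) (exG n) (dir (exF n))) ≠ 0 ∧
    ¬ Polynomial.X ^ 2 ∣ PA ε W b (exF n) (exG n) := by
  obtain ⟨ms, hms⟩ := ex_s n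
  obtain ⟨mF, hmF⟩ := null_J (homF n) (homG n) (hom_dir (homF n)) (ex_F n)
  obtain ⟨l, hl⟩ : ∃ l, l = ms + mF := ⟨_, rfl⟩
  obtain ⟨m, hm⟩ : ∃ m, m = l + (n + 1) := ⟨_, rfl⟩
  obtain ⟨sk, hsk, hskJ, hGs, hspG⟩ := hms m (by omega)
  have hspF := hmF m (by omega)
  have hM := exM_ne n
  have hF := homF n
  have hG := homG n
  have d1 : Module.finrank ℂ (H (m + 2 * (n + 1))) =
      Module.finrank ℂ (J (exF n) (exG n) m) + 3 * (n + 1) ^ 2 := by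
    subst hm
    exact le_antisymm (ex_dim n l) (finrank_J_le hF hG hM l)
  have d2 : Module.finrank ℂ (H (m + (n + 1) + 2 * (n + 1))) =
      Module.finrank ℂ (J (exF n) (exG n) (m + (n + 1))) + 3 * (n + 1) ^ 2 :=
    le_antisymm (ex_dim n m) (finrank_J_le hF hG hM m)
  generalize exF n = F at *
  generalize exG n = G at *
  obtain ⟨W', hW', sW'⟩ := exists_W F G m
  obtain ⟨W, hW, sW⟩ := exists_W F G (m + (n + 1))
  obtain ⟨N', hN'⟩ : ∃ N', 3 * (n + 1) ^ 2 = N' + 1 := ⟨3 * (n + 1) ^ 2 - 1, by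
    have : 0 < 3 * (n + 1) ^ 2 := by positivity
    omega⟩
  obtain ⟨b, j0, hb, hbj, hbs⟩ : ∃ (b : Fin (3 * (n + 1) ^ 2) → S) (j0 : Fin (3 * (n + 1) ^ 2)),
      (∀ j, (b j).IsHomogeneous (m + 2 * (n + 1))) ∧ b j0 = sk ∧
      H (m + 2 * (n + 1)) ≤ J F G m ⊔ Submodule.span ℂ (Set.range b) := by
    rw [hN'] at d1 ⊢
    have hle : J F G m ⊔ Submodule.span ℂ {sk} ≤ H (m + 2 * (n + 1)) :=
      sup_le (J_le hF hG m) ((Submodule.span_singleton_le_iff_mem _ _).2 hsk)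
    have hlt : J F G m < J F G m ⊔ Submodule.span ℂ {sk} := by
      refine lt_of_le_of_ne le_sup_left fun h => hskJ ?_
      have h2 : sk ∈ J F G m ⊔ Submodule.span ℂ {sk} :=
        Submodule.mem_sup_right (Submodule.mem_span_singleton_self sk)
      rwa [← h] at h2
    have := Submodule.finrank_lt_finrank_of_lt hlt
    obtain ⟨b, hb, hU⟩ := exists_compl_fam (H (m + 2 * (n + 1))) N' _ hle (by omega)
    refine ⟨Fin.cons sk b, 0, fun j => ?_, rfl, hU.trans ?_⟩
    · refine Fin.cases hsk hb j
    · rw [Fin.range_cons, Submodule.span_insert, sup_assoc]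
  obtain ⟨ε'⟩ : Nonempty (Dg (m + 2 * (n + 1)) ≃ Fin (Module.finrank ℂ (J F G m)) ⊕ Fin (3 * (n + 1) ^ 2)) := by
    refine ⟨Fintype.equivOfCardEq ?_⟩
    rw [← finrank_H, d1]; simp
  obtain ⟨ε⟩ : Nonempty (Dg (m + (n + 1) + 2 * (n + 1)) ≃
      Fin (Module.finrank ℂ (J F G (m + (n + 1)))) ⊕ Fin (3 * (n + 1) ^ 2)) := by
    refine ⟨Fintype.equivOfCardEq ?_⟩
    rw [← finrank_H, d2]; simp
  refine ⟨m, _, _, W', W, b, ε', ε, by omega, hW', hW, hb, ?_, ?_, ?_⟩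
  · refine ((Dt_iff ε' _ (cols_hom hF hG hW' hb (isHomogeneous_one _ _) (by ring))).1).2 ?_
    rw [span_cols, sW']
    simpa using hbs
  · refine ((Dt_iff ε _ (cols_hom hF hG hW hb (hom_dir hF) (by ring))).1).2 ?_
    rw [span_cols, sW]
    refine hspF.trans (sup_le le_sup_left ?_)
    refine (Submodule.map_mono hbs).trans ?_
    rw [Submodule.map_sup]
    refine sup_le_sup ?_ ?_
    · rw [Submodule.map_le_iff_le_comap]
      exact mul_J (hom_dir hF) m
    · rw [Submodule.map_span, ← Set.range_comp]; rfl
  · let cP := cols (fun j i => MvPolynomial.map Polynomial.C (W j i))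
      (fun j => MvPolynomial.map Polynomial.C (b j))
      (MvPolynomial.map Polynomial.C F) (MvPolynomial.map Polynomial.C G)
      (C Polynomial.X * dir (MvPolynomial.map Polynomial.C F) + dir (MvPolynomial.map Polynomial.C G))
    let Dp : Polynomial ℂ := Dt ε (Function.update cP (Sum.inr j0)
      (MvPolynomial.map Polynomial.C (dir F * sk)))
    have hDe : ∀ t, Dp.eval t = Dt ε (Function.update (cols W b F G (C t * dir F + dir G))
        (Sum.inr j0) (dir F * sk)) := by
      intro t
      have hid : (Polynomial.evalRingHom t).comp Polynomial.C = RingHom.id ℂ := by ext; simp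
      rw [← Polynomial.coe_evalRingHom, map_Dt]
      congr 1
      ext1 j
      by_cases hj : j = Sum.inr j0
      · subst hj
        simp only [Function.update_self, MvPolynomial.map_map, hid, MvPolynomial.map_id,
          RingHom.id_apply]
      · simp only [Function.update_of_ne hj, cP]
        rw [map_cols]
        simp only [map_add, map_mul, map_C, map_dir, MvPolynomial.map_map, hid,
          Polynomial.coe_evalRingHom, Polynomial.eval_X, MvPolynomial.map_id, RingHom.id_apply]
    have hPX : PA ε W b F G = Polynomial.X * Dp := by
      apply Polynomial.funext
      intro t
      rw [eval_PA, Polynomial.eval_mul, Polynomial.eval_X, hDe]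
      have h1 : cols W b F G (C t * dir F + dir G) =
          Function.update (cols W b F G (C t * dir F + dir G)) (Sum.inr j0)
            (C t * (dir F * sk) + dir G * sk) := by
        rw [eq_comm, Function.update_eq_self_iff]
        simp only [cols, Sum.elim_inr, hbj]
        ring
      rw [h1, Dt_update, Function.update_idem]
      have h2 : Dt ε (Function.update (cols W b F G (C t * dir F + dir G)) (Sum.inr j0)
          (dir G * sk)) = 0 := by
        by_contra hne
        have hli := (Dt_iff ε _ (fun j => by
          by_cases hj : j = Sum.inr j0
          · subst hj
            rw [Function.update_self]
            have := (hom_dir hG).mul hsk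
            rwa [show n + 1 + (m + 2 * (n + 1)) = m + (n + 1) + 2 * (n + 1) by ring] at this
          · rw [Function.update_of_ne hj]
            exact cols_hom hF hG hW hb (pencil_hom hF hG t) (by ring) j)).2 hne
        have := (linearIndependent_iff_notMem_span.1 hli) (Sum.inr j0)
        rw [Function.update_self] at this
        apply this
        rw [← sW] at hGs
        refine Submodule.span_mono ?_ hGs
        rintro _ ⟨j, rfl⟩
        exact ⟨Sum.inl j, by simp, by simp [cols]⟩
      rw [h2, add_zero]
    have hD0 : Dp.eval 0 ≠ 0 := by
      rw [hDe]
      refine ((Dt_iff ε _ (fun j => by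
          by_cases hj : j = Sum.inr j0
          · subst hj
            rw [Function.update_self]
            have := (hom_dir hF).mul hsk
            rwa [show n + 1 + (m + 2 * (n + 1)) = m + (n + 1) + 2 * (n + 1) by ring] at this
          · rw [Function.update_of_ne hj]
            exact cols_hom hF hG hW hb (pencil_hom hF hG 0) (by ring) j)).1).2 ?_
      have i1 : J F G (m + (n + 1)) ≤ Submodule.span ℂ (Set.range
          (Function.update (cols W b F G (C 0 * dir F + dir G)) (Sum.inr j0) (dir F * sk))) := by
        refine sW.ge.trans (Submodule.span_mono ?_)
        rintro _ ⟨j, rfl⟩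
        exact ⟨Sum.inl j, by simp [cols]⟩
      refine hspG.trans (sup_le (sup_le i1 ?_) ?_)
      · rw [Submodule.span_singleton_le_iff_mem]
        exact Submodule.subset_span ⟨Sum.inr j0, by simp⟩
      · refine (Submodule.map_mono hbs).trans ?_
        rw [Submodule.map_sup]
        refine sup_le ?_ ?_
        · refine le_trans ?_ i1
          rw [Submodule.map_le_iff_le_comap]
          exact mul_J (hom_dir hG) m
        · rw [Submodule.map_span, Submodule.span_le]
          rintro _ ⟨_, ⟨j, rfl⟩, rfl⟩
          by_cases hj : j = j0
          · subst hj
            rw [LinearMap.mulLeft_apply, hbj]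
            exact i1 hGs
          · refine Submodule.subset_span ⟨Sum.inr j, ?_⟩
            rw [Function.update_of_ne (by simpa using hj)]
            simp [cols]
    rw [hPX, pow_two, mul_dvd_mul_iff_left Polynomial.X_ne_zero, Polynomial.X_dvd_iff,
      Polynomial.coeff_zero_eq_eval_zero]
    exact hD0

end SMC


namespace SMC
open MvPolynomial Matrix

abbrev Sg (d : ℕ) := Dg d ⊕ Dg d
abbrev Rr (d : ℕ) := MvPolynomial (Sg d) ℂ

def frm {d : ℕ} (a : Dg d → ℂ) : S := ((coord d).symm a).1
lemma frm_def {d : ℕ} (a : Dg d → ℂ) : frm a = ∑ m : Dg d, monomial m.1 (a m) := rfl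
lemma frm_hom {d : ℕ} (a : Dg d → ℂ) : (frm a).IsHomogeneous d := ((coord d).symm a).2
lemma frm_coeff {d : ℕ} {F : S} (hF : F.IsHomogeneous d) :
    frm (fun m : Dg d => coeff m.1 F) = F := by
  have := (coord d).symm_apply_apply ⟨F, hF⟩
  exact congrArg Subtype.val this

def frF {d : ℕ} (a : Sg d → ℂ) : S := frm (fun m => a (Sum.inl m))
def frG {d : ℕ} (a : Sg d → ℂ) : S := frm (fun m => a (Sum.inr m))

def gF (d : ℕ) : MvPolynomial (Fin 3) (Rr d) := ∑ m : Dg d, monomial m.1 (X (Sum.inl m))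
def gG (d : ℕ) : MvPolynomial (Fin 3) (Rr d) := ∑ m : Dg d, monomial m.1 (X (Sum.inr m))

lemma map_gF {d : ℕ} (a : Sg d → ℂ) : MvPolynomial.map (eval a) (gF d) = frF a := by
  simp [gF, frF, frm_def, map_monomial]
lemma map_gG {d : ℕ} (a : Sg d → ℂ) : MvPolynomial.map (eval a) (gG d) = frG a := by
  simp [gG, frG, frm_def, map_monomial]

/-- singular parameter set -/
def Sing {d : ℕ} (a : Sg d → ℂ) (t : ℂ) : Prop :=
  ∃ v : Fin 3 → ℂ, v ≠ 0 ∧ ∀ i, t * eval v (grad (frF a) i) + eval v (grad (frG a) i) = 0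

lemma ex_G_sing (n : ℕ) : ∃ v : Fin 3 → ℂ, v ≠ 0 ∧ ∀ i, eval v (grad (exG n) i) = 0 := by
  refine ⟨fun _ => 1, fun h => by simpa using congrFun h 0, fun i => ?_⟩
  rw [exG_grad, pf, pg]
  fin_cases i <;> simp [k1, k2, ux, uy]
  ring

lemma part2 (n : ℕ) : ∃ (P : Polynomial (Rr (n + 1 + 1))) (Q : Rr (n + 1 + 1))
    (a1 : Sg (n + 1 + 1) → ℂ),
    P.natDegree ≤ 3 * (n + 1) ^ 2 ∧
    (∀ a, eval a Q ≠ 0 → eval a (P.coeff (3 * (n + 1) ^ 2)) ≠ 0) ∧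
    (∀ a t, Sing a t → (P.map (eval a)).eval t = 0) ∧
    (∀ a, eval a Q ≠ 0 → ∀ t, (P.map (eval a)).eval t = 0 → Sing a t) ∧
    (∀ a, eval a Q ≠ 0 → ∀ v : Fin 3 → ℂ, v ≠ 0 → ¬ ∀ i, eval v (grad (frF a) i) = 0) ∧
    (∀ a, eval a Q ≠ 0 → Mn (frF a) (frG a) ≠ 0) ∧
    eval a1 Q ≠ 0 ∧ Sing a1 0 ∧ ¬ Polynomial.X ^ 2 ∣ P.map (eval a1) := by
  obtain ⟨m, r', r, W', W, b, ε', ε, hm, hW', hW, hb, h1, h2, h3⟩ := ex_choice n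
  let cW' := fun j i => MvPolynomial.map (C : ℂ →+* Rr (n + 1 + 1)) (W' j i)
  let cW := fun j i => MvPolynomial.map (C : ℂ →+* Rr (n + 1 + 1)) (W j i)
  let cb := fun j => MvPolynomial.map (C : ℂ →+* Rr (n + 1 + 1)) (b j)
  have hid : ∀ a : Sg (n + 1 + 1) → ℂ, (eval a).comp C = RingHom.id ℂ := by
    intro a; ext; simp
  have q1 : ∀ a : Sg (n + 1 + 1) → ℂ, eval a (Dt ε' (cols cW' cb (gF _) (gG _) 1)) =
      Dt ε' (cols W' b (frF a) (frG a) 1) := by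
    intro a
    rw [map_Dt]
    simp_rw [map_cols]
    simp only [map_gF, map_gG, map_one, cW', cb, MvPolynomial.map_map, hid, MvPolynomial.map_id,
      RingHom.id_apply]
  have q2 : ∀ a : Sg (n + 1 + 1) → ℂ, eval a (Dt ε (cols cW cb (gF _) (gG _) (dir (gF _)))) =
      Dt ε (cols W b (frF a) (frG a) (dir (frF a))) := by
    intro a
    rw [map_Dt]
    simp_rw [map_cols]
    simp only [map_dir, map_gF, map_gG, cW, cb, MvPolynomial.map_map, hid, MvPolynomial.map_id,
      RingHom.id_apply]
  have q3 : ∀ a : Sg (n + 1 + 1) → ℂ, (PA ε cW cb (gF _) (gG _)).map (eval a) =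
      PA ε W b (frF a) (frG a) := by
    intro a
    rw [map_PA]
    simp only [map_dir, map_gF, map_gG, cW, cb, MvPolynomial.map_map, hid, MvPolynomial.map_id,
      RingHom.id_apply]
  have hFa : ∀ a : Sg (n + 1 + 1) → ℂ, (frF a).IsHomogeneous (n + 1 + 1) := fun a => frm_hom _
  have hGa : ∀ a : Sg (n + 1 + 1) → ℂ, (frG a).IsHomogeneous (n + 1 + 1) := fun a => frm_hom _
  let a1 : Sg (n + 1 + 1) → ℂ := Sum.elim (fun m => coeff m.1 (exF n)) (fun m => coeff m.1 (exG n))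
  have hF1 : frF a1 = exF n := frm_coeff (homF n)
  have hG1 : frG a1 = exG n := frm_coeff (homG n)
  refine ⟨PA ε cW cb (gF _) (gG _), Dt ε' (cols cW' cb (gF _) (gG _) 1) *
    Dt ε (cols cW cb (gF _) (gG _) (dir (gF _))), a1, (PA_deg _ _ _ _ _).1, ?_, ?_, ?_, ?_, ?_,
    ?_, ?_, ?_⟩
  · intro a ha
    rw [(PA_deg _ _ _ _ _).2]
    rw [map_mul] at ha
    exact right_ne_zero_of_mul ha
  · rintro a t ⟨v, hv, h⟩
    rw [q3, eval_PA]
    exact sing_zero (hFa a) (hGa a) hW hb ε hv h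
  · intro a ha t ht
    rw [q3, eval_PA] at ht
    rw [map_mul, q1, q2] at ha
    exact (good_iff (hFa a) (hGa a) (by omega) hm hW' hW hb rfl ε' ε (left_ne_zero_of_mul ha)
      (right_ne_zero_of_mul ha) t).2 ht
  · intro a ha v hv
    rw [map_mul, q1, q2] at ha
    exact good_inf (hFa a) (hGa a) hW hb ε (right_ne_zero_of_mul ha) v hv
  · intro a ha
    rw [map_mul, q1, q2] at ha
    exact (good_Mn (hFa a) (hGa a) (by omega) hm hW' hb rfl ε' (left_ne_zero_of_mul ha)).2.1
  · rw [map_mul, q1, q2, hF1, hG1]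
    exact mul_ne_zero h1 h2
  · obtain ⟨v, hv, h⟩ := ex_G_sing n
    exact ⟨v, hv, fun i => by rw [hG1, h i]; simp⟩
  · rw [q3, hF1, hG1]
    exact h3

end SMC


namespace SMC
open MvPolynomial Matrix

lemma hom_eval {A B : Type*} [CommRing A] [CommRing B] (φ : A →+* B) (v : Fin 3 → A)
    (p : MvPolynomial (Fin 3) A) :
    φ (eval v p) = eval (fun i => φ (v i)) (MvPolynomial.map φ p) := by
  induction p using MvPolynomial.induction_on with
  | C a => simp
  | add p q hp hq => simp [hp, hq]
  | mul_X p i hp => simp [hp]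

lemma eval_smul_hom {n : ℕ} {p : S} (hp : p.IsHomogeneous n) (c : ℂ) (v : Fin 3 → ℂ) :
    eval (c • v) p = c ^ n * eval v p := by
  rw [eval_eq', eval_eq', Finset.mul_sum]
  refine Finset.sum_congr rfl fun m hm => ?_
  have h1 : m.degree = n := by
    by_contra hne
    exact mem_support_iff.1 hm (hp.coeff_eq_zero hne)
  simp only [Pi.smul_apply, smul_eq_mul, mul_pow, Finset.prod_mul_distrib, Finset.prod_pow_eq_pow_sum]
  rw [← h1, Finsupp.degree_eq_sum]
  ring

lemma exists_w (v1 v2 : Fin 3 → ℂ) (h1 : v1 ≠ 0) (h2 : v2 ≠ 0) :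
    ∃ w : Fin 3 → ℂ, w ⬝ᵥ v1 ≠ 0 ∧ w ⬝ᵥ v2 ≠ 0 := by
  obtain ⟨i, hi⟩ := Function.ne_iff.1 h1
  obtain ⟨j, hj⟩ := Function.ne_iff.1 h2
  simp only [Pi.zero_apply] at hi hj
  by_cases a : v1 j = 0
  · by_cases b : v2 i = 0
    · exact ⟨Pi.single i 1 + Pi.single j 1, by simp [a, hi, add_dotProduct], by simp [b, hj, add_dotProduct]⟩
    · exact ⟨Pi.single i 1, by simp [hi], by simp [b]⟩
  · exact ⟨Pi.single j 1, by simp [a], by simp [hj]⟩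

section
variable {A B : Type*} [CommRing A] [CommRing B]

def lf (w : Fin 3 → A) : MvPolynomial (Fin 3) A := C (w 0) * X 0 + C (w 1) * X 1 + C (w 2) * X 2

/-- correct a form so that it becomes singular -/
def fixf (e : ℕ) (w c : Fin 3 → A) (F : MvPolynomial (Fin 3) A) : MvPolynomial (Fin 3) A :=
  F - lf w ^ e * lf c

def cc (κ : A) (w v : Fin 3 → A) (F : MvPolynomial (Fin 3) A) : Fin 3 → A :=
  fun i => eval v (grad F i) - κ * (∑ j, eval v (grad F j) * v j) * w i

lemma map_lf (φ : A →+* B) (w : Fin 3 → A) :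
    MvPolynomial.map φ (lf w) = lf (fun i => φ (w i)) := by
  simp [lf]

lemma map_fixf (φ : A →+* B) (e : ℕ) (w c : Fin 3 → A) (F : MvPolynomial (Fin 3) A) :
    MvPolynomial.map φ (fixf e w c F) =
      fixf e (fun i => φ (w i)) (fun i => φ (c i)) (MvPolynomial.map φ F) := by
  simp [fixf, map_lf]

lemma map_cc (φ : A →+* B) (κ : A) (w v : Fin 3 → A) (F : MvPolynomial (Fin 3) A) (i : Fin 3) :
    φ (cc κ w v F i) = cc (φ κ) (fun i => φ (w i)) (fun i => φ (v i)) (MvPolynomial.map φ F) i := by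
  simp [cc, hom_eval, map_grad]
end

lemma lf_hom (w : Fin 3 → ℂ) : (lf w).IsHomogeneous 1 := by
  have : ∀ i, (C (w i) * X i : S).IsHomogeneous 1 := by
    intro i
    have := (isHomogeneous_C (Fin 3) (w i)).mul (isHomogeneous_X ℂ i)
    rwa [zero_add] at this
  exact ((this 0).add (this 1)).add (this 2)

lemma fixf_hom {e : ℕ} {F : S} (hF : F.IsHomogeneous (e + 1)) (w c : Fin 3 → ℂ) :
    (fixf e w c F).IsHomogeneous (e + 1) := by
  have := ((lf_hom w).pow e).mul (lf_hom c)
  rw [one_mul] at this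
  exact hF.sub this

lemma grad_lf (w : Fin 3 → ℂ) (i : Fin 3) : pderiv i (lf w) = C (w i) := by
  fin_cases i <;> simp [lf, pderiv_X, Pi.single_apply]

lemma fixf_sing {e : ℕ} (F : S) (w v : Fin 3 → ℂ) (hw : w ⬝ᵥ v = 1) (i : Fin 3) :
    eval v (grad (fixf e w (cc ((e : ℂ) / (e + 1)) w v F) F) i) = 0 := by
  have he : (e : ℂ) + 1 ≠ 0 := by exact_mod_cast Nat.succ_ne_zero e
  have hl : ∀ c, eval v (lf c) = c ⬝ᵥ v := by
    intro c; simp [lf, dotProduct, Fin.sum_univ_three]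
  rw [grad, fixf, map_sub, Derivation.leibniz, Derivation.leibniz_pow, grad_lf, grad_lf]
  simp only [map_sub, map_add, smul_eq_mul, map_mul, map_pow, eval_C, hl, hw, nsmul_eq_mul,
    map_natCast, one_pow, one_mul, mul_one]
  have hc : cc ((e : ℂ) / (e + 1)) w v F ⬝ᵥ v = (∑ j, eval v (grad F j) * v j) / (e + 1) := by
    rw [dotProduct] at hw ⊢
    simp only [cc, sub_mul, Finset.sum_sub_distrib]
    have : ∀ x : ℂ, ∑ j, x * w j * v j = x := by
      intro x
      simp only [mul_assoc]
      rw [← Finset.mul_sum, hw, mul_one]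
    rw [this]
    field_simp
    ring
  rw [hc]
  simp only [cc, grad]
  field_simp
  ring

lemma fixf_zero {e : ℕ} (F : S) (κ : ℂ) (w v : Fin 3 → ℂ) (h : ∀ i, eval v (grad F i) = 0) :
    fixf e w (cc κ w v F) F = F := by
  have : cc κ w v F = 0 := by
    ext i; simp [cc, h]
  rw [this, fixf]
  simp [lf]

lemma curve {e : ℕ} (a1 a2 : Sg (e + 1) → ℂ) (t1 t2 : ℂ) (h1 : Sing a1 t1) (h2 : Sing a2 t2) :
    ∃ (A : Sg (e + 1) → Polynomial ℂ) (T : Polynomial ℂ),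
      (∀ s, Sing (fun i => (A i).eval s) (T.eval s)) ∧
      (∀ i, (A i).eval 0 = a1 i) ∧ T.eval 0 = t1 ∧ (∀ i, (A i).eval 1 = a2 i) ∧ T.eval 1 = t2 := by
  obtain ⟨u1, hu1, k1⟩ := h1
  obtain ⟨u2, hu2, k2⟩ := h2
  obtain ⟨w, hw1, hw2⟩ := exists_w u1 u2 hu1 hu2
  let H1 : S := C t1 * frF a1 + frG a1
  let H2 : S := C t2 * frF a2 + frG a2
  have hH : ∀ (t : ℂ) (a : Sg (e + 1) → ℂ), (C t * frF a + frG a).IsHomogeneous (e + 1) := by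
    intro t a
    have := (isHomogeneous_C (Fin 3) t).mul (frm_hom fun m => a (Sum.inl m))
    rw [zero_add] at this
    exact this.add (frm_hom _)
  have gH : ∀ (t : ℂ) (a : Sg (e + 1) → ℂ) (v : Fin 3 → ℂ) (i : Fin 3),
      eval v (grad (C t * frF a + frG a) i) =
      t * eval v (grad (frF a) i) + eval v (grad (frG a) i) := by
    intro t a v i; simp [grad]
  obtain ⟨v1, hv1, g1⟩ : ∃ v1 : Fin 3 → ℂ, w ⬝ᵥ v1 = 1 ∧ ∀ i, eval v1 (grad H1 i) = 0 := by
    refine ⟨(w ⬝ᵥ u1)⁻¹ • u1, by simp [hw1], fun i => ?_⟩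
    rw [eval_smul_hom (hom_grad (hH t1 a1) i), gH, k1, mul_zero]
  obtain ⟨v2, hv2, g2⟩ : ∃ v2 : Fin 3 → ℂ, w ⬝ᵥ v2 = 1 ∧ ∀ i, eval v2 (grad H2 i) = 0 := by
    refine ⟨(w ⬝ᵥ u2)⁻¹ • u2, by simp [hw2], fun i => ?_⟩
    rw [eval_smul_hom (hom_grad (hH t2 a2) i), gH, k2, mul_zero]
  let pX : Polynomial ℂ := Polynomial.X
  let pw : Fin 3 → Polynomial ℂ := fun i => Polynomial.C (w i)
  let pv : Fin 3 → Polynomial ℂ := fun i => Polynomial.C (v1 i) + pX * Polynomial.C (v2 i - v1 i)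
  let pH : MvPolynomial (Fin 3) (Polynomial ℂ) :=
    MvPolynomial.map Polynomial.C H1 + C pX * MvPolynomial.map Polynomial.C (H2 - H1)
  let pK := fixf e pw (cc (Polynomial.C ((e : ℂ) / (e + 1))) pw pv pH) pH
  let T : Polynomial ℂ := Polynomial.C t1 + pX * Polynomial.C (t2 - t1)
  let AF : Dg (e + 1) → Polynomial ℂ := fun m =>
    Polynomial.C (a1 (Sum.inl m)) + pX * Polynomial.C (a2 (Sum.inl m) - a1 (Sum.inl m))
  let AG : Dg (e + 1) → Polynomial ℂ := fun m => coeff m.1 pK - T * AF m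
  have hid : ∀ s : ℂ, (Polynomial.evalRingHom s).comp Polynomial.C = RingHom.id ℂ := by
    intro s; ext; simp
  let sv : ℂ → Fin 3 → ℂ := fun s i => v1 i + s * (v2 i - v1 i)
  let sH : ℂ → S := fun s => H1 + C s * (H2 - H1)
  have mH : ∀ s, MvPolynomial.map (Polynomial.evalRingHom s) pH = sH s := by
    intro s
    simp only [pH, sH, map_add, map_mul, MvPolynomial.map_map, hid, MvPolynomial.map_id, map_C, pX,
      Polynomial.coe_evalRingHom, Polynomial.eval_X]
  have mK : ∀ s, MvPolynomial.map (Polynomial.evalRingHom s) pK =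
      fixf e w (cc ((e : ℂ) / (e + 1)) w (sv s) (sH s)) (sH s) := by
    intro s
    simp only [pK, map_fixf, map_cc, mH]
    simp [pw, pv, sv, pX]
  have hsH : ∀ s, (sH s).IsHomogeneous (e + 1) := by
    intro s
    have := (isHomogeneous_C (Fin 3) s).mul ((hH t2 a2).sub (hH t1 a1))
    rw [zero_add] at this
    exact (hH t1 a1).add this
  have cK : ∀ s (m : Dg (e + 1)), (coeff m.1 pK).eval s =
      coeff m.1 (fixf e w (cc ((e : ℂ) / (e + 1)) w (sv s) (sH s)) (sH s)) := by
    intro s m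
    rw [← mK, coeff_map]; rfl
  have fc : ∀ (m : Dg (e + 1)) (a : Dg (e + 1) → ℂ), coeff m.1 (frm a) = a m := by
    intro m a
    exact congrFun ((coord (e + 1)).apply_symm_apply a) m
  have cH : ∀ (t : ℂ) (a : Sg (e + 1) → ℂ) (m : Dg (e + 1)), coeff m.1 (C t * frF a + frG a) =
      t * a (Sum.inl m) + a (Sum.inr m) := by
    intro t a m
    rw [coeff_add, coeff_C_mul, frF, frG, fc, fc]
  refine ⟨Sum.elim AF AG, T, fun s => ?_, ?_, by simp [T, pX], ?_, by simp [T, pX]⟩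
  · have hwv : w ⬝ᵥ sv s = 1 := by
      have : sv s = v1 + s • (v2 - v1) := by ext i; simp [sv]
      rw [this]; simp [hv1, hv2]
    refine ⟨sv s, fun h => by simp [h] at hwv, fun i => ?_⟩
    rw [← gH]
    have : C (T.eval s) * frF (fun i => (Sum.elim AF AG i).eval s) +
        frG (fun i => (Sum.elim AF AG i).eval s) =
        fixf e w (cc ((e : ℂ) / (e + 1)) w (sv s) (sH s)) (sH s) := by
      rw [← frm_coeff (fixf_hom (hsH s) _ _), ← frm_coeff (hH (T.eval s) _)]
      congr 1
      ext1 m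
      rw [cH]
      simp only [Sum.elim_inl, Sum.elim_inr, AG, Polynomial.eval_sub, Polynomial.eval_mul, cK]
      ring
    rw [this]
    exact fixf_sing _ _ _ hwv i
  · rintro (m | m)
    · simp [AF, pX]
    · simp only [Sum.elim_inr, AG, Polynomial.eval_sub, Polynomial.eval_mul, cK]
      have e1 : sv 0 = v1 := by ext i; simp [sv]
      have e2 : sH 0 = H1 := by simp [sH]
      rw [e1, e2, fixf_zero _ _ _ _ g1, cH]
      simp [T, AF, pX]
  · rintro (m | m)
    · simp [AF, pX]
    · simp only [Sum.elim_inr, AG, Polynomial.eval_sub, Polynomial.eval_mul, cK]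
      have e1 : sv 1 = v2 := by ext i; simp [sv]
      have e2 : sH 1 = H2 := by simp [sH]
      rw [e1, e2, fixf_zero _ _ _ _ g2, cH]
      simp [T, AF, pX]

def ev {d : ℕ} (a : Sg d → ℂ) (t : ℂ) (q : Polynomial (Rr d)) : ℂ := (q.map (eval a)).eval t

lemma irred {e : ℕ} (q r : Polynomial (Rr (e + 1)))
    (h : ∀ a t, Sing a t → ev a t (q * r) = 0) :
    (∀ a t, Sing a t → ev a t q = 0) ∨ (∀ a t, Sing a t → ev a t r = 0) := by
  by_contra hcon
  push Not at hcon
  obtain ⟨⟨a1, t1, s1, n1⟩, ⟨a2, t2, s2, n2⟩⟩ := hcon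
  obtain ⟨A, T, hs, h0, h0', h1, h1'⟩ := curve a1 a2 t1 t2 s1 s2
  let Φ : Polynomial (Rr (e + 1)) →+* Polynomial ℂ :=
    Polynomial.eval₂RingHom (eval₂Hom Polynomial.C A) T
  have hΦ : ∀ s q, (Φ q).eval s = ev (fun i => (A i).eval s) (T.eval s) q := by
    intro s q
    have : (Polynomial.evalRingHom s).comp Φ = (Polynomial.evalRingHom (T.eval s)).comp
        (Polynomial.mapRingHom (eval fun i => (A i).eval s)) := by
      apply Polynomial.ringHom_ext'
      · apply MvPolynomial.ringHom_ext
        · intro x; simp [Φ]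
        · intro x; simp [Φ]
      · simp [Φ]
    have := congrArg (fun f => f q) this
    simpa [ev] using this
  have hz : Φ (q * r) = 0 := by
    apply Polynomial.funext
    intro s
    rw [hΦ, h _ _ (hs s)]; simp
  rw [map_mul, mul_eq_zero] at hz
  rcases hz with hz | hz
  · apply n1
    have := hΦ 0 q
    rw [hz, h0', show (fun i => (A i).eval 0) = a1 from funext h0] at this
    simpa using this.symm
  · apply n2
    have := hΦ 1 r
    rw [hz, h1', show (fun i => (A i).eval 1) = a2 from funext h1] at this
    simpa using this.symm

end SMC


namespace SMC
open MvPolynomial Matrix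

section ufd
variable {R : Type*} [CommRing R] [IsDomain R] [UniqueFactorizationMonoid R]

lemma clear_den (p : Polynomial (FractionRing R)) : ∃ (c : R) (p' : Polynomial R), c ≠ 0 ∧
    p'.map (algebraMap R (FractionRing R)) = Polynomial.C (algebraMap R (FractionRing R) c) * p := by
  obtain ⟨c, hc, h⟩ := IsLocalization.integerNormalization_spec (nonZeroDivisors R) p
  refine ⟨c, IsLocalization.integerNormalization (nonZeroDivisors R) p, nonZeroDivisors.ne_zero hc, ?_⟩
  rw [h, ← algebraMap_smul (FractionRing R) c p, Polynomial.smul_eq_C_mul]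

lemma bezout (p q : Polynomial R) (h : IsCoprime (p.map (algebraMap R (FractionRing R)))
    (q.map (algebraMap R (FractionRing R)))) :
    ∃ (u v : Polynomial R) (ρ : R), ρ ≠ 0 ∧ u * p + v * q = Polynomial.C ρ := by
  obtain ⟨u, v, huv⟩ := h
  obtain ⟨c, u', hc, hu⟩ := clear_den u
  obtain ⟨c', v', hc', hv⟩ := clear_den v
  refine ⟨Polynomial.C c' * u', Polynomial.C c * v', c * c', mul_ne_zero hc hc', ?_⟩
  apply Polynomial.map_injective _ (IsFractionRing.injective R (FractionRing R))
  simp only [Polynomial.map_add, Polynomial.map_mul, hu, hv, Polynomial.map_C, map_mul]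
  linear_combination (Polynomial.C (algebraMap R (FractionRing R) c) *
    Polynomial.C (algebraMap R (FractionRing R) c')) * huv

lemma sep_or (P : Polynomial R) (hP : P ≠ 0) [CharZero (FractionRing R)] :
    (∃ (u v : Polynomial R) (ρ : R), ρ ≠ 0 ∧ u * P + v * P.derivative = Polynomial.C ρ) ∨
    ∃ (q r : Polynomial R) (m : ℕ), 2 ≤ m ∧ P = q ^ m * r ∧ 0 < q.natDegree ∧
      ∃ (u v : Polynomial R) (ρ : R), ρ ≠ 0 ∧ u * q + v * r = Polynomial.C ρ := by
  letI : NormalizationMonoid R := (UniqueFactorizationMonoid.strongNormalizationMonoid (α := R)).toNormalizationMonoid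
  letI := UniqueFactorizationMonoid.toNormalizedGCDMonoid R
  have hinj := IsFractionRing.injective R (FractionRing R)
  by_cases hs : Squarefree (P.map (algebraMap R (FractionRing R)))
  · left
    rw [← PerfectField.separable_iff_squarefree, Polynomial.Separable, Polynomial.derivative_map] at hs
    exact bezout _ _ hs
  · right
    have hPK : P.map (algebraMap R (FractionRing R)) ≠ 0 := by
      rwa [Ne, Polynomial.map_eq_zero_iff hinj]
    rw [squarefree_iff_irreducible_sq_not_dvd_of_ne_zero hPK] at hs
    push Not at hs
    obtain ⟨π, hπ, hdvd⟩ := hs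
    obtain ⟨c, p', hc, hp'⟩ := clear_den π
    have hcK : algebraMap R (FractionRing R) c ≠ 0 := by
      rwa [Ne, map_eq_zero_iff _ hinj]
    have hp0 : p' ≠ 0 := by
      rintro rfl
      rw [Polynomial.map_zero, eq_comm, mul_eq_zero, Polynomial.C_eq_zero] at hp'
      exact hp'.elim hcK hπ.ne_zero
    have hcon : algebraMap R (FractionRing R) p'.content ≠ 0 := by
      rw [Ne, map_eq_zero_iff _ hinj, Polynomial.content_eq_zero_iff]; exact hp0
    have hass : Associated (p'.primPart.map (algebraMap R (FractionRing R))) π := by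
      have h1 := hp'
      rw [p'.eq_C_content_mul_primPart, Polynomial.map_mul, Polynomial.map_C] at h1
      have u1 : IsUnit (Polynomial.C (algebraMap R (FractionRing R) p'.content)) :=
        Polynomial.isUnit_C.2 (isUnit_iff_ne_zero.2 hcon)
      have u2 : IsUnit (Polynomial.C (algebraMap R (FractionRing R) c)) :=
        Polynomial.isUnit_C.2 (isUnit_iff_ne_zero.2 hcK)
      have a1 := associated_unit_mul_left (p'.primPart.map (algebraMap R (FractionRing R))) _ u1
      have a2 := associated_unit_mul_left π _ u2
      rw [← h1] at a2
      exact a1.symm.trans a2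
    have hprim := p'.isPrimitive_primPart
    generalize p'.primPart = q at hass hprim
    have hq : Irreducible (q.map (algebraMap R (FractionRing R))) := hass.symm.irreducible hπ
    have hqdeg : 0 < q.natDegree := by
      rw [← Polynomial.natDegree_map_eq_of_injective hinj]
      exact hq.natDegree_pos
    have hnu : ¬ IsUnit q := fun h => hq.not_isUnit (h.map (Polynomial.mapRingHom _))
    have hfin := FiniteMultiplicity.of_not_isUnit hnu hP
    obtain ⟨r, hr, hnr⟩ := hfin.exists_eq_pow_mul_and_not_dvd
    refine ⟨q, r, _, ?_, hr, hqdeg, bezout _ _ ?_⟩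
    · rw [← hfin.pow_dvd_iff_le_multiplicity, pow_two]
      apply (hprim.mul hprim).dvd_of_fraction_map_dvd_fraction_map (K := FractionRing R)
      rw [Polynomial.map_mul]
      exact (hass.mul_mul hass).dvd.trans hdvd
    · rw [hq.coprime_iff_not_dvd]
      exact fun h => hnr (hprim.dvd_of_fraction_map_dvd_fraction_map h)

end ufd

lemma ev_mul {d : ℕ} (a : Sg d → ℂ) (t : ℂ) (p q : Polynomial (Rr d)) :
    ev a t (p * q) = ev a t p * ev a t q := by simp [ev]

lemma part3 (n : ℕ) : ∃ (P : Polynomial (Rr (n + 1 + 1))) (Q : Rr (n + 1 + 1)), Q ≠ 0 ∧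
    ∀ a, eval a Q ≠ 0 →
    (P.map (eval a)).natDegree = 3 * (n + 1) ^ 2 ∧ (P.map (eval a)).Separable ∧
    (∀ t, (P.map (eval a)).eval t = 0 ↔ Sing a t) ∧
    (∀ v : Fin 3 → ℂ, v ≠ 0 → ¬ ∀ i, eval v (grad (frF a) i) = 0) ∧
    Mn (frF a) (frG a) ≠ 0 := by
  obtain ⟨P, Q, a1, p1, p2, p3, p4, p5, p6, p7, p8, p9⟩ := part2 n
  have hQ : Q ≠ 0 := by rintro rfl; simp at p7
  have hP : P ≠ 0 := by rintro rfl; simp at p9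
  haveI : CharZero (FractionRing (Rr (n + 1 + 1))) :=
    charZero_of_injective_algebraMap (IsFractionRing.injective (Rr (n + 1 + 1)) _)
  rcases sep_or P hP with ⟨u, v, ρ, hρ, huv⟩ | ⟨q, r, m, hm, hPq, hq, u, v, ρ, hρ, huv⟩
  · refine ⟨P, Q * ρ, mul_ne_zero hQ hρ, fun a ha => ?_⟩
    rw [map_mul] at ha
    have ha1 := left_ne_zero_of_mul ha
    have ha2 := right_ne_zero_of_mul ha
    refine ⟨?_, ?_, fun t => ⟨p4 a ha1 t, p3 a t⟩, p5 a ha1, p6 a ha1⟩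
    · apply Polynomial.natDegree_eq_of_le_of_coeff_ne_zero
      · exact Polynomial.natDegree_map_le.trans p1
      · rw [Polynomial.coeff_map]; exact p2 a ha1
    · have := congrArg (Polynomial.map (eval a)) huv
      rw [Polynomial.map_add, Polynomial.map_mul, Polynomial.map_mul, ← Polynomial.derivative_map,
        Polynomial.map_C] at this
      refine ⟨Polynomial.C (eval a ρ)⁻¹ * u.map (eval a), Polynomial.C (eval a ρ)⁻¹ * v.map (eval a), ?_⟩
      rw [mul_assoc, mul_assoc, ← mul_add, this, ← Polynomial.C_mul, inv_mul_cancel₀ ha2,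
        Polynomial.C_1]
  · exfalso
    have hI : ∀ a t, Sing a t → ev a t (q * (q ^ (m - 1) * r)) = 0 := by
      intro a t h
      rw [← mul_assoc, ← pow_succ', Nat.sub_add_cancel (by omega), ← hPq]
      exact p3 a t h
    have hI2 : ∀ a t, Sing a t → ev a t (q ^ m * r) = 0 := by
      intro a t h
      rw [← hPq]; exact p3 a t h
    have key : ∀ a t, Sing a t → ev a t q = 0 := by
      rcases irred _ _ hI2 with h | h
      · intro a t hs
        have := h a t hs
        simp only [ev, Polynomial.map_pow, Polynomial.eval_pow] at this
        exact pow_eq_zero_iff (by omega) |>.1 this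
      · exfalso
        have hq0 : q.leadingCoeff ≠ 0 := by
          rw [Ne, Polynomial.leadingCoeff_eq_zero]; rintro rfl; simp at hq
        have hne : Q * ρ * q.leadingCoeff ≠ 0 := mul_ne_zero (mul_ne_zero hQ hρ) hq0
        obtain ⟨a, ha⟩ : ∃ a, eval a (Q * ρ * q.leadingCoeff) ≠ 0 := by
          by_contra hc
          push Not at hc
          exact hne (MvPolynomial.funext fun a => by rw [hc a, map_zero])
        rw [map_mul, map_mul] at ha
        have hd := Polynomial.natDegree_map_of_leadingCoeff_ne_zero (eval a) (right_ne_zero_of_mul ha)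
        obtain ⟨t, ht⟩ := IsAlgClosed.exists_root (q.map (eval a)) (by
          intro h0
          have := Polynomial.natDegree_eq_zero_iff_degree_le_zero.2 h0.le
          omega)
        have hPt : ev a t P = 0 := by
          have hqt : ev a t q = 0 := ht
          rw [hPq, ev_mul]
          simp only [ev, Polynomial.map_pow, Polynomial.eval_pow] at hqt ⊢
          rw [hqt, zero_pow (by omega), zero_mul]
        have hs := p4 a (left_ne_zero_of_mul (left_ne_zero_of_mul ha)) t hPt
        have hr := h a t hs
        have := congrArg (ev a t) huv
        have hqt : ev a t q = 0 := ht
        have e2 : ev a t (u * q + v * r) = ev a t u * ev a t q + ev a t v * ev a t r := by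
          simp [ev]
        rw [e2, hqt, hr] at this
        simp [ev] at this
        exact right_ne_zero_of_mul (left_ne_zero_of_mul ha) this.symm
    have h0 := key a1 0 p8
    have hX : Polynomial.X ∣ q.map (eval a1) := by
      rw [Polynomial.X_dvd_iff, Polynomial.coeff_zero_eq_eval_zero]; exact h0
    apply p9
    rw [hPq, Polynomial.map_mul, Polynomial.map_pow]
    exact ((pow_dvd_pow_of_dvd hX 2).trans (pow_dvd_pow _ hm)).mul_right _

end SMC

namespace SMC
open MvPolynomial Matrix

lemma linind_of_Mn {F G : S} (hM : Mn F G ≠ 0) : LinearIndependent ℂ ![F, G] := by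
  rw [LinearIndependent.pair_iff]
  intro s t h
  have hg : s • grad F + t • grad G = 0 := by
    ext1 i
    have := congrArg (pderiv i) h
    simpa [grad] using this
  constructor
  · have := congrArg (fun v => crossProduct v (grad G)) hg
    simp only [map_add, map_smul, LinearMap.add_apply, LinearMap.smul_apply, cross_self, smul_zero,
      add_zero, map_zero, LinearMap.zero_apply] at this
    have h2 : s • Mn F G = 0 := by
      rw [← this, Mn]
      simp [LinearMap.map_smul_of_tower]
    exact (smul_eq_zero.1 h2).resolve_right hM
  · have := congrArg (fun v => crossProduct (grad F) v) hg
    have h2 : t • Mn F G = 0 := by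
      simpa [LinearMap.map_smul_of_tower, Mn] using this
    exact (smul_eq_zero.1 h2).resolve_right hM

lemma count_final {F G : S} {N : ℕ} (p : Polynomial ℂ) (hN : p.natDegree = N) (hs : p.Separable)
    (hp : ∀ t, p.eval t = 0 ↔ ∃ v : Fin 3 → ℂ, v ≠ 0 ∧
      ∀ i, t * eval v (grad F i) + eval v (grad G i) = 0)
    (hF : ∀ v : Fin 3 → ℂ, v ≠ 0 → ¬ ∀ i, eval v (grad F i) = 0) :
    (singularMembers F G).Finite ∧ (singularMembers F G).ncard = N := by
  have hne : ∀ t : ℂ, (![t, 1] : Fin 2 → ℂ) ≠ 0 := by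
    intro t h; simpa using congrFun h 1
  let φ : ℂ → Projectivization ℂ (Fin 2 → ℂ) := fun t => Projectivization.mk ℂ ![t, 1] (hne t)
  have hφ : Function.Injective φ := by
    intro t s h
    simp only [φ] at h
    rw [Projectivization.mk_eq_mk_iff'] at h
    obtain ⟨a, ha⟩ := h
    have h0 := congrFun ha 0
    have h1 := congrFun ha 1
    simp at h0 h1
    rw [h1, one_mul] at h0
    exact h0.symm
  have hev : ∀ (c : Projectivization ℂ (Fin 2 → ℂ)) (v : Fin 3 → ℂ) (i : Fin 3),
      eval v (pderiv i (pencilMember F G c)) =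
        c.rep 0 * eval v (grad F i) + c.rep 1 * eval v (grad G i) := by
    intro c v i
    simp [pencilMember, grad, smul_eval]
  have hset : singularMembers F G = Set.image φ (p.roots.toFinset : Set ℂ) := by
    have hp0 : p ≠ 0 := hs.ne_zero
    ext c
    simp only [Set.mem_image, Finset.mem_coe, Multiset.mem_toFinset, Polynomial.mem_roots hp0,
      Polynomial.IsRoot.def, hp]
    constructor
    · rintro ⟨v, hv, h⟩
      simp only [hev] at h
      have hr1 : c.rep 1 ≠ 0 := by
        intro h1
        have hr0 : c.rep 0 ≠ 0 := by
          intro h0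
          apply c.rep_nonzero
          ext i; fin_cases i <;> simp [h0, h1]
        refine hF v hv fun i => ?_
        have := h i
        rw [h1, zero_mul, add_zero] at this
        exact (mul_eq_zero.1 this).resolve_left hr0
      refine ⟨c.rep 0 / c.rep 1, ⟨v, hv, fun i => ?_⟩, ?_⟩
      · have := h i
        field_simp
        linear_combination this
      · rw [← c.mk_rep]
        simp only [φ]
        rw [Projectivization.mk_eq_mk_iff']
        refine ⟨(c.rep 1)⁻¹, ?_⟩
        ext i
        fin_cases i
        · simp [div_eq_inv_mul]
        · simp [hr1]
    · rintro ⟨t, ⟨v, hv, h⟩, rfl⟩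
      refine ⟨v, hv, fun i => ?_⟩
      rw [hev]
      obtain ⟨a, ha⟩ := Projectivization.exists_smul_eq_mk_rep ℂ ![t, 1] (hne t)
      simp only [φ]
      rw [← ha]
      simp [Units.smul_def]
      linear_combination (a : ℂ) * h i
  rw [hset]
  refine ⟨(Finset.finite_toSet _).image _, ?_⟩
  rw [Set.ncard_image_of_injective _ hφ, Set.ncard_coe_finset,
    Multiset.toFinset_card_of_nodup (Polynomial.nodup_roots hs), ← hN]
  exact (IsAlgClosed.splits p).natDegree_eq_card_roots.symm

lemma case_one {F G : S} (hF : F.IsHomogeneous 1) (hG : G.IsHomogeneous 1)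
    (hl : LinearIndependent ℂ ![F, G]) : singularMembers F G = ∅ := by
  rw [Set.eq_empty_iff_forall_notMem]
  rintro c ⟨v, hv, h⟩
  have hP : (pencilMember F G c).IsHomogeneous 1 := by
    rw [pencilMember]
    exact Submodule.add_mem (H 1) (Submodule.smul_mem _ _ hF) (Submodule.smul_mem _ _ hG)
  have hne : pencilMember F G c ≠ 0 := by
    intro h0
    have := LinearIndependent.pair_iff.1 hl _ _ h0
    apply c.rep_nonzero
    ext i; fin_cases i
    · exact this.1
    · exact this.2
  apply hne
  generalize pencilMember F G c = L at *
  have hc : ∀ i, pderiv i L = 0 := by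
    intro i
    have hh : (pderiv i L).IsHomogeneous 0 := hP.pderiv
    have := totalDegree_eq_zero_iff_eq_C.1 (Nat.le_zero.1 hh.totalDegree_le)
    have h2 := h i
    rw [this, eval_C] at h2
    rw [this, h2, C_0]
  have := hP.sum_X_mul_pderiv
  simpa [hc] using this.symm

end SMC
/-- For a general pencil of degree-`d` plane curves, the number of singular members
is `3(d−1)²`. -/
theorem singular_members_count (d : ℕ) (hd : 1 ≤ d) :
    ∃ Q : MvPolynomial ((Fin 3 →₀ ℕ) ⊕ (Fin 3 →₀ ℕ)) ℂ,
      (∃ F G : MvPolynomial (Fin 3) ℂ, F.IsHomogeneous d ∧ G.IsHomogeneous d ∧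
          LinearIndependent ℂ ![F, G] ∧ MvPolynomial.eval (coeffs2 F G) Q ≠ 0) ∧
      ∀ F G : MvPolynomial (Fin 3) ℂ, F.IsHomogeneous d → G.IsHomogeneous d →
        LinearIndependent ℂ ![F, G] → MvPolynomial.eval (coeffs2 F G) Q ≠ 0 →
          (singularMembers F G).Finite ∧
            ((singularMembers F G).ncard : ℤ) = 3 * ((d : ℤ) - 1) ^ 2 := by
  obtain ⟨e, rfl⟩ : ∃ e, d = e + 1 := ⟨d - 1, by omega⟩
  rcases e with _ | n
  · refine ⟨1, ⟨MvPolynomial.X 0, MvPolynomial.X 1, MvPolynomial.isHomogeneous_X _ _,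
      MvPolynomial.isHomogeneous_X _ _, ?_, by simp⟩, ?_⟩
    · apply SMC.linind_of_Mn
      intro h
      have := congrFun h 2
      simp [SMC.Mn, SMC.grad, crossProduct, MvPolynomial.pderiv_X] at this
    · intro F G hF hG hl _
      rw [SMC.case_one hF hG hl]
      simp
  · obtain ⟨P, Q, hQ, h⟩ := SMC.part3 n
    have hev : ∀ F G : MvPolynomial (Fin 3) ℂ, MvPolynomial.eval (coeffs2 F G)
        (MvPolynomial.rename (Sum.map Subtype.val Subtype.val) Q) =
        MvPolynomial.eval (Sum.elim (fun m : SMC.Dg (n + 1 + 1) => MvPolynomial.coeff m.1 F)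
          (fun m : SMC.Dg (n + 1 + 1) => MvPolynomial.coeff m.1 G)) Q := by
      intro F G
      rw [MvPolynomial.eval_rename]
      congr 2
      ext x
      rcases x with x | x <;> rfl
    refine ⟨MvPolynomial.rename (Sum.map Subtype.val Subtype.val) Q, ?_, ?_⟩
    · obtain ⟨a, ha⟩ : ∃ a, MvPolynomial.eval a Q ≠ 0 := by
        by_contra hc
        push Not at hc
        exact hQ (MvPolynomial.funext fun a => by rw [hc a, map_zero])
      refine ⟨SMC.frF a, SMC.frG a, SMC.frm_hom _, SMC.frm_hom _,
        SMC.linind_of_Mn (h a ha).2.2.2.2, ?_⟩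
      rw [hev]
      convert ha using 3
      ext x
      rcases x with x | x
      · exact congrFun ((SMC.coord (n + 1 + 1)).apply_symm_apply fun m => a (Sum.inl m)) x
      · exact congrFun ((SMC.coord (n + 1 + 1)).apply_symm_apply fun m => a (Sum.inr m)) x
    · intro F G hF hG hl hne
      rw [hev] at hne
      obtain ⟨c1, c2, c3, c4, c5⟩ := h _ hne
      have eF := SMC.frm_coeff hF
      have eG := SMC.frm_coeff hG
      simp only [SMC.Sing, SMC.frF, SMC.frG, Sum.elim_inl, Sum.elim_inr, eF, eG] at c3 c4
      obtain ⟨k1, k2⟩ := SMC.count_final _ c1 c2 c3 c4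
      refine ⟨k1, ?_⟩
      rw [k2]
      push_cast
      ring
end
end

section
/- Let d ≥ 1 be an integer. For a general pencil of plane curves of degree d over ℂ and a general line L ⊂ ℙ², the number of members of the pencil that are tangent to L (i.e., such that L has contact order at least 2 with the member at some point) is exactly 2d − 2. -/
noncomputable section

/-- The set of members of the pencil spanned by `F` and `G` which are tangent to the
line `L = {h·y = 0}`, i.e. such that `L` has contact order at least 2 with the member
at some point.  (Points of `L` are the classes `[v]` with `h·v = 0`, and `L` is
parametrized by two of its projectively distinct points `[v]`, `[w]`.) -/
def membersTangentToLine (F G : MvPolynomial (Fin 3) ℂ) (h : Fin 3 → ℂ) :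
    Set (Projectivization ℂ (Fin 2 → ℂ)) :=
  {c | ∃ v w : Fin 3 → ℂ, (∑ i, h i * v i) = 0 ∧ (∑ i, h i * w i) = 0 ∧
    LinearIndependent ℂ ![v, w] ∧ ContactLE (pencilMember F G c) v w 2}


namespace TL
open Polynomial

section gen
variable {R S : Type*} [CommRing R] [CommRing S]

def e1 (h : Fin 3 → R) : Fin 3 → R := ![h 2, 0, -h 0]
def e2 (h : Fin 3 → R) : Fin 3 → R := ![0, h 2, -h 1]

def lp (N : MvPolynomial (Fin 3) R) (v w : Fin 3 → R) : R[X] :=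
  MvPolynomial.eval₂ C (fun i => C (v i) + X * C (w i)) N

def dirD (e : Fin 3 → R) (M : MvPolynomial (Fin 3) R) : MvPolynomial (Fin 3) R :=
  ∑ i, MvPolynomial.C (e i) * MvPolynomial.pderiv i M

/-- restriction to the line of the derivative in direction `e`. -/
def rp (e : Fin 3 → R) (M : MvPolynomial (Fin 3) R) (h : Fin 3 → R) : R[X] :=
  lp (dirD e M) (e1 h) (e2 h)

def Dp (m : ℕ) (F G : MvPolynomial (Fin 3) R) (h : Fin 3 → R) : R[X] :=
  resultant ((rp (e1 h) F h).map C + C X * (rp (e1 h) G h).map C)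
    ((rp (e2 h) F h).map C + C X * (rp (e2 h) G h).map C) m m

def Qf (m : ℕ) (F G : MvPolynomial (Fin 3) R) (h : Fin 3 → R) : R :=
  h 2 * (Dp m F G h).coeff (2 * m) *
    resultant (Dp m F G h) (derivative (Dp m F G h)) (2 * m) (2 * m)

lemma e1_map (φ : R →+* S) (h : Fin 3 → R) : e1 (φ ∘ h) = φ ∘ e1 h := by
  ext i; fin_cases i <;> simp [e1]

lemma e2_map (φ : R →+* S) (h : Fin 3 → R) : e2 (φ ∘ h) = φ ∘ e2 h := by
  ext i; fin_cases i <;> simp [e2]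

lemma lp_map (φ : R →+* S) (N : MvPolynomial (Fin 3) R) (v w : Fin 3 → R) :
    lp (MvPolynomial.map φ N) (φ ∘ v) (φ ∘ w) = (lp N v w).map φ := by
  unfold lp
  rw [MvPolynomial.eval₂_map, ← coe_mapRingHom, MvPolynomial.hom_eval₂]
  congr 1
  · ext; simp
  · ext; simp

lemma dirD_map (φ : R →+* S) (e : Fin 3 → R) (M : MvPolynomial (Fin 3) R) :
    dirD (φ ∘ e) (MvPolynomial.map φ M) = MvPolynomial.map φ (dirD e M) := by
  simp [dirD, MvPolynomial.pderiv_map]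

lemma rp_map (φ : R →+* S) (e : Fin 3 → R) (M : MvPolynomial (Fin 3) R) (h : Fin 3 → R) :
    rp (φ ∘ e) (MvPolynomial.map φ M) (φ ∘ h) = (rp e M h).map φ := by
  rw [rp, e1_map, e2_map, dirD_map, lp_map, rp]

lemma Dp_map (φ : R →+* S) (m : ℕ) (F G : MvPolynomial (Fin 3) R) (h : Fin 3 → R) :
    Dp m (MvPolynomial.map φ F) (MvPolynomial.map φ G) (φ ∘ h) = (Dp m F G h).map φ := by
  unfold Dp
  rw [e1_map, e2_map, rp_map, rp_map, rp_map, rp_map, ← coe_mapRingHom φ]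
  rw [← resultant_map_map]
  have : (C : S →+* S[X]).comp φ = (mapRingHom φ).comp C := by ext; simp
  have h2 : ∀ A B : R[X], (A.map φ).map C + C X * (B.map φ).map C =
      (A.map C + C X * B.map C).map (mapRingHom φ) := fun A B => by
    simp [Polynomial.map_map, this]
  rw [coe_mapRingHom, h2, h2]

lemma Qf_map (φ : R →+* S) (m : ℕ) (F G : MvPolynomial (Fin 3) R) (h : Fin 3 → R) :
    Qf m (MvPolynomial.map φ F) (MvPolynomial.map φ G) (φ ∘ h) = φ (Qf m F G h) := by
  unfold Qf
  rw [Dp_map, derivative_map, resultant_map_map]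
  simp

lemma lp_add (N N' : MvPolynomial (Fin 3) R) (v w : Fin 3 → R) :
    lp (N + N') v w = lp N v w + lp N' v w := by simp [lp]

lemma dirD_comb (e : Fin 3 → R) (F G : MvPolynomial (Fin 3) R) (a b : R) :
    dirD e (a • F + b • G) = a • dirD e F + b • dirD e G := by
  simp only [dirD, map_add, Derivation.map_smul, Finset.smul_sum, ← Finset.sum_add_distrib]
  simp only [MvPolynomial.smul_eq_C_mul]
  refine Finset.sum_congr rfl fun i _ => by ring

lemma rp_comb (e : Fin 3 → R) (F G : MvPolynomial (Fin 3) R) (h : Fin 3 → R) (a b : R) :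
    rp e (a • F + b • G) h = C a * rp e F h + C b * rp e G h := by
  rw [rp, dirD_comb]
  simp [rp, lp, MvPolynomial.smul_eq_C_mul]

lemma eval_Dp (m : ℕ) (F G : MvPolynomial (Fin 3) R) (h : Fin 3 → R) (z : R) :
    (Dp m F G h).eval z = resultant (rp (e1 h) (F + z • G) h) (rp (e2 h) (F + z • G) h) m m := by
  have key : (evalRingHom z).comp C = RingHom.id R := by ext; simp
  have h1 := fun e => rp_comb e F G h 1 z
  simp only [one_smul, map_one, one_mul] at h1
  rw [h1, h1, ← coe_evalRingHom, Dp]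
  rw [← resultant_map_map]
  have h2 : ∀ A B : R[X], (A.map C + C X * B.map C).map (evalRingHom z) = A + C z * B :=
    fun A B => by simp [Polynomial.map_map, key]
  rw [h2, h2]

lemma sylv_eq (A B A' B' : R[X]) (m : ℕ) :
    sylvester (A.map C + C X * A'.map C) (B.map C + C X * B'.map C) m m =
    (X : R[X]) • (sylvester A' B' m m).map C + (sylvester A B m m).map C := by
  ext1 i j
  induction j using Fin.addCases <;>
    simp only [sylvester, Matrix.add_apply, Matrix.smul_apply, Matrix.map_apply, Matrix.of_apply,
      Fin.addCases_left, Fin.addCases_right] <;> split_ifs <;> simp [add_comm]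

lemma natDegree_Dp (m : ℕ) (F G : MvPolynomial (Fin 3) R) (h : Fin 3 → R) :
    (Dp m F G h).natDegree ≤ 2 * m := by
  have := natDegree_det_X_add_C_le (sylvester (rp (e1 h) G h) (rp (e2 h) G h) m m)
    (sylvester (rp (e1 h) F h) (rp (e2 h) F h) m m)
  rw [Fintype.card_fin] at this
  rw [Dp, resultant, sylv_eq, two_mul]
  exact this

lemma coeff_Dp (m : ℕ) (F G : MvPolynomial (Fin 3) R) (h : Fin 3 → R) :
    (Dp m F G h).coeff (2 * m) = resultant (rp (e1 h) G h) (rp (e2 h) G h) m m := by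
  have := coeff_det_X_add_C_card (sylvester (rp (e1 h) G h) (rp (e2 h) G h) m m)
    (sylvester (rp (e1 h) F h) (rp (e2 h) F h) m m)
  rw [Fintype.card_fin] at this
  rw [Dp, resultant, sylv_eq, two_mul]
  exact this

lemma eval_lp (N : MvPolynomial (Fin 3) R) (v w : Fin 3 → R) (t : R) :
    (lp N v w).eval t = MvPolynomial.eval (v + t • w) N := by
  rw [← coe_evalRingHom, lp, MvPolynomial.hom_eval₂, MvPolynomial.eval]
  congr 1
  · ext; simp
  · ext i; simp; ring

lemma lp_homog {N : MvPolynomial (Fin 3) R} {m : ℕ} (hN : N.IsHomogeneous m) (v w : Fin 3 → R) :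
    (lp N v w).natDegree ≤ m ∧ (lp N v w).coeff m = MvPolynomial.eval w N := by
  have hlin : ∀ i, (C (v i) + X * C (w i)).natDegree ≤ 1 := fun i => by compute_degree
  have hpow : ∀ i k, ((C (v i) + X * C (w i)) ^ k).natDegree ≤ k := fun i k => by
    simpa using natDegree_pow_le_of_le k (hlin i)
  have hc : ∀ i k, ((C (v i) + X * C (w i)) ^ k).coeff k = w i ^ k := fun i k => by
    have := coeff_pow_of_natDegree_le (m := k) (hlin i)
    simpa [coeff_C] using this
  rw [lp, MvPolynomial.eval₂_eq', MvPolynomial.eval_eq']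
  have hk : ∀ k ∈ N.support, k 0 + k 1 + k 2 = m := fun k hk => by
    have := hN (MvPolynomial.mem_support_iff.1 hk)
    rw [← this, Finsupp.weight_apply, Finsupp.sum_fintype _ _ (by simp)]
    simp [Fin.sum_univ_three]
  have h2 : ∀ k : Fin 3 →₀ ℕ, ((C (v 0) + X * C (w 0)) ^ k 0 * (C (v 1) + X * C (w 1)) ^ k 1).natDegree
      ≤ k 0 + k 1 := fun k => natDegree_mul_le_of_le (hpow _ _) (hpow _ _)
  constructor
  · refine natDegree_sum_le_of_forall_le _ _ fun k hks => ?_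
    rw [Fin.prod_univ_three, ← hk k hks]
    refine (natDegree_C_mul_le _ _).trans ?_
    exact natDegree_mul_le_of_le (h2 k) (hpow _ _)
  · rw [finsetSum_coeff]
    refine Finset.sum_congr rfl fun k hks => ?_
    rw [coeff_C_mul, Fin.prod_univ_three, Fin.prod_univ_three, ← hk k hks,
      coeff_mul_add_eq_of_natDegree_le (h2 k) (hpow _ _), coeff_mul_add_eq_of_natDegree_le (hpow _ _) (hpow _ _),
      hc, hc, hc]

lemma dirD_homog {M : MvPolynomial (Fin 3) R} {d : ℕ} (hM : M.IsHomogeneous d) (e : Fin 3 → R) :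
    (dirD e M).IsHomogeneous (d - 1) := by
  refine MvPolynomial.IsHomogeneous.sum _ _ _ fun i _ => ?_
  exact MvPolynomial.IsHomogeneous.C_mul hM.pderiv _

lemma deriv_lp (N : MvPolynomial (Fin 3) R) (v w : Fin 3 → R) :
    derivative (lp N v w) = lp (dirD w N) v w := by
  induction N using MvPolynomial.induction_on with
  | C a => simp [lp, dirD]
  | add p q hp hq =>
    have : dirD w (p + q) = dirD w p + dirD w q := by
      simpa using dirD_comb w p q 1 1
    rw [lp_add, derivative_add, hp, hq, this, lp_add]
  | mul_X p i hp =>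
    have h1 : dirD w (p * MvPolynomial.X i) =
        dirD w p * MvPolynomial.X i + MvPolynomial.C (w i) * p := by
      simp only [dirD, Derivation.leibniz, smul_eq_mul, MvPolynomial.pderiv_X, mul_add,
        Finset.sum_add_distrib, Finset.sum_mul]
      rw [add_comm]
      congr 1
      · refine Finset.sum_congr rfl fun i _ => by ring
      · rw [Finset.sum_eq_single i]
        · simp
        · intro b _ hb; simp [hb.symm]
        · simp
    have h2 : ∀ q : MvPolynomial (Fin 3) R, lp (q * MvPolynomial.X i) v w =
        lp q v w * (C (v i) + X * C (w i)) := fun q => by simp [lp]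
    have h3 : lp (MvPolynomial.C (w i) * p) v w = C (w i) * lp p v w := by simp [lp]
    rw [h1, lp_add, h2, h2, h3, derivative_mul, hp]
    simp
    ring

end gen

lemma res_zero_iff (A B : ℂ[X]) (m : ℕ) (hm : 1 ≤ m) (hA : A.natDegree ≤ m) (hB : B.natDegree ≤ m) :
    resultant A B m m = 0 ↔
      (∃ t, A.eval t = 0 ∧ B.eval t = 0) ∨ (A.coeff m = 0 ∧ B.coeff m = 0) := by
  have key : ∀ A B : ℂ[X], A.natDegree ≤ m → B.natDegree ≤ m → A.coeff m ≠ 0 →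
      (resultant A B m m = 0 ↔ ∃ t, A.eval t = 0 ∧ B.eval t = 0) := by
    intro A B hA hB hc
    have hdeg : A.natDegree = m := le_antisymm hA (le_natDegree_of_ne_zero hc)
    have hA0 : A ≠ 0 := by rintro rfl; simp at hc
    have h := resultant_eq_prod_eval A B m hB (IsAlgClosed.splits A)
    rw [hdeg] at h
    rw [h, mul_eq_zero, or_iff_right (pow_ne_zero _ (leadingCoeff_ne_zero.2 hA0)),
      Multiset.prod_eq_zero_iff]
    simp [hA0]
  by_cases hcA : A.coeff m = 0
  · by_cases hcB : B.coeff m = 0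
    · simp only [hcA, hcB, and_self, or_true, iff_true]
      have lt : ∀ A : ℂ[X], A.natDegree ≤ m → A.coeff m = 0 → A.natDegree < m := by
        intro A hA hc
        refine lt_of_le_of_ne hA fun h => ?_
        have h0 : A = 0 := by rw [← leadingCoeff_eq_zero, leadingCoeff, h, hc]
        rw [h0] at h; simp at h; omega
      exact resultant_eq_zero_of_lt_lt _ _ _ _ (lt A hA hcA) (lt B hB hcB)
    · rw [resultant_comm, mul_eq_zero, or_iff_right (by simp), key B A hB hA hcB]
      simp [hcB, and_comm]
  · rw [key A B hA hB hcA]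
    simp [hcA]

/-- singular point condition of the restriction -/
def Tan (M : MvPolynomial (Fin 3) ℂ) (h : Fin 3 → ℂ) : Prop :=
  ∃ α β : ℂ, (α ≠ 0 ∨ β ≠ 0) ∧ MvPolynomial.eval (α • e1 h + β • e2 h) (dirD (e1 h) M) = 0 ∧
    MvPolynomial.eval (α • e1 h + β • e2 h) (dirD (e2 h) M) = 0

lemma eval_homog {N : MvPolynomial (Fin 3) ℂ} {m : ℕ} (hN : N.IsHomogeneous m) (a : ℂ)
    (p : Fin 3 → ℂ) : MvPolynomial.eval (a • p) N = a ^ m * MvPolynomial.eval p N := by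
  rw [MvPolynomial.eval_eq', MvPolynomial.eval_eq', Finset.mul_sum]
  refine Finset.sum_congr rfl fun k hks => ?_
  have h1 := hN (MvPolynomial.mem_support_iff.1 hks)
  rw [Finsupp.weight_apply, Finsupp.sum_fintype _ _ (by simp)] at h1
  simp only [Fin.sum_univ_three, Pi.one_apply, smul_eq_mul, mul_one] at h1
  rw [← h1]
  simp only [Fin.prod_univ_three, Pi.smul_apply, smul_eq_mul]
  ring

lemma tan_iff_res {M : MvPolynomial (Fin 3) ℂ} {m : ℕ} (hm : 1 ≤ m) (hM : M.IsHomogeneous (m + 1))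
    (h : Fin 3 → ℂ) : Tan M h ↔ resultant (rp (e1 h) M h) (rp (e2 h) M h) m m = 0 := by
  have hh : ∀ e, (dirD e M).IsHomogeneous m := fun e => dirD_homog hM e
  have hl := fun e => lp_homog (hh e) (e1 h) (e2 h)
  unfold rp
  rw [res_zero_iff _ _ m hm (hl _).1 (hl _).1]
  rw [(hl _).2, (hl _).2]
  simp only [eval_lp]
  constructor
  · rintro ⟨α, β, hne, h1, h2⟩
    by_cases hα : α = 0
    · subst hα
      have hβ : β ≠ 0 := by simpa using hne
      right
      rw [zero_smul, zero_add, eval_homog (hh _)] at h1 h2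
      simp only [mul_eq_zero, pow_eq_zero_iff (show m ≠ 0 by omega), hβ, false_or] at h1 h2
      exact ⟨h1, h2⟩
    · left
      refine ⟨β / α, ?_⟩
      have : α • e1 h + β • e2 h = α • (e1 h + (β / α) • e2 h) := by
        rw [smul_add, smul_smul, mul_div_cancel₀ _ hα]
      rw [this, eval_homog (hh _)] at h1 h2
      simp only [mul_eq_zero, pow_eq_zero_iff (show m ≠ 0 by omega), hα, false_or] at h1 h2
      exact ⟨h1, h2⟩
  · rintro (⟨t, h1, h2⟩ | ⟨h1, h2⟩)
    · exact ⟨1, t, by simp, by simpa using h1, by simpa using h2⟩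
    · exact ⟨0, 1, by simp, by simpa using h1, by simpa using h2⟩

lemma eval_dirD_lin (M : MvPolynomial (Fin 3) ℂ) (p u w : Fin 3 → ℂ) (a b : ℂ) :
    MvPolynomial.eval p (dirD (a • u + b • w) M) =
      a * MvPolynomial.eval p (dirD u M) + b * MvPolynomial.eval p (dirD w M) := by
  simp [dirD, Fin.sum_univ_three]; ring

lemma euler {M : MvPolynomial (Fin 3) ℂ} {d : ℕ} (hM : M.IsHomogeneous d) (p : Fin 3 → ℂ) :
    MvPolynomial.eval p (dirD p M) = d * MvPolynomial.eval p M := by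
  have := congrArg (MvPolynomial.eval p) hM.sum_X_mul_pderiv
  simpa [dirD] using this

lemma contact_iff (M : MvPolynomial (Fin 3) ℂ) (v w : Fin 3 → ℂ) : ContactLE M v w 2 ↔
    MvPolynomial.eval v M = 0 ∧ MvPolynomial.eval v (dirD w M) = 0 := by
  have h0 : linePoly M v w = lp M v w := by
    rw [linePoly, MvPolynomial.aeval_def, lp]; rfl
  rw [ContactLE, h0, X_pow_dvd_iff]
  have h1 : (lp M v w).coeff 0 = MvPolynomial.eval v M := by
    rw [coeff_zero_eq_eval_zero, eval_lp]; simp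
  have h2 : (lp M v w).coeff 1 = MvPolynomial.eval v (dirD w M) := by
    have : (derivative (lp M v w)).coeff 0 = MvPolynomial.eval v (dirD w M) := by
      rw [coeff_zero_eq_eval_zero, deriv_lp, eval_lp]; simp
    rw [← this, coeff_derivative]; simp
  rw [← h1, ← h2]
  constructor
  · intro h; exact ⟨h 0 (by norm_num), h 1 (by norm_num)⟩
  · rintro ⟨ha, hb⟩ k hk
    interval_cases k <;> assumption

lemma on_line {h : Fin 3 → ℂ} (hh : h 2 ≠ 0) {v : Fin 3 → ℂ} (hv : ∑ i, h i * v i = 0) :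
    v = (v 0 / h 2) • e1 h + (v 1 / h 2) • e2 h := by
  rw [Fin.sum_univ_three] at hv
  ext i; fin_cases i
  · simp [e1, e2]; field_simp
  · simp [e1, e2]; field_simp
  · simp [e1, e2]; field_simp; linear_combination hv

lemma e_line (h : Fin 3 → ℂ) (α β : ℂ) : ∑ i, h i * (α • e1 h + β • e2 h) i = 0 := by
  simp [Fin.sum_univ_three, e1, e2]; ring

lemma contact_iff_tan {M : MvPolynomial (Fin 3) ℂ} {d : ℕ} (hd : 1 ≤ d) (hM : M.IsHomogeneous d)
    {h : Fin 3 → ℂ} (hh : h 2 ≠ 0) :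
    (∃ v w : Fin 3 → ℂ, (∑ i, h i * v i) = 0 ∧ (∑ i, h i * w i) = 0 ∧
    LinearIndependent ℂ ![v, w] ∧ ContactLE M v w 2) ↔ Tan M h := by
  simp only [contact_iff, LinearIndependent.pair_iff]
  constructor
  · rintro ⟨v, w, hv, hw, hli, h1, h2⟩
    have hE := euler hM v
    rw [h1, mul_zero] at hE
    have ev := on_line hh hv
    have ew := on_line hh hw
    set α := v 0 / h 2
    set β := v 1 / h 2
    set γ := w 0 / h 2
    set δ := w 1 / h 2
    have hvne : α ≠ 0 ∨ β ≠ 0 := by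
      by_contra hcon
      push Not at hcon
      rw [hcon.1, hcon.2] at ev
      have := hli 1 0 (by rw [ev]; simp)
      simp at this
    have hdet : α * δ - β * γ ≠ 0 := by
      intro h0
      have h3 := hli δ (-β) (by
        rw [ev, ew]
        ext i
        simp only [Pi.add_apply, Pi.smul_apply, smul_eq_mul, Pi.zero_apply]
        linear_combination (e1 h i) * h0)
      have h4 := hli γ (-α) (by
        rw [ev, ew]
        ext i
        simp only [Pi.add_apply, Pi.smul_apply, smul_eq_mul, Pi.zero_apply]
        linear_combination -(e2 h i) * h0)
      have : β = 0 := neg_eq_zero.1 h3.2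
      have : α = 0 := neg_eq_zero.1 h4.2
      tauto
    refine ⟨α, β, hvne, ?_⟩
    rw [← ev]
    have hE' : α * MvPolynomial.eval v (dirD (e1 h) M) + β * MvPolynomial.eval v (dirD (e2 h) M) = 0 := by
      rw [← eval_dirD_lin, ← ev]; exact hE
    have h2' : γ * MvPolynomial.eval v (dirD (e1 h) M) + δ * MvPolynomial.eval v (dirD (e2 h) M) = 0 := by
      rw [← eval_dirD_lin, ← ew]; exact h2
    constructor
    · apply (mul_eq_zero.1 (show (α * δ - β * γ) * _ = 0 from _)).resolve_left hdet
      linear_combination δ * hE' - β * h2'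
    · apply (mul_eq_zero.1 (show (α * δ - β * γ) * _ = 0 from _)).resolve_left hdet
      linear_combination α * h2' - γ * hE'
  · rintro ⟨α, β, hne, h1, h2⟩
    obtain ⟨γ, δ, hdet⟩ : ∃ γ δ : ℂ, α * δ - β * γ ≠ 0 := by
      rcases hne with h0 | h0
      · exact ⟨0, 1, by simpa using h0⟩
      · exact ⟨1, 0, by simpa using h0⟩
    refine ⟨α • e1 h + β • e2 h, γ • e1 h + δ • e2 h, e_line _ _ _, e_line _ _ _, ?_, ?_, ?_⟩
    · intro s t hst
      have q0 := congrFun hst 0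
      have q1 := congrFun hst 1
      simp [e1, e2] at q0 q1
      have q0' : s * α + t * γ = 0 := by
        apply (mul_eq_zero.1 (show h 2 * _ = 0 from _)).resolve_left hh
        linear_combination q0
      have q1' : s * β + t * δ = 0 := by
        apply (mul_eq_zero.1 (show h 2 * _ = 0 from _)).resolve_left hh
        linear_combination q1
      constructor
      · apply (mul_eq_zero.1 (show (α * δ - β * γ) * _ = 0 from _)).resolve_left hdet
        linear_combination δ * q0' - γ * q1'
      · apply (mul_eq_zero.1 (show (α * δ - β * γ) * _ = 0 from _)).resolve_left hdet
        linear_combination α * q1' - β * q0'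
    · have hE := euler hM (α • e1 h + β • e2 h)
      rw [eval_dirD_lin, h1, h2] at hE
      have : (d : ℂ) ≠ 0 := by exact_mod_cast (by omega)
      simpa [this] using hE.symm
    · rw [eval_dirD_lin, h1, h2]; simp

lemma tan_smul (M : MvPolynomial (Fin 3) ℂ) (h : Fin 3 → ℂ) (a : ℂ) (ha : a ≠ 0) :
    Tan (a • M) h ↔ Tan M h := by
  have h1 : ∀ e, dirD e (a • M) = a • dirD e M := fun e => by
    simpa using dirD_comb e M 0 a 0
  simp only [Tan, h1, MvPolynomial.smul_eval, mul_eq_zero, ha, false_or]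

lemma homog_comb {F G : MvPolynomial (Fin 3) ℂ} {d : ℕ} (hF : F.IsHomogeneous d)
    (hG : G.IsHomogeneous d) (a b : ℂ) : (a • F + b • G).IsHomogeneous d := by
  simp only [MvPolynomial.smul_eq_C_mul]
  exact (hF.C_mul a).add (hG.C_mul b)

lemma mk_mem {F G : MvPolynomial (Fin 3) ℂ} {d : ℕ} (hd : 1 ≤ d) (hF : F.IsHomogeneous d)
    (hG : G.IsHomogeneous d) {h : Fin 3 → ℂ} (hh : h 2 ≠ 0) (u : Fin 2 → ℂ) (hu : u ≠ 0) :
    Projectivization.mk ℂ u hu ∈ membersTangentToLine F G h ↔ Tan (u 0 • F + u 1 • G) h := by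
  rw [membersTangentToLine, Set.mem_ofPred_eq, pencilMember,
    contact_iff_tan hd (homog_comb hF hG _ _) hh]
  obtain ⟨a, ha⟩ := Projectivization.exists_smul_eq_mk_rep ℂ u hu
  rw [← ha, ← tan_smul (u 0 • F + u 1 • G) h (a : ℂ) a.ne_zero]
  simp [Units.smul_def, smul_smul]

lemma count_of_Qf {F G : MvPolynomial (Fin 3) ℂ} {m : ℕ} (hm : 1 ≤ m)
    (hF : F.IsHomogeneous (m + 1)) (hG : G.IsHomogeneous (m + 1)) {h : Fin 3 → ℂ}
    (hQ : Qf m F G h ≠ 0) :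
    (membersTangentToLine F G h).Finite ∧ (membersTangentToLine F G h).ncard = 2 * m := by
  unfold Qf at hQ
  have hh : h 2 ≠ 0 := fun h0 => hQ (by simp [h0])
  have hc : (Dp m F G h).coeff (2 * m) ≠ 0 := fun h0 => hQ (by simp [h0])
  have hr : resultant (Dp m F G h) (derivative (Dp m F G h)) (2 * m) (2 * m) ≠ 0 :=
    fun h0 => hQ (by simp [h0])
  have hinf : ¬ Tan G h := by rw [tan_iff_res hm hG, ← coeff_Dp m F]; exact hc
  have hz : ∀ z, (Dp m F G h).eval z = 0 ↔ Tan (F + z • G) h := fun z => by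
    rw [eval_Dp, tan_iff_res hm]; simpa using homog_comb hF hG 1 z
  have hdeg := natDegree_Dp m F G h
  set D := Dp m F G h
  have hdeg' : D.natDegree = 2 * m := le_antisymm hdeg (le_natDegree_of_ne_zero hc)
  have hD0 : D ≠ 0 := by intro h0; simp [h0] at hc
  have hnod : D.roots.Nodup := by
    rw [Multiset.nodup_iff_count_le_one]
    intro a
    rw [count_roots]
    by_contra hcon
    push Not at hcon
    rw [one_lt_rootMultiplicity_iff_isRoot hD0] at hcon
    apply hr
    have := resultant_eq_prod_eval D (derivative D) (2 * m)
      ((natDegree_derivative_le _).trans (by omega)) (IsAlgClosed.splits D)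
    rw [hdeg'] at this
    rw [this, mul_eq_zero]
    right
    rw [Multiset.prod_eq_zero_iff, Multiset.mem_map]
    exact ⟨a, (mem_roots hD0).2 hcon.1, hcon.2⟩
  have hcard : D.roots.toFinset.card = 2 * m := by
    rw [Multiset.toFinset_card_of_nodup hnod, ← hdeg']
    exact (IsAlgClosed.splits D).natDegree_eq_card_roots.symm
  have hne : ∀ z : ℂ, (![1, z] : Fin 2 → ℂ) ≠ 0 := fun z h0 => by
    have := congrFun h0 0; simp at this
  let f : ℂ → Projectivization ℂ (Fin 2 → ℂ) := fun z => Projectivization.mk ℂ ![1, z] (hne z)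
  have hf : Function.Injective f := by
    intro z z' hzz
    obtain ⟨a, ha⟩ := (Projectivization.mk_eq_mk_iff' ℂ _ _ _ _).1 hzz
    have a0 := congrFun ha 0
    have a1 := congrFun ha 1
    simp at a0 a1
    rw [a0] at a1; simpa using a1.symm
  have hset : membersTangentToLine F G h = f '' (D.roots.toFinset : Set ℂ) := by
    ext c
    induction c using Projectivization.ind with
    | h u hu =>
    rw [mk_mem (by omega) hF hG hh]
    constructor
    · intro ht
      by_cases hu0 : u 0 = 0
      · exfalso
        have hu1 : u 1 ≠ 0 := by
          intro h1; apply hu; ext i; fin_cases i <;> simp [hu0, h1]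
        rw [hu0, zero_smul, zero_add, tan_smul _ _ _ hu1] at ht
        exact hinf ht
      · have e : u 0 • F + u 1 • G = u 0 • (F + (u 1 / u 0) • G) := by
          rw [smul_add, smul_smul, mul_div_cancel₀ _ hu0]
        rw [e, tan_smul _ _ _ hu0, ← hz] at ht
        refine ⟨u 1 / u 0, by simpa [hD0] using ht, ?_⟩
        rw [Projectivization.mk_eq_mk_iff']
        refine ⟨(u 0)⁻¹, ?_⟩
        ext i; fin_cases i
        · simp [hu0]
        · simp; field_simp
    · rintro ⟨z, hzr, hfz⟩
      rw [← mk_mem (by omega) hF hG hh u hu, ← hfz, mk_mem (by omega) hF hG hh]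
      simpa [← hz, hD0] using hzr
  rw [hset]
  refine ⟨(Finset.finite_toSet _).image _, ?_⟩
  rw [Set.ncard_image_of_injective _ hf, Set.ncard_coe_finset, hcard]

lemma Qf_ne_zero {F G : MvPolynomial (Fin 3) ℂ} {m : ℕ} {h : Fin 3 → ℂ} (hh : h 2 ≠ 0)
    (h0 : Dp m F G h ≠ 0) (S : Finset ℂ) (hS : S.card = 2 * m)
    (hroot : ∀ z ∈ S, (Dp m F G h).eval z = 0) : Qf m F G h ≠ 0 := by
  have hdeg := natDegree_Dp m F G h
  unfold Qf
  set D := Dp m F G h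
  have hsub : S.val ≤ D.roots := by
    rw [Finset.val_le_iff_val_subset]
    intro z hz
    exact (mem_roots h0).2 (hroot z hz)
  have hcard : D.roots.card = D.natDegree := (IsAlgClosed.splits D).natDegree_eq_card_roots.symm
  have hle := Multiset.card_le_card hsub
  have hS' : S.val.card = 2 * m := hS
  have hdeg' : D.natDegree = 2 * m := by omega
  have heq : S.val = D.roots := Multiset.eq_of_le_of_card_le hsub (by omega)
  have hnod : D.roots.Nodup := heq ▸ S.nodup
  refine mul_ne_zero (mul_ne_zero hh ?_) ?_
  · rw [← hdeg']; exact leadingCoeff_ne_zero.2 h0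
  · have := resultant_eq_prod_eval D (derivative D) (2 * m)
      ((natDegree_derivative_le _).trans (by omega)) (IsAlgClosed.splits D)
    rw [hdeg'] at this
    rw [this]
    refine mul_ne_zero (pow_ne_zero _ (leadingCoeff_ne_zero.2 h0)) ?_
    rw [Ne, Multiset.prod_eq_zero_iff, Multiset.mem_map]
    rintro ⟨a, ha, ha'⟩
    have h1 : 1 < D.rootMultiplicity a := by
      rw [one_lt_rootMultiplicity_iff_isRoot h0]
      exact ⟨(mem_roots h0).1 ha, ha'⟩
    have := Multiset.nodup_iff_count_le_one.1 hnod a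
    rw [count_roots] at this
    omega

def exF (m : ℕ) : MvPolynomial (Fin 3) ℂ :=
  MvPolynomial.C 2 * MvPolynomial.X 1 ^ (m + 1) - MvPolynomial.X 0 ^ m * MvPolynomial.X 1

def exG (m : ℕ) : MvPolynomial (Fin 3) ℂ :=
  MvPolynomial.C 2 * MvPolynomial.X 0 ^ (m + 1) - MvPolynomial.X 1 ^ m * MvPolynomial.X 0

def exh : Fin 3 → ℂ := ![0, 0, 1]

lemma exF_homog (m : ℕ) : (exF m).IsHomogeneous (m + 1) := by
  have hX := fun i => MvPolynomial.isHomogeneous_X ℂ (i : Fin 3)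
  have h1 := ((hX 1).pow (m + 1)).C_mul 2
  have h2 := ((hX 0).pow m).mul (hX 1)
  simp only [one_mul] at h1 h2
  exact h1.sub h2

lemma exG_homog (m : ℕ) : (exG m).IsHomogeneous (m + 1) := by
  have hX := fun i => MvPolynomial.isHomogeneous_X ℂ (i : Fin 3)
  have h1 := ((hX 0).pow (m + 1)).C_mul 2
  have h2 := ((hX 1).pow m).mul (hX 0)
  simp only [one_mul] at h1 h2
  exact h1.sub h2

lemma ex_li (m : ℕ) : LinearIndependent ℂ ![exF m, exG m] := by
  rw [LinearIndependent.pair_iff]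
  intro s t hst
  have h1 := congrArg (MvPolynomial.eval ![1, 0, 0]) hst
  have h2 := congrArg (MvPolynomial.eval ![0, 1, 0]) hst
  rcases Nat.eq_zero_or_pos m with rfl | hm
  · simp [exF, exG] at h1 h2
    norm_num at h1 h2
    exact ⟨h2, h1⟩
  · simp [exF, exG, hm.ne'] at h1 h2
    exact ⟨h2, h1⟩

lemma ex_tan (m : ℕ) (z : ℂ) : Tan (exF m + z • exG m) exh ↔ ∃ α β : ℂ, (α ≠ 0 ∨ β ≠ 0) ∧
    -(m * α ^ (m - 1) * β) + z * (2 * (m + 1) * α ^ m - β ^ m) = 0 ∧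
    2 * (m + 1) * β ^ m - α ^ m - z * (m * β ^ (m - 1) * α) = 0 := by
  unfold Tan
  refine exists_congr fun α => exists_congr fun β => and_congr_right fun _ => ?_
  have hp : α • e1 exh + β • e2 exh = ![α, β, 0] := by
    ext i; fin_cases i <;> simp [e1, e2, exh]
  have h1 : MvPolynomial.eval ![α, β, 0] (dirD (e1 exh) (exF m + z • exG m)) =
      -(m * α ^ (m - 1) * β) + z * (2 * (m + 1) * α ^ m - β ^ m) := by
    simp [dirD, Fin.sum_univ_three, e1, exh, exF, exG, Derivation.leibniz_pow,
      MvPolynomial.pderiv_X, Pi.single_apply]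
    ring
  have h2 : MvPolynomial.eval ![α, β, 0] (dirD (e2 exh) (exF m + z • exG m)) =
      2 * (m + 1) * β ^ m - α ^ m - z * (m * β ^ (m - 1) * α) := by
    simp [dirD, Fin.sum_univ_three, e2, exh, exF, exG, Derivation.leibniz_pow,
      MvPolynomial.pderiv_X, Pi.single_apply]
    ring
  rw [hp, h1, h2]

lemma ex_eval (m : ℕ) (hm : 1 ≤ m) (z : ℂ) :
    (Dp m (exF m) (exG m) exh).eval z = 0 ↔ Tan (exF m + z • exG m) exh := by
  rw [eval_Dp, tan_iff_res hm]
  simpa using homog_comb (exF_homog m) (exG_homog m) 1 z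

lemma ex_D_ne (m : ℕ) (hm : 1 ≤ m) : Dp m (exF m) (exG m) exh ≠ 0 := by
  intro h0
  have := (ex_eval m hm 0).1 (by simp [h0])
  rw [ex_tan] at this
  obtain ⟨α, β, hne, h1, h2⟩ := this
  have hm0 : (m : ℂ) ≠ 0 := Nat.cast_ne_zero.2 (by omega)
  have hm1 : (m : ℂ) + 1 ≠ 0 := Nat.cast_add_one_ne_zero m
  have hm' : m ≠ 0 := by omega
  simp [hm0] at h1 h2
  rcases h1 with ⟨rfl, h1⟩ | rfl
  · simp [hm', hm1] at h2
    simp [h2] at hne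
  · simp [hm'] at h2
    simp [h2] at hne

lemma ex_root (m : ℕ) (hm : 1 ≤ m) (t z u : ℂ) (ht : t ^ m = u) (ht0 : t ≠ 0) (hu : 2 - u ≠ 0)
    (hquad : 2 * u ^ 2 - (5 + 3 * m) * u + 2 = 0) (hz : z * (2 - u) = -t * (2 * u - 1)) :
    (Dp m (exF m) (exG m) exh).eval z = 0 := by
  rw [ex_eval m hm, ex_tan]
  refine ⟨1, t, by simp, ?_, ?_⟩
  · rw [ht]
    apply (mul_eq_zero.1 (show (2 - u) * _ = 0 from _)).resolve_left hu
    simp only [one_pow]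
    linear_combination t * hquad + (2 * (m + 1) - u) * hz
  · obtain ⟨k, rfl⟩ : ∃ k, m = k + 1 := ⟨m - 1, by omega⟩
    apply (mul_eq_zero.1 (show ((2 - u) * t) * _ = 0 from _)).resolve_left (mul_ne_zero hu ht0)
    rw [ht]
    simp only [one_pow, Nat.add_sub_cancel]
    rw [pow_succ] at ht
    linear_combination (-t) * hquad - (k + 1 : ℕ) * u * hz - (2 - u) * z * (k + 1 : ℕ) * ht

lemma ex_param (m : ℕ) (hm : 1 ≤ m) : ∃ t : ℝ, 1 < t ∧ t ^ m ≠ 2 ∧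
    2 * (t ^ m) ^ 2 - (5 + 3 * m) * t ^ m + 2 = 0 := by
  have hm1 : (1 : ℝ) ≤ m := by exact_mod_cast hm
  set s := Real.sqrt ((5 + 3 * m) ^ 2 - 16)
  have hs : s ^ 2 = (5 + 3 * m) ^ 2 - 16 := Real.sq_sqrt (by nlinarith)
  have hs0 : 0 ≤ s := Real.sqrt_nonneg _
  set u : ℝ := (5 + 3 * m + s) / 4 with hu
  have hq : 2 * u ^ 2 - (5 + 3 * m) * u + 2 = 0 := by rw [hu]; linear_combination hs / 8
  have hu1 : 1 < u := by rw [hu]; linarith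
  have ht : (u ^ ((m : ℝ)⁻¹)) ^ m = u := Real.rpow_inv_natCast_pow (by linarith) (by omega)
  refine ⟨u ^ ((m : ℝ)⁻¹), Real.one_lt_rpow hu1 (by positivity), ?_, ?_⟩
  · rw [ht]; intro h; rw [h] at hq; linarith
  · rw [ht]; exact hq

lemma ex_Qf (m : ℕ) (hm : 1 ≤ m) : Qf m (exF m) (exG m) exh ≠ 0 := by
  obtain ⟨t, ht1, ht2, hq⟩ := ex_param m hm
  have hu1 : 1 < t ^ m := one_lt_pow₀ ht1 (by omega)
  set u := t ^ m with hu
  have hm0 : m ≠ 0 := by omega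
  have hu2 : (2 - u : ℝ) ≠ 0 := fun h => ht2 (by linarith)
  have hu3 : (2 * u - 1 : ℝ) ≠ 0 := by linarith
  set r : ℝ := -(t * (2 * u - 1) / (2 - u)) with hr
  have hr1 : 1 < |r| := by
    rw [hr, abs_neg, abs_div, abs_mul, abs_of_pos (by linarith : 0 < t),
      abs_of_pos (by linarith : 0 < 2 * u - 1), lt_div_iff₀ (abs_pos.2 hu2), one_mul]
    have : |2 - u| < 2 * u - 1 := by rw [abs_lt]; constructor <;> linarith
    nlinarith
  have hr0 : r ≠ 0 := by intro h; rw [h] at hr1; simp at hr1; linarith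
  have hrC : (r : ℂ) ≠ 0 := by exact_mod_cast hr0
  have htC : (t : ℂ) ≠ 0 := by exact_mod_cast (by linarith : t ≠ 0)
  have huC : (t : ℂ) ^ m = u := by rw [hu]; push_cast; rfl
  have hu0C : (u : ℂ) ≠ 0 := by exact_mod_cast (by linarith : u ≠ 0)
  have hu2C : (2 - u : ℂ) ≠ 0 := by exact_mod_cast hu2
  have hu3C : (2 * u - 1 : ℂ) ≠ 0 := by exact_mod_cast hu3
  have hqC : 2 * (u : ℂ) ^ 2 - (5 + 3 * m) * u + 2 = 0 := by exact_mod_cast hq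
  have hreq : (r : ℂ) = -(t * (2 * u - 1) / (2 - u)) := by rw [hr]; push_cast; rfl
  let N := nthRootsFinset m (1 : ℂ)
  have hN : N.card = m := (Complex.isPrimitiveRoot_exp m hm0).card_nthRootsFinset
  have hNm : ∀ ζ ∈ N, ζ ^ m = 1 := fun ζ hζ => (mem_nthRootsFinset (by omega) _).1 hζ
  have hNn : ∀ ζ ∈ N, ‖ζ‖ = 1 := fun ζ hζ => Complex.norm_eq_one_of_pow_eq_one (hNm ζ hζ) hm0
  refine Qf_ne_zero (by simp [exh]) (ex_D_ne m hm)
    (N.image (fun ζ => (r : ℂ) * ζ) ∪ N.image (fun ζ => (r : ℂ)⁻¹ * ζ)) ?_ ?_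
  · rw [Finset.card_union_of_disjoint, Finset.card_image_of_injective _ (mul_right_injective₀ hrC),
      Finset.card_image_of_injective _ (mul_right_injective₀ (inv_ne_zero hrC)), hN, two_mul]
    rw [Finset.disjoint_left]
    intro x hx hx'
    simp only [Finset.mem_image] at hx hx'
    obtain ⟨ζ, hζ, rfl⟩ := hx
    obtain ⟨ξ, hξ, he⟩ := hx'
    have := congrArg norm he
    simp only [norm_mul, norm_inv, hNn _ hζ, hNn _ hξ, mul_one, Complex.norm_real,
      Real.norm_eq_abs] at this
    have h1 : |r|⁻¹ < 1 := inv_lt_one_of_one_lt₀ hr1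
    linarith
  · intro z hz
    simp only [Finset.mem_union, Finset.mem_image] at hz
    rcases hz with ⟨ζ, hζ, rfl⟩ | ⟨ζ, hζ, rfl⟩
    · have hζ0 : ζ ≠ 0 := by rintro rfl; simpa using hNn _ hζ
      refine ex_root m hm (t * ζ) _ u ?_ (mul_ne_zero htC hζ0) hu2C hqC ?_
      · rw [mul_pow, hNm ζ hζ, huC, mul_one]
      · rw [hreq]; field_simp
    · have hζ0 : ζ ≠ 0 := by rintro rfl; simpa using hNn _ hζ
      refine ex_root m hm ((t : ℂ)⁻¹ * ζ) _ (u : ℂ)⁻¹ ?_ (mul_ne_zero (inv_ne_zero htC) hζ0) ?_ ?_ ?_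
      · rw [mul_pow, hNm ζ hζ, inv_pow, huC, mul_one]
      · have : (2 - (u : ℂ)⁻¹) = (2 * u - 1) / u := by field_simp
        rw [this]; exact div_ne_zero hu3C hu0C
      · field_simp; linear_combination hqC
      · rw [hreq]; field_simp

/-! generic forms -/

abbrev Sg := ((Fin 3 →₀ ℕ) ⊕ (Fin 3 →₀ ℕ)) ⊕ Fin 3

def gF (d : ℕ) : MvPolynomial (Fin 3) (MvPolynomial Sg ℂ) :=
  ∑ k ∈ Finset.finsuppAntidiag Finset.univ d,
    MvPolynomial.monomial k (MvPolynomial.X (Sum.inl (Sum.inl k)))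

def gG (d : ℕ) : MvPolynomial (Fin 3) (MvPolynomial Sg ℂ) :=
  ∑ k ∈ Finset.finsuppAntidiag Finset.univ d,
    MvPolynomial.monomial k (MvPolynomial.X (Sum.inl (Sum.inr k)))

def gh : Fin 3 → MvPolynomial Sg ℂ := fun i => MvPolynomial.X (Sum.inr i)

lemma sum_homog {F : MvPolynomial (Fin 3) ℂ} {d : ℕ} (hF : F.IsHomogeneous d) :
    ∑ k ∈ Finset.finsuppAntidiag Finset.univ d, MvPolynomial.monomial k (F.coeff k) = F := by
  conv_rhs => rw [F.as_sum]
  symm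
  apply Finset.sum_subset
  · intro k hk
    have h1 := hF (MvPolynomial.mem_support_iff.1 hk)
    rw [Finsupp.weight_apply, Finsupp.sum_fintype _ _ (by simp)] at h1
    simp only [Pi.one_apply, smul_eq_mul, mul_one] at h1
    rw [Finset.mem_finsuppAntidiag]
    exact ⟨h1, Finset.subset_univ _⟩
  · intro k _ hk
    rw [MvPolynomial.notMem_support_iff.1 hk]; simp

lemma map_gF {F G : MvPolynomial (Fin 3) ℂ} {d : ℕ} (hF : F.IsHomogeneous d) (h : Fin 3 → ℂ) :
    MvPolynomial.map (MvPolynomial.eval (Sum.elim (coeffs2 F G) h)) (gF d) = F := by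
  conv_rhs => rw [← sum_homog hF]
  simp [gF, MvPolynomial.map_monomial, coeffs2]

lemma map_gG {F G : MvPolynomial (Fin 3) ℂ} {d : ℕ} (hG : G.IsHomogeneous d) (h : Fin 3 → ℂ) :
    MvPolynomial.map (MvPolynomial.eval (Sum.elim (coeffs2 F G) h)) (gG d) = G := by
  conv_rhs => rw [← sum_homog hG]
  simp [gG, MvPolynomial.map_monomial, coeffs2]

lemma map_gh (F G : MvPolynomial (Fin 3) ℂ) (h : Fin 3 → ℂ) :
    (MvPolynomial.eval (Sum.elim (coeffs2 F G) h)) ∘ gh = h := by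
  ext i; simp [gh]

/-- degree one -/
def Q1 {R : Type*} [CommRing R] (F G : MvPolynomial (Fin 3) R) (h : Fin 3 → R) : R :=
  h 2 * ((rp (e1 h) F h).coeff 0 * (rp (e2 h) G h).coeff 0
    - (rp (e1 h) G h).coeff 0 * (rp (e2 h) F h).coeff 0)

lemma Q1_map {R S : Type*} [CommRing R] [CommRing S] (φ : R →+* S)
    (F G : MvPolynomial (Fin 3) R) (h : Fin 3 → R) :
    Q1 (MvPolynomial.map φ F) (MvPolynomial.map φ G) (φ ∘ h) = φ (Q1 F G h) := by
  simp [Q1, e1_map, e2_map, rp_map]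

lemma count_of_Q1 {F G : MvPolynomial (Fin 3) ℂ} (hF : F.IsHomogeneous 1) (hG : G.IsHomogeneous 1)
    {h : Fin 3 → ℂ} (hQ : Q1 F G h ≠ 0) : membersTangentToLine F G h = ∅ := by
  unfold Q1 at hQ
  have hh : h 2 ≠ 0 := fun h0 => hQ (by simp [h0])
  have hdet := right_ne_zero_of_mul hQ
  rw [Set.eq_empty_iff_forall_notMem]
  intro c
  induction c using Projectivization.ind with
  | h u hu =>
  rw [mk_mem le_rfl hF hG hh]
  rintro ⟨α, β, -, h1, h2⟩
  have key : ∀ e, ∀ M : MvPolynomial (Fin 3) ℂ, M.IsHomogeneous 1 → ∀ p,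
      MvPolynomial.eval p (dirD e M) = (rp e M h).coeff 0 := by
    intro e M hM p
    have h3 := dirD_homog hM e
    rw [rp, (lp_homog h3 _ _).2]
    have h4 := eval_homog h3 0 p
    have h5 := eval_homog h3 0 (e2 h)
    simp only [zero_smul, Nat.sub_self, pow_zero, one_mul] at h4 h5
    rw [← h4, h5]
  rw [key _ _ (homog_comb hF hG _ _), rp_comb] at h1 h2
  simp only [coeff_add, coeff_C_mul] at h1 h2
  apply hu
  ext i; fin_cases i
  · apply (mul_eq_zero.1 (show _ * u 0 = 0 from _)).resolve_left hdet
    linear_combination (rp (e2 h) G h).coeff 0 * h1 - (rp (e1 h) G h).coeff 0 * h2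
  · apply (mul_eq_zero.1 (show _ * u 1 = 0 from _)).resolve_left hdet
    linear_combination (rp (e1 h) F h).coeff 0 * h2 - (rp (e2 h) F h).coeff 0 * h1

lemma ex_Q1 : Q1 (exF 0) (exG 0) exh ≠ 0 := by
  have h0 : ∀ e M, (rp e M exh).coeff 0 = MvPolynomial.eval (e1 exh) (dirD e M) := fun e M => by
    rw [rp, coeff_zero_eq_eval_zero, eval_lp]; simp
  rw [Q1, h0, h0, h0, h0]
  simp [dirD, Fin.sum_univ_three, e1, e2, exh, exF, exG,
      MvPolynomial.pderiv_X, Pi.single_apply]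
  norm_num

end TL

/-- For a general pencil of degree-`d` plane curves and a general line
`L = {h·y = 0} ⊂ ℙ²`, the number of members of the pencil tangent to `L` is
exactly `2d − 2`. -/
theorem members_tangent_to_general_line_count (d : ℕ) (hd : 1 ≤ d) :
    ∃ Q : MvPolynomial (((Fin 3 →₀ ℕ) ⊕ (Fin 3 →₀ ℕ)) ⊕ Fin 3) ℂ,
      (∃ (F G : MvPolynomial (Fin 3) ℂ) (h : Fin 3 → ℂ),
          F.IsHomogeneous d ∧ G.IsHomogeneous d ∧ LinearIndependent ℂ ![F, G] ∧ h ≠ 0 ∧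
          MvPolynomial.eval (Sum.elim (coeffs2 F G) h) Q ≠ 0) ∧
      ∀ (F G : MvPolynomial (Fin 3) ℂ) (h : Fin 3 → ℂ),
        F.IsHomogeneous d → G.IsHomogeneous d → LinearIndependent ℂ ![F, G] → h ≠ 0 →
        MvPolynomial.eval (Sum.elim (coeffs2 F G) h) Q ≠ 0 →
          (membersTangentToLine F G h).Finite ∧
            ((membersTangentToLine F G h).ncard : ℤ) = 2 * (d : ℤ) - 2 := by
  obtain ⟨m, rfl⟩ : ∃ m, d = m + 1 := ⟨d - 1, by omega⟩
  have hne : TL.exh ≠ 0 := fun h0 => by simpa [TL.exh] using congrFun h0 2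
  rcases Nat.eq_zero_or_pos m with rfl | hm
  · refine ⟨TL.Q1 (TL.gF 1) (TL.gG 1) TL.gh, ⟨TL.exF 0, TL.exG 0, TL.exh, TL.exF_homog 0,
      TL.exG_homog 0, TL.ex_li 0, hne, ?_⟩, ?_⟩
    · rw [← TL.Q1_map, TL.map_gF (TL.exF_homog 0), TL.map_gG (TL.exG_homog 0), TL.map_gh]
      exact TL.ex_Q1
    · intro F G h hF hG _ _ hQ
      rw [zero_add] at hF hG
      rw [← TL.Q1_map, TL.map_gF hF, TL.map_gG hG, TL.map_gh] at hQ
      rw [TL.count_of_Q1 hF hG hQ]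
      simp
  · refine ⟨TL.Qf m (TL.gF (m + 1)) (TL.gG (m + 1)) TL.gh, ⟨TL.exF m, TL.exG m, TL.exh,
      TL.exF_homog m, TL.exG_homog m, TL.ex_li m, hne, ?_⟩, ?_⟩
    · rw [← TL.Qf_map, TL.map_gF (TL.exF_homog m), TL.map_gG (TL.exG_homog m), TL.map_gh]
      exact TL.ex_Qf m hm
    · intro F G h hF hG _ _ hQ
      rw [← TL.Qf_map, TL.map_gF hF, TL.map_gG hG, TL.map_gh] at hQ
      obtain ⟨h1, h2⟩ := TL.count_of_Qf hm hF hG hQ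
      refine ⟨h1, ?_⟩
      rw [h2]; push_cast; ring
end
end
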